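/- Fix α ∈ (0,π) with α ≠ 2π/3 and set s = e^{iα}. Define v_n = ∑_{k∈ℤ} ẽ_{n,k} s^k (a finite sum for each n). Then v_n = 0 whenever 3 ∤ n, and as n → ∞ through multiples of 3, v_n ∼ −(3^{5−3α/π} e^{iα} α)/(2π(1+e^{iα}+e^{2iα}) Γ(−3α/(2π))) · n^{−3α/(2π)−1} · 3^n, i.e. the ratio of the two sides tends to 1 along n divisible by 3. -/

import Mathlib

open scoped BigOperators
noncomputable section

abbrev WSt : Type := ℤ × ℕ × ℕ

def cellStep (v w : WSt) : Prop :=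
  w = (v.1, v.2.1 + 1, v.2.2 + 1) ∨
  (1 ≤ v.2.2 ∧ w = (v.1, v.2.1, v.2.2 - 1)) ∨
  (1 ≤ v.2.1 ∧ w = (v.1, v.2.1 - 1, v.2.2)) ∨
  (v.2.1 = 0 ∧ w = (v.1 + 1, v.2.2, 0)) ∨
  (v.2.2 = 0 ∧ w = (v.1 - 1, 0, v.2.1 + 1))

def vertStep (v w : WSt) : Prop :=
  w = (v.1, v.2.1 + 1, v.2.2 + 1) ∨
  (1 ≤ v.2.2 ∧ w = (v.1, v.2.1, v.2.2 - 1)) ∨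
  (1 ≤ v.2.1 ∧ w = (v.1, v.2.1 - 1, v.2.2)) ∨
  (v.2.1 = 0 ∧ 1 ≤ v.2.2 ∧ w = (v.1 + 1, v.2.2 - 1, 0)) ∨
  (v.2.2 = 0 ∧ w = (v.1 - 1, 0, v.2.1 + 2))

def pathCount (step : WSt → WSt → Prop) (n : ℕ) (v : WSt) : ℕ :=
  Nat.card {p : Fin (n + 1) → WSt //
    p 0 = ((0 : ℤ), 0, 0) ∧ p (Fin.last n) = v ∧
    ∀ i : Fin n, step (p i.castSucc) (p i.succ)}

/-- number of cell-centred excursions of length `n` with winding angle `2πk/3` -/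
def eCell (n : ℕ) (k : ℤ) : ℕ := pathCount cellStep n (k, 0, 0)

/-- number of vertex-centred walks of length `n` with winding angle `2πk/3` -/
def eVert (n : ℕ) (k : ℤ) : ℕ := pathCount vertStep n (k, 0, 0)

/-- The series `T_k(u,q)`. -/
def Tk (k : ℕ) (u q : ℂ) : ℂ :=
  ∑' n : ℕ, (-1 : ℂ) ^ n * ((2 * n + 1 : ℕ) : ℂ) ^ k * q ^ (n * (n + 1) / 2) *
    (u ^ (n + 1) - (-1 : ℂ) ^ k * u ^ (-(n : ℤ)))

/-- Jacobi theta function θ₁₁. -/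
def jTheta (z τ : ℂ) : ℂ :=
  ∑' n : ℤ, (-1 : ℂ) ^ n *
    Complex.exp (((2 * (n : ℂ) + 1) / 2) ^ 2 * Complex.I * (Real.pi : ℂ) * τ +
      (2 * (n : ℂ) + 1) * Complex.I * z)

/-- derivative of θ with respect to z -/
def jTheta' (z τ : ℂ) : ℂ := deriv (fun w => jTheta w τ) z

namespace Kreweras

open Filter Topology

/-! ### The transfer operator of the walk -/

/-- Sum of `F` over the states reachable in one step. -/
def stepOp (F : WSt → ℂ) (v : WSt) : ℂ :=
  F (v.1, v.2.1 + 1, v.2.2 + 1) +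
  (if v.2.2 = 0 then F (v.1 - 1, 0, v.2.1 + 2) else F (v.1, v.2.1, v.2.2 - 1)) +
  (if v.2.1 = 0 then (if v.2.2 = 0 then 0 else F (v.1 + 1, v.2.2 - 1, 0))
    else F (v.1, v.2.1 - 1, v.2.2))

/-- The finite set of states reachable in one step. -/
def succs (v : WSt) : Finset WSt :=
  {(v.1, v.2.1 + 1, v.2.2 + 1)} ∪
  (if v.2.2 = 0 then {(v.1 - 1, 0, v.2.1 + 2)} else {(v.1, v.2.1, v.2.2 - 1)}) ∪
  (if v.2.1 = 0 then (if v.2.2 = 0 then ∅ else {(v.1 + 1, v.2.2 - 1, 0)})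
    else {(v.1, v.2.1 - 1, v.2.2)})

lemma mem_succs (v w : WSt) : w ∈ succs v ↔ vertStep v w := by
  obtain ⟨k, a, b⟩ := v
  unfold succs vertStep
  by_cases ha : a = 0 <;> by_cases hb : b = 0 <;>
    (simp [ha, hb, Nat.one_le_iff_ne_zero]; try tauto)

lemma sum_succs (F : WSt → ℂ) (v : WSt) : ∑ w ∈ succs v, F w = stepOp F v := by
  obtain ⟨k, a, b⟩ := v
  unfold succs stepOp
  rw [Finset.sum_union, Finset.sum_union]
  · by_cases ha : a = 0 <;> by_cases hb : b = 0 <;> simp [ha, hb]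
  · by_cases hb : b = 0 <;> simp [hb]
  · by_cases ha : a = 0 <;> by_cases hb : b = 0 <;> simp [ha, hb]; omega

lemma finite_paths_and_card (n : ℕ) (v : WSt) : ∀ u : WSt,
    Finite {p : Fin (n + 1) → WSt // p 0 = u ∧ p (Fin.last n) = v ∧
      ∀ i : Fin n, vertStep (p i.castSucc) (p i.succ)} ∧
    (Nat.card {p : Fin (n + 1) → WSt // p 0 = u ∧ p (Fin.last n) = v ∧
      ∀ i : Fin n, vertStep (p i.castSucc) (p i.succ)} : ℂ) =
      stepOp^[n] (fun w => if w = v then 1 else 0) u := by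
  induction n with
  | zero =>
    intro u
    by_cases h : u = v
    · subst h
      have : Unique {p : Fin (0 + 1) → WSt // p 0 = u ∧ p (Fin.last 0) = u ∧
          ∀ i : Fin 0, vertStep (p i.castSucc) (p i.succ)} :=
        { default := ⟨fun _ => u, by simp⟩
          uniq := fun p => by
            ext1; funext i
            have : i = 0 := Fin.fin_one_eq_zero i
            rw [this]; exact p.2.1 }
      refine ⟨inferInstance, ?_⟩
      rw [Nat.card_unique]; simp
    · have : IsEmpty {p : Fin (0 + 1) → WSt // p 0 = u ∧ p (Fin.last 0) = v ∧
          ∀ i : Fin 0, vertStep (p i.castSucc) (p i.succ)} :=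
        ⟨fun p => h (p.2.1.symm.trans p.2.2.1)⟩
      refine ⟨inferInstance, ?_⟩
      rw [Nat.card_of_isEmpty]; simp [h]
  | succ n ih =>
    intro u
    let X := fun w : succs u => {p : Fin (n + 1) → WSt // p 0 = w ∧ p (Fin.last n) = v ∧
      ∀ i : Fin n, vertStep (p i.castSucc) (p i.succ)}
    let e : {p : Fin (n + 1 + 1) → WSt // p 0 = u ∧ p (Fin.last (n + 1)) = v ∧
        ∀ i : Fin (n + 1), vertStep (p i.castSucc) (p i.succ)} ≃ Σ w : succs u, X w :=
      { toFun := fun p => ⟨⟨p.1 1, by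
            rw [mem_succs]
            have := p.2.2.2 0
            rw [Fin.castSucc_zero, p.2.1] at this
            exact this⟩, ⟨fun i => p.1 i.succ, rfl, p.2.2.1, fun i => p.2.2.2 i.succ⟩⟩
        invFun := fun q => ⟨Fin.cons u q.2.1, rfl, q.2.2.2.1, fun i => by
            refine Fin.cases ?_ (fun j => ?_) i
            · have h := (mem_succs u q.1.1).1 q.1.2
              have h0 := q.2.2.1
              rw [← h0] at h
              exact h
            · exact q.2.2.2.2 j⟩
        left_inv := fun p => by
          ext1; funext i
          refine Fin.cases ?_ (fun j => ?_) i
          · exact p.2.1.symm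
          · rfl
        right_inv := fun q => by
          obtain ⟨⟨w, hw⟩, ⟨p, hp⟩⟩ := q
          have h0 : p 0 = w := hp.1
          subst h0
          rfl }
    have hf : ∀ w : succs u, Finite (X w) := fun w => (ih w).1
    refine ⟨Finite.of_equiv _ e.symm, ?_⟩
    rw [Nat.card_congr e, Nat.card_sigma, Function.iterate_succ_apply', ← sum_succs,
      ← Finset.sum_coe_sort (succs u)]
    push_cast
    exact Finset.sum_congr rfl fun w _ => (ih w).2

lemma exists_finsupp_iterate_stepOp (n : ℕ) : ∀ u : WSt, ∃ c : WSt →₀ ℂ,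
    ∀ F : WSt → ℂ, stepOp^[n] F u = Finsupp.linearCombination ℂ F c := by
  induction n with
  | zero => exact fun u => ⟨Finsupp.single u 1, fun F => by simp⟩
  | succ n ih =>
    intro u
    choose c hc using ih
    refine ⟨∑ w ∈ succs u, c w, fun F => ?_⟩
    rw [Function.iterate_succ_apply', ← sum_succs, map_sum]
    exact Finset.sum_congr rfl fun w _ => hc w F

/-- `n`-step sum of `F` started from the origin. -/
def walkSum (n : ℕ) (F : WSt → ℂ) : ℂ := stepOp^[n] F ((0 : ℤ), 0, 0)

lemma walkSum_zero (F : WSt → ℂ) : walkSum 0 F = F (0, 0, 0) := rfl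

lemma walkSum_succ (n : ℕ) (F : WSt → ℂ) : walkSum (n + 1) F = walkSum n (stepOp F) := rfl

lemma exists_finsupp_walkSum (n : ℕ) : ∃ c : WSt →₀ ℂ,
    ∀ F : WSt → ℂ, walkSum n F = Finsupp.linearCombination ℂ F c :=
  exists_finsupp_iterate_stepOp n _

lemma walkSum_add (n : ℕ) (F G : WSt → ℂ) : walkSum n (F + G) = walkSum n F + walkSum n G := by
  obtain ⟨c, hc⟩ := exists_finsupp_walkSum n
  simp only [hc, Finsupp.linearCombination_apply, Finsupp.sum, Pi.add_apply, smul_add,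
    Finset.sum_add_distrib]

lemma walkSum_smul (n : ℕ) (z : ℂ) (F : WSt → ℂ) : walkSum n (z • F) = z * walkSum n F := by
  obtain ⟨c, hc⟩ := exists_finsupp_walkSum n
  simp only [hc, Finsupp.linearCombination_apply, Finsupp.sum, Pi.smul_apply, smul_eq_mul,
    Finset.mul_sum]
  exact Finset.sum_congr rfl fun w _ => by ring

lemma walkSum_differentiableOn (n : ℕ) (F : ℂ → WSt → ℂ) (U : Set ℂ)
    (hF : ∀ w, DifferentiableOn ℂ (fun z => F z w) U) :
    DifferentiableOn ℂ (fun z => walkSum n (F z)) U := by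
  obtain ⟨c, hc⟩ := exists_finsupp_walkSum n
  simp only [hc, Finsupp.linearCombination_apply, Finsupp.sum, smul_eq_mul]
  exact DifferentiableOn.fun_sum fun w _ => (hF w).const_mul _

lemma norm_stepOp_le (F : WSt → ℂ) (M : ℝ) (hM : ∀ w, ‖F w‖ ≤ M) (u : WSt) :
    ‖stepOp F u‖ ≤ 3 * M := by
  have h0 : 0 ≤ M := (norm_nonneg _).trans (hM u)
  unfold stepOp
  refine (norm_add₃_le).trans ?_
  have h1 := hM (u.1, u.2.1 + 1, u.2.2 + 1)
  have h2 : ‖(if u.2.2 = 0 then F (u.1 - 1, 0, u.2.1 + 2) else F (u.1, u.2.1, u.2.2 - 1))‖ ≤ M := by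
    split_ifs <;> exact hM _
  have h3 : ‖(if u.2.1 = 0 then (if u.2.2 = 0 then 0 else F (u.1 + 1, u.2.2 - 1, 0))
    else F (u.1, u.2.1 - 1, u.2.2))‖ ≤ M := by
    split_ifs
    · simpa using h0
    · exact hM _
    · exact hM _
  linarith

lemma norm_walkSum_le (n : ℕ) : ∀ (F : WSt → ℂ) (M : ℝ), (∀ w, ‖F w‖ ≤ M) →
    ‖walkSum n F‖ ≤ 3 ^ n * M := by
  induction n with
  | zero => intro F M hM; simpa [walkSum_zero] using hM _
  | succ n ih =>
    intro F M hM
    rw [walkSum_succ, pow_succ, mul_assoc]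
    exact ih _ _ (norm_stepOp_le F M hM)

lemma iterate_stepOp_eq_zero (n : ℕ) : ∀ (F : WSt → ℂ) (j : ℕ),
    (∀ w : WSt, ¬ 3 ∣ (w.2.1 + w.2.2 + j) → F w = 0) →
    ∀ w : WSt, ¬ 3 ∣ (w.2.1 + w.2.2 + j + 2 * n) → stepOp^[n] F w = 0 := by
  induction n with
  | zero => intro F j hF w hw; exact hF w hw
  | succ n ih =>
    intro F j hF w hw
    rw [Function.iterate_succ_apply]
    refine ih _ (j + 2) (fun u hu => ?_) w (by convert hw using 2; ring)
    obtain ⟨k, a, b⟩ := u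
    simp only at hu
    unfold stepOp
    simp only
    rw [hF _ (by simp only; omega)]
    have h2 : (if b = 0 then F (k - 1, 0, a + 2) else F (k, a, b - 1)) = 0 := by
      split_ifs
      · exact hF _ (by simp only; omega)
      · exact hF _ (by simp only; omega)
    rw [h2]
    split_ifs
    · simp
    · rw [hF _ (by simp only; omega)]; simp
    · rw [hF _ (by simp only; omega)]; simp

/-- Weight of the excursions. -/
def wtE (s : ℂ) (v : WSt) : ℂ := if v.2.1 = 0 ∧ v.2.2 = 0 then s ^ v.1 else 0

/-- Weight of the walks ending on the first boundary ray. -/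
def wtA (s x : ℂ) (v : WSt) : ℂ := if v.2.2 = 0 then s ^ v.1 * x ^ v.2.1 else 0

/-- Weight of the walks ending on the second boundary ray. -/
def wtB (s y : ℂ) (v : WSt) : ℂ := if v.2.1 = 0 then s ^ v.1 * y ^ v.2.2 else 0

/-- Weight of all walks. -/
def wtG (s x y : ℂ) (v : WSt) : ℂ := s ^ v.1 * x ^ v.2.1 * y ^ v.2.2

lemma tsum_eVert (n : ℕ) (s : ℂ) :
    ∑' k : ℤ, (eVert n k : ℂ) * s ^ k = walkSum n (wtE s) := by
  obtain ⟨c, hc⟩ := exists_finsupp_walkSum n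
  have h1 : ∀ k : ℤ, (eVert n k : ℂ) = c (k, 0, 0) := by
    intro k
    have := (finite_paths_and_card n (k, 0, 0) ((0 : ℤ), 0, 0)).2
    unfold eVert pathCount
    rw [this]
    change walkSum n _ = _
    rw [hc, Finsupp.linearCombination_apply, Finsupp.sum]
    simp [eq_comm]
  have hinj : Function.Injective (fun k : ℤ => ((k, 0, 0) : WSt)) := fun a b h => by
    simpa using h
  have h2 : walkSum n (wtE s) = ∑' w : WSt, c w * wtE s w := by
    rw [hc, Finsupp.linearCombination_apply, Finsupp.sum]
    symm
    simp only [smul_eq_mul]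
    refine tsum_eq_sum fun w hw => ?_
    rw [Finsupp.notMem_support_iff.1 hw, zero_mul]
  rw [h2, ← hinj.tsum_eq]
  · refine tsum_congr fun k => ?_
    simp [h1, wtE]
  · rintro ⟨k, a, b⟩ hw
    simp only [Function.mem_support, wtE] at hw
    by_cases h : a = 0 ∧ b = 0
    · exact ⟨k, by simp [h.1, h.2]⟩
    · simp [h] at hw

lemma walkSum_wtE_eq_zero (n : ℕ) (s : ℂ) (hn : ¬ 3 ∣ n) : walkSum n (wtE s) = 0 := by
  refine iterate_stepOp_eq_zero n _ 0 (fun w hw => ?_) _ (by simp only; omega)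
  unfold wtE
  rw [if_neg]
  rintro ⟨h1, h2⟩
  simp [h1, h2] at hw

lemma stepOp_wtG (s x y : ℂ) (hs : s ≠ 0) :
    (x * y) • stepOp (wtG s x y) = (x ^ 2 * y ^ 2 + x + y) • wtG s x y + (-x) • wtA s x +
      (-y) • wtB s y + (s * y) • wtB s x + (-(s * y)) • wtE s + (s⁻¹ * x * y ^ 3) • wtA s y := by
  funext ⟨k, a, b⟩
  have e1 : s ^ (k + 1) = s ^ k * s := zpow_add_one₀ hs k
  have e2 : s ^ (k - 1) = s ^ k * s⁻¹ := zpow_sub_one₀ hs k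
  simp only [Pi.smul_apply, Pi.add_apply, smul_eq_mul, stepOp, wtG, wtA, wtB, wtE]
  rcases a with _ | a <;> rcases b with _ | b <;> simp [e1, e2] <;> ring

/-! ### Generating functions -/

/-- Generating function of the weighted walks. -/
def genF (F : WSt → ℂ) (t : ℂ) : ℂ := ∑' n : ℕ, t ^ n * walkSum n F

lemma norm_genF_term_le (F : WSt → ℂ) (t : ℂ) (hF : ∀ w, ‖F w‖ ≤ 1) (n : ℕ) :
    ‖t ^ n * walkSum n F‖ ≤ (3 * ‖t‖) ^ n := by
  rw [norm_mul, norm_pow, mul_pow, mul_comm]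
  exact mul_le_mul_of_nonneg_right (by simpa using norm_walkSum_le n F 1 hF) (by positivity)

lemma summable_geometric_three {t : ℂ} (ht : ‖t‖ < 1 / 3) :
    Summable fun n : ℕ => (3 * ‖t‖) ^ n :=
  summable_geometric_of_lt_one (by positivity) (by linarith)

lemma summable_genF (F : WSt → ℂ) {t : ℂ} (ht : ‖t‖ < 1 / 3) (hF : ∀ w, ‖F w‖ ≤ 1) :
    Summable fun n : ℕ => t ^ n * walkSum n F :=
  Summable.of_norm_bounded (summable_geometric_three ht) (norm_genF_term_le F t hF)

lemma norm_wtE_le {s : ℂ} (hs : ‖s‖ = 1) (w : WSt) : ‖wtE s w‖ ≤ 1 := by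
  unfold wtE; split_ifs <;> simp [hs]

lemma norm_wtA_le {s x : ℂ} (hs : ‖s‖ = 1) (hx : ‖x‖ ≤ 1) (w : WSt) : ‖wtA s x w‖ ≤ 1 := by
  unfold wtA
  split_ifs
  · simpa [hs] using pow_le_one₀ (norm_nonneg x) hx
  · simp

lemma norm_wtB_le {s x : ℂ} (hs : ‖s‖ = 1) (hx : ‖x‖ ≤ 1) (w : WSt) : ‖wtB s x w‖ ≤ 1 := by
  unfold wtB
  split_ifs
  · simpa [hs] using pow_le_one₀ (norm_nonneg x) hx
  · simp

lemma norm_wtG_le {s x y : ℂ} (hs : ‖s‖ = 1) (hx : ‖x‖ ≤ 1) (hy : ‖y‖ ≤ 1) (w : WSt) :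
    ‖wtG s x y w‖ ≤ 1 := by
  unfold wtG
  simpa [hs] using
    mul_le_one₀ (pow_le_one₀ (norm_nonneg x) hx) (by positivity) (pow_le_one₀ (norm_nonneg y) hy)

/-- Generating function of the excursions. -/
def genE (s t : ℂ) : ℂ := genF (wtE s) t

/-- Generating function of the walks ending on the first boundary ray. -/
def genA (s t x : ℂ) : ℂ := genF (wtA s x) t

/-- Generating function of the walks ending on the second boundary ray. -/
def genB (s t y : ℂ) : ℂ := genF (wtB s y) t

lemma genA_zero (s t : ℂ) : genA s t 0 = genE s t := by
  unfold genA genE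
  congr 1
  funext ⟨k, a, b⟩
  rcases a with _ | a <;> rcases b with _ | b <;> simp [wtA, wtE]

lemma genB_zero (s t : ℂ) : genB s t 0 = genE s t := by
  unfold genB genE
  congr 1
  funext ⟨k, a, b⟩
  rcases a with _ | a <;> rcases b with _ | b <;> simp [wtB, wtE]

lemma genF_differentiableOn {t : ℂ} (ht : ‖t‖ < 1 / 3) (F : ℂ → WSt → ℂ)
    (hF : ∀ w, DifferentiableOn ℂ (fun z => F z w) (Metric.ball 0 1))
    (hb : ∀ z ∈ Metric.ball (0 : ℂ) 1, ∀ w, ‖F z w‖ ≤ 1) :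
    DifferentiableOn ℂ (fun z => genF (F z) t) (Metric.ball 0 1) := by
  unfold genF
  refine Complex.differentiableOn_tsum_of_summable_norm (summable_geometric_three ht)
    (fun n => (walkSum_differentiableOn n F _ hF).const_mul _) Metric.isOpen_ball ?_
  exact fun n z hz => norm_genF_term_le _ t (hb z hz) n

lemma genA_differentiableOn {s t : ℂ} (hs : ‖s‖ = 1) (ht : ‖t‖ < 1 / 3) :
    DifferentiableOn ℂ (genA s t) (Metric.ball 0 1) := by
  refine genF_differentiableOn ht (fun x => wtA s x) (fun w => ?_) fun z hz w =>
    norm_wtA_le hs (by simpa using (mem_ball_zero_iff.1 hz).le) w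
  unfold wtA
  split_ifs <;> fun_prop

lemma genB_differentiableOn {s t : ℂ} (hs : ‖s‖ = 1) (ht : ‖t‖ < 1 / 3) :
    DifferentiableOn ℂ (genB s t) (Metric.ball 0 1) := by
  refine genF_differentiableOn ht (fun x => wtB s x) (fun w => ?_) fun z hz w =>
    norm_wtB_le hs (by simpa using (mem_ball_zero_iff.1 hz).le) w
  unfold wtB
  split_ifs <;> fun_prop

lemma kernel_identity {s t x y : ℂ} (hs : ‖s‖ = 1) (ht : ‖t‖ < 1 / 3) (hx : ‖x‖ ≤ 1)
    (hy : ‖y‖ ≤ 1) (hk : x * y = t * (x ^ 2 * y ^ 2 + x + y)) :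
    x * y - t * x * genA s t x - t * y * genB s t y + t * s * y * (genB s t x - genE s t)
      + t * s⁻¹ * x * y ^ 3 * genA s t y = 0 := by
  have hs0 : s ≠ 0 := by rintro rfl; simp at hs
  have hG := (summable_genF (wtG s x y) ht (norm_wtG_le hs hx hy)).hasSum
  have hE := (summable_genF (wtE s) ht (norm_wtE_le hs)).hasSum
  have hA := (summable_genF (wtA s x) ht (norm_wtA_le hs hx)).hasSum
  have hB := (summable_genF (wtB s y) ht (norm_wtB_le hs hy)).hasSum
  have hB' := (summable_genF (wtB s x) ht (norm_wtB_le hs hx)).hasSum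
  have hA' := (summable_genF (wtA s y) ht (norm_wtA_le hs hy)).hasSum
  have h1 := ((hasSum_nat_add_iff' 1).2 hG).mul_left (x * y)
  have h2 := (((((hG.mul_left (x ^ 2 * y ^ 2 + x + y)).add (hA.mul_left (-x))).add
    (hB.mul_left (-y))).add (hB'.mul_left (s * y))).add (hE.mul_left (-(s * y)))).add
    (hA'.mul_left (s⁻¹ * x * y ^ 3))
  have h3 := h2.mul_left t
  have key : ∀ n : ℕ, x * y * walkSum (n + 1) (wtG s x y) =
      (x ^ 2 * y ^ 2 + x + y) * walkSum n (wtG s x y) + (-x) * walkSum n (wtA s x)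
        + (-y) * walkSum n (wtB s y) + (s * y) * walkSum n (wtB s x)
        + (-(s * y)) * walkSum n (wtE s) + (s⁻¹ * x * y ^ 3) * walkSum n (wtA s y) := by
    intro n
    rw [walkSum_succ, ← walkSum_smul, stepOp_wtG s x y hs0]
    simp only [walkSum_add, walkSum_smul]
  have h4 := h1.unique (h3.congr_fun fun n => by
    have := key n
    rw [pow_succ]
    linear_combination t ^ n * t * this)
  have hg : genF (wtG s x y) t = ∑' n : ℕ, t ^ n * walkSum n (wtG s x y) := rfl
  have h0 : walkSum 0 (wtG s x y) = 1 := by simp [walkSum_zero, wtG]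
  simp only [Finset.range_one, Finset.sum_singleton, pow_zero, one_mul, h0] at h4
  unfold genA genB genE genF
  linear_combination (-1) * h4 + (∑' n : ℕ, t ^ n * walkSum n (wtG s x y)) * hk

/-! ### Laurent coefficients on an annulus -/

/-- The `n`-th Laurent coefficient of `f` computed on the circle of radius `r`. -/
def lc (f : ℂ → ℂ) (r : ℝ) (n : ℤ) : ℂ :=
  (2 * Real.pi * Complex.I : ℂ)⁻¹ * ∮ z in C(0, r), z ^ (-n - 1) * f z

lemma circleIntegral_annulus_eq {f : ℂ → ℂ} {r₁ r₂ : ℝ} (h1 : 0 < r₁) (h12 : r₁ ≤ r₂)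
    (hf : ∀ z : ℂ, r₁ ≤ ‖z‖ → ‖z‖ ≤ r₂ → DifferentiableAt ℂ f z) :
    (∮ z in C(0, r₂), f z) = ∮ z in C(0, r₁), f z := by
  refine Complex.circleIntegral_eq_of_differentiable_on_annulus_off_countable h1 h12
    Set.countable_empty ?_ ?_
  · rintro z ⟨hz1, hz2⟩
    simp only [Metric.mem_closedBall, dist_zero_right, Metric.mem_ball, not_lt] at hz1 hz2
    exact (hf z hz2 hz1).continuousAt.continuousWithinAt
  · rintro z ⟨⟨hz1, hz2⟩, -⟩
    simp only [Metric.mem_closedBall, dist_zero_right, Metric.mem_ball, not_le] at hz1 hz2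
    exact hf z hz2.le hz1.le

lemma lc_annulus_eq {f : ℂ → ℂ} {r₁ r₂ : ℝ} (h1 : 0 < r₁) (h12 : r₁ ≤ r₂)
    (hf : ∀ z : ℂ, r₁ ≤ ‖z‖ → ‖z‖ ≤ r₂ → DifferentiableAt ℂ f z) (n : ℤ) :
    lc f r₂ n = lc f r₁ n := by
  unfold lc
  rw [circleIntegral_annulus_eq h1 h12]
  intro z hz1 hz2
  have hz : z ≠ 0 := norm_pos_iff.1 (h1.trans_le hz1)
  exact (differentiableAt_zpow.2 (Or.inl hz)).mul (hf z hz1 hz2)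

lemma ne_zero_of_mem_sphere {r : ℝ} (hr : 0 < r) {z : ℂ} (hz : z ∈ Metric.sphere (0 : ℂ) r) :
    z ≠ 0 := by
  rw [mem_sphere_zero_iff_norm] at hz
  exact norm_pos_iff.1 (hz ▸ hr)

lemma circleIntegrable_of_continuousAt {f : ℂ → ℂ} {r : ℝ} (hr : 0 < r)
    (hf : ∀ z : ℂ, ‖z‖ = r → ContinuousAt f z) : CircleIntegrable f 0 r :=
  ContinuousOn.circleIntegrable hr.le fun z hz => (hf z (by simpa using hz)).continuousWithinAt

lemma circleIntegrable_zpow_mul {f : ℂ → ℂ} {r : ℝ} (hr : 0 < r)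
    (hf : ∀ z : ℂ, ‖z‖ = r → ContinuousAt f z) (n : ℤ) :
    CircleIntegrable (fun z => z ^ n * f z) 0 r :=
  circleIntegrable_of_continuousAt hr fun z hz =>
    (continuousAt_zpow₀ z n (Or.inl (norm_pos_iff.1 (hz ▸ hr)))).mul (hf z hz)

lemma lc_congr {f g : ℂ → ℂ} {r : ℝ} (hr : 0 < r) (h : ∀ z : ℂ, ‖z‖ = r → f z = g z) (n : ℤ) :
    lc f r n = lc g r n := by
  unfold lc
  rw [circleIntegral.integral_congr hr.le fun z hz =>
    congrArg (z ^ (-n - 1) * ·) (h z (by simpa using hz))]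

lemma lc_add {f g : ℂ → ℂ} {r : ℝ} (hr : 0 < r) (hf : ∀ z : ℂ, ‖z‖ = r → ContinuousAt f z)
    (hg : ∀ z : ℂ, ‖z‖ = r → ContinuousAt g z) (n : ℤ) :
    lc (fun z => f z + g z) r n = lc f r n + lc g r n := by
  unfold lc
  simp only [mul_add]
  rw [circleIntegral.integral_add (circleIntegrable_zpow_mul hr hf _)
    (circleIntegrable_zpow_mul hr hg _), mul_add]

lemma lc_const_mul (a : ℂ) (f : ℂ → ℂ) (r : ℝ) (n : ℤ) :
    lc (fun z => a * f z) r n = a * lc f r n := by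
  unfold lc
  simp only [mul_left_comm _ a]
  rw [circleIntegral.integral_const_mul, mul_left_comm]

lemma lc_const (a : ℂ) {r : ℝ} (hr : 0 < r) (n : ℤ) :
    lc (fun _ => a) r n = if n = 0 then a else 0 := by
  have h := lc_const_mul a (fun _ => 1) r n
  simp only [mul_one] at h
  rw [h]
  unfold lc
  simp only [mul_one]
  split_ifs with hn
  · subst hn
    have := circleIntegral.integral_sub_center_inv 0 hr.ne'
    simp only [sub_zero] at this
    simp only [neg_zero, zero_sub, zpow_neg_one, this]
    rw [inv_mul_cancel₀ Complex.two_pi_I_ne_zero, mul_one]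
  · have := circleIntegral.integral_sub_zpow_of_ne (n := -n - 1) (by omega) 0 0 r
    simp only [sub_zero] at this
    rw [this]; simp

lemma lc_mul_id (f : ℂ → ℂ) {r : ℝ} (hr : 0 < r) (n : ℤ) :
    lc (fun z => z * f z) r n = lc f r (n - 1) := by
  unfold lc
  congr 1
  refine circleIntegral.integral_congr hr.le fun z hz => ?_
  have hz : z ≠ 0 := ne_zero_of_mem_sphere hr hz
  simp only
  rw [show -(n - 1) - 1 = (-n - 1) + 1 by ring, zpow_add_one₀ hz]
  ring

lemma norm_lc_le {f : ℂ → ℂ} {r M : ℝ} (hr : 0 < r) (hf : ∀ z : ℂ, ‖z‖ = r → ‖f z‖ ≤ M) (n : ℤ) :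
    ‖lc f r n‖ ≤ M * r ^ (-n) := by
  have h := circleIntegral.norm_two_pi_i_inv_smul_integral_le_of_norm_le_const
    (f := fun z => z ^ (-n - 1) * f z) (c := 0) (C := r ^ (-n - 1) * M) hr.le (fun z hz => by
      have hz' : ‖z‖ = r := by simpa using hz
      rw [norm_mul, norm_zpow, hz']
      exact mul_le_mul_of_nonneg_left (hf z hz') (by positivity))
  rw [smul_eq_mul] at h
  refine h.trans (le_of_eq ?_)
  rw [← mul_assoc, ← zpow_one_add₀ hr.ne', mul_comm]
  congr 2; ring

lemma exists_norm_le_of_continuousAt {f : ℂ → ℂ} {r : ℝ}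
    (hf : ∀ z : ℂ, ‖z‖ = r → ContinuousAt f z) : ∃ M : ℝ, ∀ z : ℂ, ‖z‖ = r → ‖f z‖ ≤ M := by
  obtain ⟨M, hM⟩ := (isCompact_sphere (0 : ℂ) r).exists_bound_of_continuousOn (f := f)
    fun z hz => (hf z (by simpa using hz)).continuousWithinAt
  exact ⟨M, fun z hz => hM z (by simpa using hz)⟩

lemma summable_lc_mul_zpow {f : ℂ → ℂ} {r₁ r₂ : ℝ} {w : ℂ} (h1 : 0 < r₁) (hw1 : r₁ < ‖w‖)
    (hw2 : ‖w‖ < r₂) (hf : ∀ z : ℂ, r₁ ≤ ‖z‖ → ‖z‖ ≤ r₂ → DifferentiableAt ℂ f z) :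
    Summable fun n : ℤ => lc f r₂ n * w ^ n := by
  have hw0 : 0 < ‖w‖ := h1.trans hw1
  have h12 := (hw1.trans hw2).le
  have h2 : 0 < r₂ := hw0.trans hw2
  obtain ⟨M1, hM1⟩ := exists_norm_le_of_continuousAt
    (f := f) (r := r₁) fun z hz => (hf z hz.ge (hz.le.trans h12)).continuousAt
  obtain ⟨M2, hM2⟩ := exists_norm_le_of_continuousAt
    (f := f) (r := r₂) fun z hz => (hf z (h12.trans hz.ge) hz.le).continuousAt
  refine Summable.of_nat_of_neg ?_ ?_
  · refine Summable.of_norm_bounded (g := fun n : ℕ => M2 * (‖w‖ / r₂) ^ n)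
      ((summable_geometric_of_lt_one (by positivity) ((div_lt_one h2).2 hw2)).mul_left _)
      fun n => ?_
    rw [norm_mul, norm_zpow, zpow_natCast, div_pow, div_eq_mul_inv, mul_comm (‖w‖ ^ n),
      ← mul_assoc]
    refine mul_le_mul_of_nonneg_right ?_ (by positivity)
    simpa using norm_lc_le h2 hM2 n
  · refine Summable.of_norm_bounded (g := fun n : ℕ => M1 * (r₁ / ‖w‖) ^ n)
      ((summable_geometric_of_lt_one (by positivity) ((div_lt_one hw0).2 hw1)).mul_left _)
      fun n => ?_
    rw [lc_annulus_eq h1 h12 hf, norm_mul, norm_zpow, zpow_neg, zpow_natCast, div_pow,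
      div_eq_mul_inv, ← mul_assoc]
    refine mul_le_mul_of_nonneg_right ?_ (by positivity)
    simpa using norm_lc_le h1 hM1 (-n)

/-- On an annulus a holomorphic function is the sum of its Laurent series. -/
lemma hasSum_lc {f : ℂ → ℂ} {r₁ r₂ : ℝ} {w : ℂ} (h1 : 0 < r₁) (hw1 : r₁ < ‖w‖)
    (hw2 : ‖w‖ < r₂) (hf : ∀ z : ℂ, r₁ ≤ ‖z‖ → ‖z‖ ≤ r₂ → DifferentiableAt ℂ f z) :
    HasSum (fun n : ℤ => lc f r₂ n * w ^ n) (f w) := by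
  have hw0 : w ≠ 0 := norm_pos_iff.1 (h1.trans hw1)
  have h2 : 0 < r₂ := (h1.trans hw1).trans hw2
  have hnhds : {z : ℂ | r₁ < ‖z‖ ∧ ‖z‖ < r₂} ∈ 𝓝 w :=
    ((isOpen_lt continuous_const continuous_norm).inter
      (isOpen_lt continuous_norm continuous_const)).mem_nhds ⟨hw1, hw2⟩
  have hg : ∀ z : ℂ, r₁ ≤ ‖z‖ → ‖z‖ ≤ r₂ → DifferentiableAt ℂ (dslope f w) z := by
    intro z hz1 hz2
    by_cases hzw : z = w
    · subst hzw
      exact ((Complex.differentiableOn_dslope hnhds).2 fun u hu =>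
        (hf u hu.1.le hu.2.le).differentiableWithinAt).differentiableAt hnhds
    · exact (differentiableAt_dslope_of_ne hzw).2 (hf z hz1 hz2)
  have hgc : ∀ z : ℂ, ‖z‖ = r₂ → ContinuousAt (dslope f w) z := fun z hz =>
    (hg z ((hw1.trans hw2).le.trans hz.ge) hz.le).continuousAt
  have hcoef : ∀ n : ℤ, lc f r₂ n = (if n = 0 then f w else 0) + lc (dslope f w) r₂ (n - 1)
      + (-w) * lc (dslope f w) r₂ n := by
    intro n
    have c1 : ∀ z : ℂ, ‖z‖ = r₂ → ContinuousAt (fun z => z * dslope f w z) z := fun z hz =>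
      continuousAt_id.mul (hgc z hz)
    have c2 : ∀ z : ℂ, ‖z‖ = r₂ → ContinuousAt (fun z => f w + z * dslope f w z) z := fun z hz =>
      continuousAt_const.add (c1 z hz)
    have c3 : ∀ z : ℂ, ‖z‖ = r₂ → ContinuousAt (fun z => -w * dslope f w z) z := fun z hz =>
      continuousAt_const.mul (hgc z hz)
    rw [← lc_const (f w) h2, ← lc_mul_id _ h2, ← lc_const_mul, ← lc_add h2
      (fun _ _ => continuousAt_const) c1, ← lc_add h2 c2 c3]
    refine lc_congr h2 (fun z _ => ?_) n
    have := sub_smul_dslope f w z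
    rw [smul_eq_mul] at this
    linear_combination -this
  have hS := (summable_lc_mul_zpow h1 hw1 hw2 hg).mul_right w
  have hS' : HasSum (fun n : ℤ => lc (dslope f w) r₂ (n - 1) * w ^ (n - 1) * w)
      (∑' n : ℤ, lc (dslope f w) r₂ n * w ^ n * w) :=
    ((Equiv.subRight (1 : ℤ)).hasSum_iff (f := fun n : ℤ => lc (dslope f w) r₂ n * w ^ n * w)).2
      hS.hasSum
  have h3 := ((hasSum_ite_eq (0 : ℤ) (f w)).add hS').sub hS.hasSum
  rw [add_sub_cancel_right] at h3
  refine h3.congr_fun fun n => ?_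
  rw [hcoef, zpow_sub_one₀ hw0]
  split_ifs with hn
  · subst hn; simp [hw0]; ring
  · field_simp; ring

lemma circleIntegral_dilate (f : ℂ → ℂ) (q : ℂ) (r : ℝ) :
    (∮ z in C(0, ‖q‖ * r), f z) = ∮ z in C(0, r), q * f (q * z) := by
  have hq : q = ‖q‖ * Complex.exp (q.arg * Complex.I) := (Complex.norm_mul_exp_arg_mul_I q).symm
  have hmap : ∀ θ : ℝ, q * circleMap 0 r θ = circleMap 0 (‖q‖ * r) (θ + q.arg) := by
    intro θ
    conv_lhs => rw [hq]
    simp only [circleMap]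
    push_cast
    rw [add_mul, Complex.exp_add]
    ring
  have hper : Function.Periodic (fun θ : ℝ => deriv (circleMap (0 : ℂ) (‖q‖ * r)) θ •
      f (circleMap (0 : ℂ) (‖q‖ * r) θ)) (2 * Real.pi) := by
    intro θ
    simp only [deriv_circleMap, periodic_circleMap (0 : ℂ) (‖q‖ * r) θ]
  unfold circleIntegral
  have h1 := hper.intervalIntegral_add_eq 0 q.arg
  rw [zero_add] at h1
  rw [h1, show ∫ x in q.arg..q.arg + 2 * Real.pi, deriv (circleMap (0 : ℂ) (‖q‖ * r)) x •
      f (circleMap 0 (‖q‖ * r) x) = ∫ x in (0 + q.arg)..(2 * Real.pi + q.arg),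
      deriv (circleMap (0 : ℂ) (‖q‖ * r)) x • f (circleMap 0 (‖q‖ * r) x) by
    rw [zero_add, add_comm q.arg],
    ← intervalIntegral.integral_comp_add_right (fun x => deriv (circleMap (0 : ℂ) (‖q‖ * r)) x •
      f (circleMap 0 (‖q‖ * r) x))]
  refine intervalIntegral.integral_congr fun θ _ => ?_
  simp only [deriv_circleMap, ← hmap, smul_eq_mul]
  ring

lemma lc_dilate (f : ℂ → ℂ) {q : ℂ} (hq : q ≠ 0) {r : ℝ} (hr : 0 < r) (n : ℤ) :
    lc (fun z => f (q * z)) r n = q ^ n * lc f (‖q‖ * r) n := by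
  unfold lc
  have key : (∮ z in C(0, r), z ^ (-n - 1) * f (q * z)) =
      ∮ z in C(0, r), q ^ n * (q * ((q * z) ^ (-n - 1) * f (q * z))) := by
    refine circleIntegral.integral_congr hr.le fun z hz => ?_
    have hz : z ≠ 0 := ne_zero_of_mem_sphere hr hz
    rw [mul_zpow, show -n - 1 = -(n + 1) by ring, zpow_neg q, zpow_add_one₀ hq]
    have := zpow_ne_zero n hq
    field_simp
  rw [key, circleIntegral_dilate (fun z => z ^ (-n - 1) * f z),
    circleIntegral.integral_const_mul]
  ring

/-- Difference of two circle integrals around a double pole. -/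
lemma circleIntegral_double_pole {G : ℂ → ℂ} {r₁ r₂ : ℝ} {w : ℂ} (h1 : 0 < r₁) (hw1 : r₁ < ‖w‖)
    (hw2 : ‖w‖ < r₂) (hG : ∀ z : ℂ, r₁ ≤ ‖z‖ → ‖z‖ ≤ r₂ → DifferentiableAt ℂ G z) :
    (∮ z in C(0, r₂), G z / (z - w) ^ 2) - (∮ z in C(0, r₁), G z / (z - w) ^ 2) =
      2 * Real.pi * Complex.I * deriv G w := by
  have h2 : 0 < r₂ := (h1.trans hw1).trans hw2
  have hnhds : {z : ℂ | r₁ < ‖z‖ ∧ ‖z‖ < r₂} ∈ 𝓝 w :=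
    ((isOpen_lt continuous_const continuous_norm).inter
      (isOpen_lt continuous_norm continuous_const)).mem_nhds ⟨hw1, hw2⟩
  have hd : ∀ f : ℂ → ℂ, (∀ z : ℂ, r₁ ≤ ‖z‖ → ‖z‖ ≤ r₂ → DifferentiableAt ℂ f z) →
      ∀ z : ℂ, r₁ ≤ ‖z‖ → ‖z‖ ≤ r₂ → DifferentiableAt ℂ (dslope f w) z := by
    intro f hf z hz1 hz2
    by_cases hzw : z = w
    · subst hzw
      exact ((Complex.differentiableOn_dslope hnhds).2 fun u hu =>
        (hf u hu.1.le hu.2.le).differentiableWithinAt).differentiableAt hnhds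
    · exact (differentiableAt_dslope_of_ne hzw).2 (hf z hz1 hz2)
  set K := dslope (dslope G w) w with hK
  have hKd := hd _ (hd _ hG)
  have hexp : ∀ z : ℂ, z ≠ w → G z / (z - w) ^ 2 =
      G w * (z - w) ^ (-2 : ℤ) + (deriv G w * (z - w)⁻¹ + K z) := by
    intro z hz
    have e1 := sub_smul_dslope G w z
    have e2 := sub_smul_dslope (dslope G w) w z
    rw [smul_eq_mul] at e1 e2
    rw [dslope_same] at e2
    have hz' : z - w ≠ 0 := sub_ne_zero.2 hz
    rw [zpow_neg]
    field_simp
    rw [← hK] at e2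
    linear_combination (-1 : ℂ) * e1 - (z - w) * e2
  have hint : ∀ r : ℝ, 0 < r → r₁ ≤ r → r ≤ r₂ → r ≠ ‖w‖ →
      (∮ z in C(0, r), G z / (z - w) ^ 2) =
        deriv G w * (∮ z in C(0, r), (z - w)⁻¹) + ∮ z in C(0, r), K z := by
    intro r hr hr1 hr2 hne
    have hnw : ∀ z : ℂ, ‖z‖ = r → z ≠ w := fun z hz h => hne (by rw [← hz, h])
    rw [circleIntegral.integral_congr hr.le (g := fun z =>
      G w * (z - w) ^ (-2 : ℤ) + (deriv G w * (z - w)⁻¹ + K z))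
      fun z hz => hexp z (hnw z (by simpa using hz))]
    have c1 : ∀ z : ℂ, ‖z‖ = r → ContinuousAt (fun z => (z - w)⁻¹) z := fun z hz =>
      (continuousAt_id.sub continuousAt_const).inv₀ (sub_ne_zero.2 (hnw z hz))
    have c2 : ∀ z : ℂ, ‖z‖ = r → ContinuousAt (fun z => G w * (z - w) ^ (-2 : ℤ)) z := fun z hz =>
      continuousAt_const.mul ((continuousAt_id.sub continuousAt_const).zpow₀ _
        (Or.inl (sub_ne_zero.2 (hnw z hz))))
    have c3 : ∀ z : ℂ, ‖z‖ = r → ContinuousAt K z := fun z hz =>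
      (hKd z (hr1.trans hz.ge) (hz.le.trans hr2)).continuousAt
    have c4 : ∀ z : ℂ, ‖z‖ = r → ContinuousAt (fun z => deriv G w * (z - w)⁻¹) z := fun z hz =>
      continuousAt_const.mul (c1 z hz)
    have c5 : ∀ z : ℂ, ‖z‖ = r → ContinuousAt (fun z => deriv G w * (z - w)⁻¹ + K z) z :=
      fun z hz => (c4 z hz).add (c3 z hz)
    rw [circleIntegral.integral_add (circleIntegrable_of_continuousAt hr c2)
      (circleIntegrable_of_continuousAt hr c5),
      circleIntegral.integral_add (circleIntegrable_of_continuousAt hr c4)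
      (circleIntegrable_of_continuousAt hr c3),
      circleIntegral.integral_const_mul, circleIntegral.integral_const_mul,
      circleIntegral.integral_sub_zpow_of_ne (by norm_num)]
    ring
  have h12 := (hw1.trans hw2).le
  rw [hint r₂ h2 h12 le_rfl hw2.ne', hint r₁ h1 le_rfl h12 hw1.ne,
    circleIntegral_annulus_eq h1 h12 hKd,
    circleIntegral.integral_sub_inv_of_mem_ball (by simpa using hw2)]
  have hz : (∮ z in C(0, r₁), (z - w)⁻¹) = 0 := by
    refine Complex.circleIntegral_eq_zero_of_differentiable_on_off_countable h1.le
      Set.countable_empty ?_ ?_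
    · intro z hz
      refine ((continuousAt_id.sub continuousAt_const).inv₀ (sub_ne_zero.2 ?_)).continuousWithinAt
      rintro rfl
      exact hw1.not_ge (by simpa using hz)
    · rintro z ⟨hz, -⟩
      refine (differentiableAt_id.sub_const _).inv (sub_ne_zero.2 ?_)
      rintro rfl
      exact hw1.not_gt (by simpa using hz)
  rw [hz]
  ring

/-! ### Infinite products -/

/-- The infinite `q`-Pochhammer symbol. -/
def qP (Z q : ℂ) : ℂ := ∏' n : ℕ, (1 + -(Z * q ^ n))

lemma summable_qP (Z : ℂ) {q : ℂ} (hq : ‖q‖ < 1) : Summable fun n : ℕ => ‖-(Z * q ^ n)‖ := by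
  simp only [norm_neg, norm_mul, norm_pow]
  exact (summable_geometric_of_lt_one (norm_nonneg _) hq).mul_left _

lemma multipliable_qP (Z : ℂ) {q : ℂ} (hq : ‖q‖ < 1) :
    Multipliable fun n : ℕ => 1 + -(Z * q ^ n) :=
  multipliable_one_add_of_summable (summable_qP Z hq)

lemma qP_ne_zero {Z q : ℂ} (hq : ‖q‖ < 1) (h : ∀ n : ℕ, Z * q ^ n ≠ 1) : qP Z q ≠ 0 :=
  tprod_one_add_ne_zero_of_summable (fun n h0 => h n (by linear_combination -h0))
    (summable_qP Z hq)

lemma qP_ne_zero_of_norm_lt {Z q : ℂ} (hq : ‖q‖ < 1) (h : ‖Z‖ < 1) : qP Z q ≠ 0 := by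
  refine qP_ne_zero hq fun n hn => ?_
  have := congrArg norm hn
  rw [norm_mul, norm_pow, norm_one] at this
  have h2 : ‖q‖ ^ n ≤ 1 := pow_le_one₀ (norm_nonneg _) hq.le
  nlinarith [norm_nonneg Z, norm_nonneg q]

lemma qP_succ (Z : ℂ) {q : ℂ} (hq : ‖q‖ < 1) : qP Z q = (1 - Z) * qP (Z * q) q := by
  have e : ∀ n : ℕ, 1 + -(Z * q * q ^ n) = 1 + -(Z * q ^ (n + 1)) := fun n => by ring
  have h : Multipliable fun n : ℕ => 1 + -(Z * q ^ (n + 1)) :=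
    (multipliable_qP (Z * q) hq).congr e
  have h2 := tprod_eq_zero_mul' (f := fun n : ℕ => 1 + -(Z * q ^ n)) h
  have h3 : qP (Z * q) q = ∏' n : ℕ, (1 + -(Z * q ^ (n + 1))) := tprod_congr e
  rw [h3]
  refine h2.trans ?_
  rw [pow_zero, mul_one, ← sub_eq_add_neg]

lemma qP_one {q : ℂ} (hq : ‖q‖ < 1) : qP 1 q = 0 := by
  rw [qP_succ 1 hq]; simp

lemma qP_zero (q : ℂ) : qP 0 q = 1 := by simp [qP]

lemma norm_qP_sub_one_le (Z : ℂ) {q : ℂ} (hq : ‖q‖ < 1) :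
    ‖qP Z q - 1‖ ≤ Real.exp (‖Z‖ / (1 - ‖q‖)) - 1 := by
  have h1 : Tendsto (fun n : ℕ => ‖∏ i ∈ Finset.range n, (1 + -(Z * q ^ i)) - 1‖) atTop
      (𝓝 ‖qP Z q - 1‖) :=
    (((multipliable_qP Z hq).hasProd.tendsto_prod_nat).sub_const 1).norm
  refine le_of_tendsto h1 (Eventually.of_forall fun n => ?_)
  refine (Finset.norm_prod_one_add_sub_one_le _ _).trans ?_
  refine sub_le_sub_right (Real.exp_le_exp.2 ?_) 1
  refine ((summable_qP Z hq).sum_le_tsum _ fun _ _ => norm_nonneg _).trans (le_of_eq ?_)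
  simp only [norm_neg, norm_mul, norm_pow]
  rw [tsum_mul_left, tsum_geometric_of_lt_one (norm_nonneg _) hq, div_eq_mul_inv]

lemma multipliableLocallyUniformlyOn_qP {Z q : ℂ → ℂ} {s : Set ℂ} (hs : IsOpen s)
    (hZ : ContinuousOn Z s) (hq : ContinuousOn q s) (h1 : ∀ u ∈ s, ‖q u‖ < 1) :
    MultipliableLocallyUniformlyOn (fun (n : ℕ) u => 1 + -(Z u * q u ^ n)) s := by
  use fun u => ∏' n : ℕ, (1 + -(Z u * q u ^ n))
  apply hasProdLocallyUniformlyOn_of_forall_compact hs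
  intro K hK hcK
  rcases K.eq_empty_or_nonempty with hN | hN
  · simp [hasProdUniformlyOn_iff_tendstoUniformlyOn, hN, tendstoUniformlyOn_empty]
  · obtain ⟨q₀, hq₀, HB⟩ := hcK.exists_isMaxOn hN (hq.norm.mono hK)
    obtain ⟨C, hC⟩ := hcK.exists_bound_of_continuousOn (hZ.mono hK)
    refine ((summable_geometric_of_lt_one (norm_nonneg _) (h1 _ (hK hq₀))).mul_left
      C).hasProdUniformlyOn_nat_one_add hcK (.of_forall fun n x hx => ?_) (fun n => ?_)
    · rw [norm_neg, norm_mul, norm_pow]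
      exact mul_le_mul (hC x hx) (pow_le_pow_left₀ (norm_nonneg _) (HB hx) n) (by positivity)
        ((norm_nonneg _).trans (hC x hx))
    · exact (((hZ.mono hK).mul ((hq.mono hK).pow n)).neg)

lemma qP_differentiableOn {Z q : ℂ → ℂ} {s : Set ℂ} (hs : IsOpen s)
    (hZ : DifferentiableOn ℂ Z s) (hq : DifferentiableOn ℂ q s) (h1 : ∀ u ∈ s, ‖q u‖ < 1) :
    DifferentiableOn ℂ (fun u => qP (Z u) (q u)) s :=
  (multipliableLocallyUniformlyOn_qP hs hZ.continuousOn hq.continuousOn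
    h1).hasProdLocallyUniformlyOn.differentiableOn (.of_forall fun t => by
      refine (DifferentiableOn.finsetProd (f := fun (n : ℕ) u => 1 + -(Z u * q u ^ n)) (u := t)
        fun n _ => (hZ.mul (hq.pow n)).neg.const_add 1).congr fun u _ => ?_
      simp) hs

lemma qP_differentiable_left {q : ℂ} (hq : ‖q‖ < 1) : Differentiable ℂ (fun Z => qP Z q) := by
  rw [← differentiableOn_univ]
  exact qP_differentiableOn isOpen_univ differentiableOn_id (differentiableOn_const q)
    fun _ _ => hq

lemma summable_qP_logDeriv (Z q Z' q' : ℂ) (hq : ‖q‖ < 1) :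
    Summable fun n : ℕ => -(Z' * q ^ n + Z * (n * q ^ (n - 1) * q')) / (1 + -(Z * q ^ n)) := by
  have h0 : Tendsto (fun n : ℕ => (1 + -(Z * q ^ n))⁻¹) atTop (𝓝 1) := by
    have := (((tendsto_pow_atTop_nhds_zero_of_norm_lt_one hq).const_mul Z).neg.const_add
      1).inv₀ (by simp)
    simpa using this
  have hO : (fun n : ℕ => (1 + -(Z * q ^ n))⁻¹) =O[atTop] (fun _ => (1 : ℝ)) :=
    h0.isBigO_one ℝ
  have hsum : Summable fun n : ℕ => ‖Z'‖ * ‖q‖ ^ n + ‖Z‖ * ‖q'‖ * (n * ‖q‖ ^ (n - 1)) := by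
    refine ((summable_geometric_of_lt_one (norm_nonneg _) hq).mul_left _).add (Summable.mul_left _ ?_)
    rw [← summable_nat_add_iff 1]
    have := (summable_pow_mul_geometric_of_norm_lt_one (R := ℝ) 1 (r := ‖q‖) (by simpa using hq)).add
      (summable_geometric_of_lt_one (norm_nonneg _) hq)
    refine this.congr fun n => ?_
    simp only [Nat.add_sub_cancel]; push_cast; ring
  refine summable_of_isBigO_nat hsum ?_
  have hO2 : (fun n : ℕ => -(Z' * q ^ n + Z * (n * q ^ (n - 1) * q'))) =O[atTop]
      (fun n : ℕ => ‖Z'‖ * ‖q‖ ^ n + ‖Z‖ * ‖q'‖ * (n * ‖q‖ ^ (n - 1))) := by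
    refine Asymptotics.IsBigO.of_bound 1 (Eventually.of_forall fun n => ?_)
    rw [norm_neg, one_mul, Real.norm_of_nonneg (by positivity)]
    refine (norm_add_le _ _).trans (le_of_eq ?_)
    simp only [norm_mul, norm_pow, Complex.norm_natCast]
    ring
  simpa [div_eq_mul_inv] using hO2.mul hO

lemma logDeriv_qP {Z q : ℂ → ℂ} {s : Set ℂ} (hs : IsOpen s)
    (hZ : DifferentiableOn ℂ Z s) (hq : DifferentiableOn ℂ q s) (h1 : ∀ u ∈ s, ‖q u‖ < 1)
    {x : ℂ} (hx : x ∈ s) (hne : ∀ n : ℕ, Z x * q x ^ n ≠ 1) :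
    HasSum (fun n : ℕ => -(deriv Z x * q x ^ n + Z x * (n * q x ^ (n - 1) * deriv q x)) /
      (1 + -(Z x * q x ^ n))) (logDeriv (fun u => qP (Z u) (q u)) x) := by
  have hd : ∀ n : ℕ, logDeriv (fun u => 1 + -(Z u * q u ^ n)) x =
      -(deriv Z x * q x ^ n + Z x * (n * q x ^ (n - 1) * deriv q x)) /
      (1 + -(Z x * q x ^ n)) := by
    intro n
    have hZ' := (hZ.differentiableAt (hs.mem_nhds hx)).hasDerivAt
    have hq' := (hq.differentiableAt (hs.mem_nhds hx)).hasDerivAt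
    have h : HasDerivAt (fun u => 1 + -(Z u * q u ^ n))
        (-(deriv Z x * q x ^ n + Z x * (n * q x ^ (n - 1) * deriv q x))) x :=
      (hZ'.mul (hq'.pow n)).neg.const_add 1
    rw [logDeriv_apply, h.deriv]
  have hS := summable_qP_logDeriv (Z x) (q x) (deriv Z x) (deriv q x) (h1 x hx)
  have := logDeriv_tprod_eq_tsum hs hx (f := fun (n : ℕ) u => 1 + -(Z u * q u ^ n))
    (fun n h0 => hne n (by linear_combination -h0))
    (fun n => (hZ.mul (hq.pow n)).neg.const_add 1)
    (hS.congr fun n => (hd n).symm)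
    (multipliableLocallyUniformlyOn_qP hs hZ.continuousOn hq.continuousOn h1)
    (qP_ne_zero (h1 x hx) hne)
  unfold qP
  rw [this, tsum_congr hd]
  exact hS.hasSum

lemma qP_trisect (Z : ℂ) {q : ℂ} (hq : ‖q‖ < 1) :
    qP Z (q ^ 3) * qP (q * Z) (q ^ 3) * qP (q ^ 2 * Z) (q ^ 3) = qP Z q := by
  have hq3 : ‖q ^ 3‖ < 1 := by
    rw [norm_pow]; exact pow_lt_one₀ (norm_nonneg _) hq (by norm_num)
  have h1 := (((multipliable_qP Z hq3).hasProd.tendsto_prod_nat).mul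
    ((multipliable_qP (q * Z) hq3).hasProd.tendsto_prod_nat)).mul
    ((multipliable_qP (q ^ 2 * Z) hq3).hasProd.tendsto_prod_nat)
  have h2 := ((multipliable_qP Z hq).hasProd.tendsto_prod_nat).comp
    (tendsto_id.const_mul_atTop' (r := 3) (by norm_num))
  refine tendsto_nhds_unique h1 (h2.congr fun n => ?_)
  simp only [Function.comp, id]
  induction n with
  | zero => simp
  | succ n ih =>
    rw [show 3 * (n + 1) = 3 * n + 1 + 1 + 1 by ring, Finset.prod_range_succ,
      Finset.prod_range_succ, Finset.prod_range_succ, ih, Finset.prod_range_succ,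
      Finset.prod_range_succ, Finset.prod_range_succ]
    ring

lemma qP_cube (Z ω : ℂ) (hω : 1 + ω + ω ^ 2 = 0) {q : ℂ} (hq : ‖q‖ < 1) :
    qP Z q * qP (ω * Z) q * qP (ω ^ 2 * Z) q = qP (Z ^ 3) (q ^ 3) := by
  unfold qP
  rw [← (multipliable_qP Z hq).tprod_mul (multipliable_qP _ hq),
    ← ((multipliable_qP Z hq).mul (multipliable_qP _ hq)).tprod_mul (multipliable_qP _ hq)]
  refine tprod_congr fun n => ?_
  have h3 : ω ^ 3 = 1 := by linear_combination (ω - 1) * hω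
  linear_combination (-(Z * q ^ n) + (Z * q ^ n) ^ 2 * ω) * hω - (Z * q ^ n) ^ 3 * h3

/-- The theta product `(Z; q)(q / Z; q)`. -/
def jT (Z q : ℂ) : ℂ := qP Z q * qP (q / Z) q

lemma jT_div (Z : ℂ) {q : ℂ} (hq0 : q ≠ 0) : jT (q / Z) q = jT Z q := by
  unfold jT
  rw [div_div_cancel₀ hq0, mul_comm]

lemma jT_inv {Z q : ℂ} (hZ : Z ≠ 0) (hq : ‖q‖ < 1) : jT Z⁻¹ q = -Z⁻¹ * jT Z q := by
  unfold jT
  rw [qP_succ Z hq, qP_succ Z⁻¹ hq, div_inv_eq_mul, mul_comm q Z, div_eq_mul_inv, mul_comm q]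
  field_simp
  ring

lemma jT_mul {Z q : ℂ} (hZ : Z ≠ 0) (hq0 : q ≠ 0) (hq : ‖q‖ < 1) :
    jT (q * Z) q = -Z⁻¹ * jT Z q := by
  rw [← jT_inv hZ hq, ← jT_div (q * Z) hq0]
  congr 1
  field_simp

lemma jT_one {q : ℂ} (hq : ‖q‖ < 1) : jT 1 q = 0 := by
  unfold jT; rw [qP_one hq, zero_mul]

lemma jT_differentiableAt {Z q : ℂ} (hZ : Z ≠ 0) (hq : ‖q‖ < 1) :
    DifferentiableAt ℂ (fun Z => jT Z q) Z := by
  unfold jT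
  exact (qP_differentiable_left hq Z).mul ((qP_differentiable_left hq _).comp Z
    ((differentiableAt_const q).div differentiableAt_id hZ))

lemma jT_ne_zero {Z q : ℂ} (hq : ‖q‖ < 1) (h1 : ∀ n : ℕ, Z * q ^ n ≠ 1)
    (h2 : ∀ n : ℕ, q / Z * q ^ n ≠ 1) : jT Z q ≠ 0 :=
  mul_ne_zero (qP_ne_zero hq h1) (qP_ne_zero hq h2)

lemma jT_trisect {Z q : ℂ} (hZ : Z ≠ 0) (hq0 : q ≠ 0) (hq : ‖q‖ < 1) :
    jT Z (q ^ 3) * jT (q * Z) (q ^ 3) * jT (q ^ 2 * Z) (q ^ 3) = jT Z q := by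
  unfold jT
  rw [← qP_trisect Z hq, ← qP_trisect (q / Z) hq,
    show q ^ 3 / Z = q ^ 2 * (q / Z) by field_simp,
    show q ^ 3 / (q * Z) = q * (q / Z) by field_simp,
    show q ^ 3 / (q ^ 2 * Z) = q / Z by field_simp]
  ring

lemma hasDerivAt_jT_one {q : ℂ} (hq : ‖q‖ < 1) :
    HasDerivAt (fun Z => jT Z q) (-(qP q q) ^ 2) 1 := by
  have h : (fun Z => jT Z q) = fun Z => (1 - Z) * (qP (Z * q) q * qP (q / Z) q) := by
    funext Z; unfold jT; rw [qP_succ Z hq, mul_assoc]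
  rw [h]
  have h1 : HasDerivAt (fun Z : ℂ => 1 - Z) (-1) 1 := (hasDerivAt_id 1).const_sub 1
  have h2 : DifferentiableAt ℂ (fun Z => qP (Z * q) q * qP (q / Z) q) 1 :=
    ((qP_differentiable_left hq _).comp (1 : ℂ) (differentiableAt_id.mul_const q)).mul
      ((qP_differentiable_left hq _).comp (1 : ℂ)
        ((differentiableAt_const q).div differentiableAt_id one_ne_zero))
  refine (h1.mul h2.hasDerivAt).congr_deriv ?_
  simp only [one_mul, div_one, sub_self, zero_mul, add_zero]
  ring

/-! ### Uniqueness of theta functions and its consequences -/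

lemma lc_theta {f : ℂ → ℂ} {q : ℂ} (hq0 : q ≠ 0) (hq : ‖q‖ < 1)
    (hd : ∀ Z : ℂ, Z ≠ 0 → DifferentiableAt ℂ f Z)
    (hf : ∀ Z : ℂ, Z ≠ 0 → Z * f (q * Z) = -f Z) (n : ℤ) :
    lc f 1 (n + 1) = -(q ^ n * lc f 1 n) := by
  have h1 : lc (fun Z => Z * f (q * Z)) 1 (n + 1) = q ^ n * lc f 1 n := by
    rw [lc_mul_id _ one_pos, lc_dilate f hq0 one_pos, mul_one, add_sub_cancel_right,
      ← lc_annulus_eq (norm_pos_iff.2 hq0) hq.le fun z hz _ =>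
        hd z (norm_pos_iff.1 ((norm_pos_iff.2 hq0).trans_le hz))]
  have h2 : lc (fun Z => Z * f (q * Z)) 1 (n + 1) = lc (fun Z => (-1) * f Z) 1 (n + 1) :=
    lc_congr one_pos (fun z hz => by
      rw [hf z (norm_pos_iff.1 (by rw [hz]; exact one_pos))]; ring) _
  rw [lc_const_mul] at h2
  linear_combination h2 - h1

/-- The space of theta functions of degree one is one dimensional. -/
lemma theta_unique {f g : ℂ → ℂ} {q : ℂ} (hq0 : q ≠ 0) (hq : ‖q‖ < 1)
    (hdf : ∀ Z : ℂ, Z ≠ 0 → DifferentiableAt ℂ f Z)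
    (hf : ∀ Z : ℂ, Z ≠ 0 → Z * f (q * Z) = -f Z)
    (hdg : ∀ Z : ℂ, Z ≠ 0 → DifferentiableAt ℂ g Z)
    (hg : ∀ Z : ℂ, Z ≠ 0 → Z * g (q * Z) = -g Z)
    (hg0 : ∃ Z : ℂ, Z ≠ 0 ∧ g Z ≠ 0) : ∃ k : ℂ, ∀ Z : ℂ, Z ≠ 0 → f Z = k * g Z := by
  have hprop : ∀ n : ℤ, lc g 1 0 * lc f 1 n = lc f 1 0 * lc g 1 n := by
    intro n
    induction n using Int.induction_on with
    | zero => ring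
    | succ n ih =>
      rw [lc_theta hq0 hq hdf hf, lc_theta hq0 hq hdg hg]
      linear_combination (-q ^ (n : ℤ)) * ih
    | pred n ih =>
      have e1 := lc_theta hq0 hq hdf hf (-(n : ℤ) - 1)
      have e2 := lc_theta hq0 hq hdg hg (-(n : ℤ) - 1)
      rw [sub_add_cancel] at e1 e2
      rw [e1, e2] at ih
      refine mul_left_cancel₀ (zpow_ne_zero (-(n : ℤ) - 1) hq0) ?_
      linear_combination -ih
  have hser : ∀ (F : ℂ → ℂ), (∀ Z : ℂ, Z ≠ 0 → DifferentiableAt ℂ F Z) → ∀ Z : ℂ, Z ≠ 0 →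
      HasSum (fun n : ℤ => lc F 1 n * Z ^ n) (F Z) := by
    intro F hF Z hZ
    have hZ' := norm_pos_iff.2 hZ
    set r₁ := min (‖Z‖ / 2) 1
    set r₂ := ‖Z‖ + 1
    have hr : 0 < r₁ := lt_min (by positivity) one_pos
    have h := hasSum_lc (w := Z) (r₁ := r₁) (r₂ := r₂) hr
      ((min_le_left _ _).trans_lt (by linarith)) (by simp [r₂]) fun z hz _ =>
        hF z (norm_pos_iff.1 (hr.trans_le hz))
    refine h.congr_fun fun n => ?_
    rw [lc_annulus_eq (r₁ := 1) (r₂ := r₂) one_pos (by simp [r₂]) fun z hz _ =>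
        hF z (norm_pos_iff.1 (one_pos.trans_le hz))]
  have hg1 : lc g 1 0 ≠ 0 := by
    intro h0
    obtain ⟨Z, hZ, hgZ⟩ := hg0
    have hall : ∀ n : ℤ, lc g 1 n = 0 := by
      intro n
      induction n using Int.induction_on with
      | zero => exact h0
      | succ n ih => rw [lc_theta hq0 hq hdg hg, ih]; simp
      | pred n ih =>
        have e2 := lc_theta hq0 hq hdg hg (-(n : ℤ) - 1)
        rw [sub_add_cancel, ih] at e2
        have := zpow_ne_zero (-(n : ℤ) - 1) hq0
        simpa [this] using e2.symm
    refine hgZ ((hser g hdg Z hZ).unique ?_)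
    simp [hall]
  refine ⟨lc f 1 0 / lc g 1 0, fun Z hZ => ?_⟩
  refine (hser f hdf Z hZ).unique (((hser g hdg Z hZ).mul_left _).congr_fun fun n => ?_)
  have := hprop n
  field_simp
  linear_combination this

/-- The normalised exponential `z ↦ e^{2πiz}`. -/
def ex (z : ℂ) : ℂ := Complex.exp (2 * Real.pi * Complex.I * z)

lemma ex_add (z w : ℂ) : ex (z + w) = ex z * ex w := by
  unfold ex; rw [mul_add, Complex.exp_add]

lemma ex_neg (z : ℂ) : ex (-z) = (ex z)⁻¹ := by
  unfold ex; rw [mul_neg, Complex.exp_neg]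

lemma ex_sub (z w : ℂ) : ex (z - w) = ex z / ex w := by
  rw [sub_eq_add_neg, ex_add, ex_neg, div_eq_mul_inv]

lemma ex_zero : ex 0 = 1 := by simp [ex]

lemma ex_one : ex 1 = 1 := by simp [ex, Complex.exp_two_pi_mul_I]

lemma ex_ne_zero (z : ℂ) : ex z ≠ 0 := Complex.exp_ne_zero _

lemma ex_nat_mul (n : ℕ) (z : ℂ) : ex (n * z) = ex z ^ n := by
  unfold ex; rw [← Complex.exp_nat_mul]; ring_nf

lemma ex_three_mul (z : ℂ) : ex (3 * z) = ex z ^ 3 := by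
  have := ex_nat_mul 3 z; simpa using this

lemma ex_half : ex (1 / 2) = -1 := by
  unfold ex
  rw [show 2 * (Real.pi : ℂ) * Complex.I * (1 / 2) = Real.pi * Complex.I by ring,
    Complex.exp_pi_mul_I]

lemma norm_ex (z : ℂ) : ‖ex z‖ = Real.exp (-(2 * Real.pi * z.im)) := by
  unfold ex
  rw [Complex.norm_exp]
  congr 1
  simp

lemma norm_ex_lt_one {z : ℂ} (hz : 0 < z.im) : ‖ex z‖ < 1 := by
  rw [norm_ex, Real.exp_lt_one_iff]
  have := Real.pi_pos
  nlinarith [mul_pos this hz]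

lemma hasDerivAt_ex (z : ℂ) : HasDerivAt ex (2 * Real.pi * Complex.I * ex z) z := by
  have := ((hasDerivAt_id z).const_mul (2 * (Real.pi : ℂ) * Complex.I)).cexp
  refine this.congr_deriv ?_
  simp [ex, mul_comm]

lemma differentiable_ex : Differentiable ℂ ex := fun z => (hasDerivAt_ex z).differentiableAt

lemma exists_eq_comp_ex {F : ℂ → ℂ} (hF : Differentiable ℂ F) (hper : ∀ z, F (z + 1) = F z) :
    ∃ f : ℂ → ℂ, (∀ Z : ℂ, Z ≠ 0 → DifferentiableAt ℂ f Z) ∧ ∀ z, f (ex z) = F z := by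
  have hpi := Complex.two_pi_I_ne_zero
  have hperZ : ∀ (n : ℤ) (z : ℂ), F (z + n) = F z := fun n z => by
    have := (show Function.Periodic F (1 : ℂ) from hper).int_mul n z
    simpa using this
  have key : ∀ a b : ℂ, Complex.exp a = Complex.exp b →
      F (a / (2 * Real.pi * Complex.I)) = F (b / (2 * Real.pi * Complex.I)) := by
    intro a b hab
    obtain ⟨n, hn⟩ := Complex.exp_eq_exp_iff_exists_int.1 hab
    rw [hn, ← hperZ n (b / _)]
    congr 1
    field_simp
  refine ⟨fun Z => F (Complex.log Z / (2 * Real.pi * Complex.I)), fun Z hZ => ?_, fun z => ?_⟩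
  · rcases Complex.mem_slitPlane_or_neg_mem_slitPlane hZ with h | h
    · exact (hF _).comp Z ((Complex.differentiableAt_log h).div_const _)
    · have heq : (fun Z => F (Complex.log Z / (2 * Real.pi * Complex.I))) =ᶠ[𝓝 Z]
          fun Z => F ((Complex.log (-Z) + Real.pi * Complex.I) / (2 * Real.pi * Complex.I)) := by
        filter_upwards [isOpen_ne.mem_nhds hZ] with W hW
        refine key _ _ ?_
        rw [Complex.exp_log hW, Complex.exp_add, Complex.exp_log (neg_ne_zero.2 hW),
          Complex.exp_pi_mul_I]
        ring
      refine DifferentiableAt.congr_of_eventuallyEq ?_ heq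
      refine (hF _).comp Z (DifferentiableAt.div_const (DifferentiableAt.add_const _ ?_) _)
      exact (Complex.differentiableAt_log h).comp Z differentiableAt_id.neg
  · simp only
    rw [key (Complex.log (ex z)) (2 * Real.pi * Complex.I * z)
      (by rw [Complex.exp_log (ex_ne_zero z)]; rfl), mul_div_cancel_left₀ _ hpi]

lemma jT_neg_one_ne_zero {q : ℂ} (hq : ‖q‖ < 1) : jT (-1) q ≠ 0 := by
  refine mul_ne_zero ?_ (qP_ne_zero_of_norm_lt hq (by simpa using hq))
  rw [qP_succ _ hq]
  exact mul_ne_zero (by norm_num) (qP_ne_zero_of_norm_lt hq (by simpa using hq))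

lemma exists_ex_eq {Z : ℂ} (hZ : Z ≠ 0) : ∃ z, ex z = Z :=
  ⟨Complex.log Z / (2 * Real.pi * Complex.I), by
    unfold ex; rw [mul_div_cancel₀ _ Complex.two_pi_I_ne_zero, Complex.exp_log hZ]⟩

/-- The inversion formula of the theta product. -/
lemma jT_inversion {τ : ℂ} (hτ : 0 < τ.im) : ∃ G : ℂ, G ≠ 0 ∧ ∀ z : ℂ,
    jT (ex z) (ex τ) = G * Complex.exp (Real.pi * Complex.I * (-z ^ 2 / τ - z / τ + z)) *
      jT (ex (z / τ)) (ex (-1 / τ)) := by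
  have hτ0 : τ ≠ 0 := by rintro rfl; simp at hτ
  have hq := norm_ex_lt_one hτ
  have him : 0 < (-1 / τ).im := by
    rw [neg_div, one_div, Complex.neg_im, Complex.inv_im, neg_div, neg_neg]
    exact div_pos hτ (Complex.normSq_pos.2 hτ0)
  have hq' := norm_ex_lt_one him
  set F : ℂ → ℂ := fun z => Complex.exp (Real.pi * Complex.I * (-z ^ 2 / τ - z / τ + z)) *
      jT (ex (z / τ)) (ex (-1 / τ)) with hFdef
  have hFd : Differentiable ℂ F := by
    intro z
    refine DifferentiableAt.mul (by fun_prop) ?_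
    have h1 : DifferentiableAt ℂ (fun z : ℂ => ex (z / τ)) z :=
      (differentiable_ex.comp (differentiable_id.div_const τ)) z
    exact DifferentiableAt.comp z (jT_differentiableAt (ex_ne_zero (z / τ)) hq') h1
  have hF1 : ∀ z, F (z + 1) = F z := by
    intro z
    simp only [hFdef]
    have e1 : ex (z / τ) = ex (-1 / τ) * ex ((z + 1) / τ) := by
      rw [← ex_add]; congr 1; field_simp; ring
    have e2 := jT_mul (ex_ne_zero ((z + 1) / τ)) (ex_ne_zero _) hq'
    rw [← e1] at e2
    have e3 : Complex.exp (Real.pi * Complex.I * (-(z + 1) ^ 2 / τ - (z + 1) / τ + (z + 1))) =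
        Complex.exp (Real.pi * Complex.I * (-z ^ 2 / τ - z / τ + z)) *
          (-(ex ((z + 1) / τ))⁻¹) := by
      have : -(ex ((z + 1) / τ))⁻¹ = Complex.exp (Real.pi * Complex.I) *
          Complex.exp (2 * Real.pi * Complex.I * -((z + 1) / τ)) := by
        rw [Complex.exp_pi_mul_I, ← ex_neg]; simp [ex]
      rw [this, ← Complex.exp_add, ← Complex.exp_add]
      congr 1; field_simp; ring
    rw [e2, e3]
    ring
  have hFτ : ∀ z, ex z * F (z + τ) = -F z := by
    intro z
    simp only [hFdef]
    have e1 : ex ((z + τ) / τ) = ex (z / τ) := by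
      rw [add_div, div_self hτ0, ex_add, ex_one, mul_one]
    have e3 : ex z * Complex.exp (Real.pi * Complex.I * (-(z + τ) ^ 2 / τ - (z + τ) / τ + (z + τ)))
        = -Complex.exp (Real.pi * Complex.I * (-z ^ 2 / τ - z / τ + z)) := by
      have : -Complex.exp (Real.pi * Complex.I * (-z ^ 2 / τ - z / τ + z)) =
          Complex.exp (Real.pi * Complex.I * (-z ^ 2 / τ - z / τ + z)) *
            Complex.exp (-(Real.pi * Complex.I)) := by
        rw [Complex.exp_neg, Complex.exp_pi_mul_I]; norm_num
      rw [this]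
      unfold ex
      rw [← Complex.exp_add, ← Complex.exp_add]
      congr 1; field_simp; ring
    rw [e1, ← mul_assoc, e3]
    ring
  obtain ⟨f, hfd, hf⟩ := exists_eq_comp_ex hFd hF1
  obtain ⟨k, hk⟩ := theta_unique (ex_ne_zero τ) hq (f := f) (g := fun Z => jT Z (ex τ)) hfd
    (fun Z hZ => by
      obtain ⟨z, rfl⟩ := exists_ex_eq hZ
      rw [mul_comm (ex τ), ← ex_add, hf, hf, hFτ])
    (fun Z hZ => jT_differentiableAt hZ hq)
    (fun Z hZ => by rw [jT_mul hZ (ex_ne_zero τ) hq]; field_simp)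
    ⟨-1, by norm_num, jT_neg_one_ne_zero hq⟩
  have hk' : ∀ z, F z = k * jT (ex z) (ex τ) := fun z => by rw [← hf, hk _ (ex_ne_zero z)]
  have hk0 : k ≠ 0 := by
    rintro rfl
    have := hk' (τ / 2)
    simp only [hFdef, zero_mul] at this
    rw [show τ / 2 / τ = 1 / 2 by field_simp, ex_half] at this
    exact mul_ne_zero (Complex.exp_ne_zero _) (jT_neg_one_ne_zero hq') this
  refine ⟨k⁻¹, inv_ne_zero hk0, fun z => ?_⟩
  have := hk' z
  simp only [hFdef] at this
  rw [mul_assoc, this]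
  field_simp

/-! ### The cubic theta identity -/

/-- The logarithmic derivative entering the cubic theta identity. -/
def aF (q : ℂ) : ℂ := 1 - 6 * logDeriv (fun Z => jT (q * Z) (q ^ 3)) 1

lemma norm_pow_lt_one {q : ℂ} (hq : ‖q‖ < 1) {k : ℕ} (hk : k ≠ 0) : ‖q ^ k‖ < 1 := by
  rw [norm_pow]; exact pow_lt_one₀ (norm_nonneg _) hq hk

lemma jT_self_cube {q : ℂ} (hq0 : q ≠ 0) (hq : ‖q‖ < 1) :
    jT q (q ^ 3) * qP (q ^ 3) (q ^ 3) = qP q q := by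
  rw [← qP_trisect q hq]
  unfold jT
  rw [show q ^ 3 / q = q * q by field_simp, show q ^ 3 = q ^ 2 * q by ring]

lemma cubic_theta {q Z : ℂ} (hq0 : q ≠ 0) (hq : ‖q‖ < 1) (hZ : Z ≠ 0) :
    qP (q ^ 3) (q ^ 3) ^ 3 * (jT (q * Z) (q ^ 3) ^ 3 - Z * jT (q ^ 2 * Z) (q ^ 3) ^ 3
      - q / Z * jT Z (q ^ 3) ^ 3) = qP q q * aF q * jT Z q := by
  have hq3 := norm_pow_lt_one hq (k := 3) (by norm_num)
  have hq30 : q ^ 3 ≠ 0 := pow_ne_zero 3 hq0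
  have hdj : ∀ c : ℂ, c ≠ 0 → ∀ Z : ℂ, Z ≠ 0 →
      DifferentiableAt ℂ (fun Z => jT (c * Z) (q ^ 3)) Z := fun c hc Z hZ =>
    (jT_differentiableAt (mul_ne_zero hc hZ) hq3).comp Z (differentiableAt_id.const_mul c)
  have hd0 : ∀ Z : ℂ, Z ≠ 0 → DifferentiableAt ℂ (fun Z => jT Z (q ^ 3)) Z := fun Z hZ =>
    jT_differentiableAt hZ hq3
  obtain ⟨k, hk⟩ := theta_unique hq0 hq (f := fun Z => jT (q * Z) (q ^ 3) ^ 3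
      - Z * jT (q ^ 2 * Z) (q ^ 3) ^ 3 - q / Z * jT Z (q ^ 3) ^ 3) (g := fun Z => jT Z q)
    (fun Z hZ => by
      have h1 := hdj q hq0 Z hZ
      have h2 := hdj (q ^ 2) (pow_ne_zero 2 hq0) Z hZ
      have h3 := hd0 Z hZ
      have h4 : DifferentiableAt ℂ (fun Z : ℂ => q / Z) Z :=
        (differentiableAt_const q).div differentiableAt_id hZ
      exact ((h1.pow 3).sub (differentiableAt_id.mul (h2.pow 3))).sub (h4.mul (h3.pow 3)))
    (fun Z hZ => by
      rw [show q * (q * Z) = q ^ 2 * Z by ring, show q ^ 2 * (q * Z) = q ^ 3 * Z by ring,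
        jT_mul hZ hq30 hq3]
      field_simp
      ring)
    (fun Z hZ => jT_differentiableAt hZ hq)
    (fun Z hZ => by rw [jT_mul hZ hq0 hq]; field_simp)
    ⟨-1, by norm_num, jT_neg_one_ne_zero hq⟩
  have hP2 : jT (q ^ 2) (q ^ 3) = jT q (q ^ 3) := by
    rw [← jT_div (q ^ 2) hq30, show q ^ 3 / q ^ 2 = q by field_simp]
  have hPB := jT_self_cube hq0 hq
  have hA : qP q q ≠ 0 := qP_ne_zero_of_norm_lt hq hq
  have hP : jT q (q ^ 3) ≠ 0 := by
    intro h; rw [h, zero_mul] at hPB; exact hA hPB.symm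
  set ℓ := deriv (fun Z => jT (q * Z) (q ^ 3)) 1 with hℓ
  have hder1 : HasDerivAt (fun Z => jT (q * Z) (q ^ 3)) ℓ 1 :=
    (hdj q hq0 1 one_ne_zero).hasDerivAt
  have hder2 : HasDerivAt (fun Z => jT (q ^ 2 * Z) (q ^ 3)) (-ℓ) 1 := by
    have he : (fun Z => jT (q ^ 2 * Z) (q ^ 3)) = fun Z => jT (q * Z⁻¹) (q ^ 3) := by
      funext Z
      rw [← jT_div (q ^ 2 * Z) hq30]
      congr 1
      by_cases hZ : Z = 0
      · simp [hZ]
      · field_simp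
    rw [he]
    have hi : HasDerivAt (fun Z : ℂ => Z⁻¹) (-1) 1 := by
      simpa using hasDerivAt_inv (one_ne_zero (α := ℂ))
    have hd1' : HasDerivAt (fun Z => jT (q * Z) (q ^ 3)) ℓ ((1 : ℂ)⁻¹) := by simpa using hder1
    have := hd1'.comp (1 : ℂ) hi
    simpa [Function.comp_def] using this
  have hder0 := (hd0 1 one_ne_zero).hasDerivAt
  have hz0 : jT 1 (q ^ 3) = 0 := jT_one hq3
  have hqd : HasDerivAt (fun Z : ℂ => q / Z) (-q) 1 := by
    have := (hasDerivAt_inv (one_ne_zero (α := ℂ))).const_mul q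
    simpa [div_eq_mul_inv] using this
  have hM : HasDerivAt (fun Z => jT (q * Z) (q ^ 3) ^ 3
      - Z * jT (q ^ 2 * Z) (q ^ 3) ^ 3 - q / Z * jT Z (q ^ 3) ^ 3)
      (6 * jT q (q ^ 3) ^ 2 * ℓ - jT q (q ^ 3) ^ 3) 1 := by
    refine (((hder1.pow 3).sub ((hasDerivAt_id (1 : ℂ)).mul (hder2.pow 3))).sub
      (hqd.mul (hder0.pow 3))).congr_deriv ?_
    simp only [id, mul_one, Pi.pow_apply, hz0, hP2]
    ring
  have hM2 : HasDerivAt (fun Z => jT (q * Z) (q ^ 3) ^ 3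
      - Z * jT (q ^ 2 * Z) (q ^ 3) ^ 3 - q / Z * jT Z (q ^ 3) ^ 3)
      (k * -(qP q q) ^ 2) 1 := by
    refine ((hasDerivAt_jT_one hq).const_mul k).congr_of_eventuallyEq ?_
    filter_upwards [isOpen_ne.mem_nhds (one_ne_zero (α := ℂ))] with W hW
    exact hk W hW
  have hu := hM.unique hM2
  have ha : aF q * jT q (q ^ 3) = jT q (q ^ 3) - 6 * ℓ := by
    unfold aF
    rw [logDeriv_apply, ← hℓ, mul_one]
    field_simp
  have hfin : qP (q ^ 3) (q ^ 3) ^ 3 * k = qP q q * aF q := by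
    refine mul_left_cancel₀ (pow_ne_zero 2 hA) ?_
    rw [← hPB] at hu ⊢
    linear_combination qP (q ^ 3) (q ^ 3) ^ 3 * hu - (jT q (q ^ 3) * qP (q ^ 3) (q ^ 3)) ^ 2 *
      qP (q ^ 3) (q ^ 3) * ha
  rw [hk Z hZ, ← hfin]
  ring

/-! ### Parametrisation of the kernel -/

/-- First coordinate of the parametrisation of the kernel curve. -/
def xK (ϖ q Z : ℂ) : ℂ := ϖ * jT Z (q ^ 3) * jT (q ^ 2 * Z) (q ^ 3) / jT (q * Z) (q ^ 3) ^ 2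

/-- Second coordinate of the parametrisation of the kernel curve. -/
def yK (ϖ q Z : ℂ) : ℂ := -ϖ * Z⁻¹ * jT Z (q ^ 3) * jT (q * Z) (q ^ 3) / jT (q ^ 2 * Z) (q ^ 3) ^ 2

/-- The weight `t` as a function of the nome. -/
def tK (ϖ q : ℂ) : ℂ := ϖ * qP (q ^ 3) (q ^ 3) ^ 3 / (qP q q * aF q)

lemma jT_three_shift {q Z : ℂ} (hq0 : q ≠ 0) (hq : ‖q‖ < 1) (hZ : Z ≠ 0) :
    jT (q ^ 2 * (q * Z)) (q ^ 3) = -Z⁻¹ * jT Z (q ^ 3) := by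
  rw [← jT_mul hZ (pow_ne_zero 3 hq0) (norm_pow_lt_one hq (by norm_num))]
  ring_nf

lemma xK_shift (ϖ : ℂ) {q Z : ℂ} (hq0 : q ≠ 0) (hq : ‖q‖ < 1) (hZ : Z ≠ 0) :
    xK ϖ q (q * Z) = yK ϖ q Z := by
  unfold xK yK
  rw [jT_three_shift hq0 hq hZ, ← mul_assoc q q, ← sq]
  ring

lemma yK_periodic (ϖ : ℂ) {q Z : ℂ} (hq0 : q ≠ 0) (hq : ‖q‖ < 1) (hZ : Z ≠ 0) :
    yK ϖ q (q ^ 3 * Z) = yK ϖ q Z := by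
  have hq3 := norm_pow_lt_one hq (k := 3) (by norm_num)
  have hq30 : q ^ 3 ≠ 0 := pow_ne_zero 3 hq0
  unfold yK
  rw [show q * (q ^ 3 * Z) = q ^ 3 * (q * Z) by ring,
    show q ^ 2 * (q ^ 3 * Z) = q ^ 3 * (q ^ 2 * Z) by ring,
    jT_mul hZ hq30 hq3, jT_mul (mul_ne_zero hq0 hZ) hq30 hq3,
    jT_mul (mul_ne_zero (pow_ne_zero 2 hq0) hZ) hq30 hq3]
  by_cases h2 : jT (q ^ 2 * Z) (q ^ 3) = 0
  · simp [h2]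
  · field_simp

lemma kernel_param {ϖ q Z : ℂ} (hϖ : ϖ ^ 3 = q) (hq0 : q ≠ 0) (hq : ‖q‖ < 1) (hZ : Z ≠ 0)
    (ha : aF q ≠ 0)
    (h1 : jT (q * Z) (q ^ 3) ≠ 0) (h2 : jT (q ^ 2 * Z) (q ^ 3) ≠ 0) :
    xK ϖ q Z * yK ϖ q Z = tK ϖ q *
      (xK ϖ q Z ^ 2 * yK ϖ q Z ^ 2 + xK ϖ q Z + yK ϖ q Z) := by
  have hϖ0 : ϖ ≠ 0 := by rintro rfl; simp at hϖ; exact hq0 hϖ.symm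
  have hA : qP q q ≠ 0 := qP_ne_zero_of_norm_lt hq hq
  have hM := cubic_theta hq0 hq hZ
  rw [← jT_trisect hZ hq0 hq] at hM
  unfold xK yK tK
  set j0 := jT Z (q ^ 3)
  set j1 := jT (q * Z) (q ^ 3)
  set j2 := jT (q ^ 2 * Z) (q ^ 3)
  have hx : (ϖ * j0 * j2 / j1 ^ 2) ^ 2 * (-ϖ * Z⁻¹ * j0 * j1 / j2 ^ 2) ^ 2 + ϖ * j0 * j2 / j1 ^ 2 +
      -ϖ * Z⁻¹ * j0 * j1 / j2 ^ 2 = -(ϖ * j0 / (Z * j1 ^ 2 * j2 ^ 2)) *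
        (j1 ^ 3 - Z * j2 ^ 3 - q / Z * j0 ^ 3) := by
    generalize j0 = u0, j1 = u1, j2 = u2 at *
    subst hϖ
    field_simp
    ring
  rw [hx]
  generalize j1 ^ 3 - Z * j2 ^ 3 - q / Z * j0 ^ 3 = M at *
  have : ϖ * qP (q ^ 3) (q ^ 3) ^ 3 / (qP q q * aF q) * (-(ϖ * j0 / (Z * j1 ^ 2 * j2 ^ 2)) * M) =
      -(ϖ ^ 2 * j0 / (Z * j1 ^ 2 * j2 ^ 2)) * (qP (q ^ 3) (q ^ 3) ^ 3 * M) / (qP q q * aF q) := by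
    ring
  rw [this, hM]
  field_simp

/-! ### Bounds for a small nome -/

lemma norm_qP_le_three {Z q : ℂ} (hZ : ‖Z‖ ≤ 1 / 2) (hq : ‖q‖ ≤ 1 / 1000) : ‖qP Z q‖ ≤ 3 := by
  have h := norm_qP_sub_one_le Z (q := q) (by linarith)
  have h2 : ‖Z‖ / (1 - ‖q‖) ≤ 1 := by rw [div_le_one (by linarith)]; linarith
  have h3 : ‖qP Z q‖ ≤ ‖qP Z q - 1‖ + 1 := by
    simpa using norm_add_le (qP Z q - 1) 1
  have := Real.exp_le_exp.2 h2
  linarith [Real.exp_one_lt_d9]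

lemma norm_qP_le_twenty_seven {Z q : ℂ} (hZ : ‖Z‖ ≤ 2) (hq : ‖q‖ ≤ 1 / 1000) :
    ‖qP Z q‖ ≤ 27 := by
  have h := norm_qP_sub_one_le Z (q := q) (by linarith)
  have h2 : ‖Z‖ / (1 - ‖q‖) ≤ 3 := by rw [div_le_iff₀ (by linarith)]; linarith
  have h3 : ‖qP Z q‖ ≤ ‖qP Z q - 1‖ + 1 := by
    simpa using norm_add_le (qP Z q - 1) 1
  have := Real.exp_le_exp.2 h2
  have h5 : Real.exp 3 ≤ 27 := by
    rw [show (3 : ℝ) = 1 + 1 + 1 by norm_num, Real.exp_add, Real.exp_add]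
    have := Real.exp_one_lt_d9
    have h0 := Real.exp_pos 1
    have : Real.exp 1 * Real.exp 1 ≤ 9 := by nlinarith
    nlinarith
  linarith

lemma norm_qP_sub_one_le_tenth {Z q : ℂ} (hZ : ‖Z‖ ≤ 1 / 100) (hq : ‖q‖ ≤ 1 / 1000) :
    ‖qP Z q - 1‖ ≤ 1 / 10 := by
  have h := norm_qP_sub_one_le Z (q := q) (by linarith)
  have h2 : ‖Z‖ / (1 - ‖q‖) ≤ 1 / 20 := by rw [div_le_iff₀ (by linarith)]; linarith
  have h0 : 0 ≤ ‖Z‖ / (1 - ‖q‖) := div_nonneg (norm_nonneg _) (by linarith)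
  have h4 := Real.abs_exp_sub_one_le (x := ‖Z‖ / (1 - ‖q‖)) (by rw [abs_of_nonneg h0]; linarith)
  rw [abs_of_nonneg h0] at h4
  linarith [le_abs_self (Real.exp (‖Z‖ / (1 - ‖q‖)) - 1)]

lemma norm_qP_ge {Z q : ℂ} (hZ : ‖Z‖ ≤ 1 / 100) (hq : ‖q‖ ≤ 1 / 1000) : 9 / 10 ≤ ‖qP Z q‖ := by
  have h := norm_qP_sub_one_le_tenth hZ hq
  have h2 : ‖(1 : ℂ)‖ ≤ ‖qP Z q‖ + ‖qP Z q - 1‖ := by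
    have := norm_sub_le (qP Z q) (qP Z q - 1)
    simpa using this
  rw [norm_one] at h2
  linarith

/-- The annulus `2‖q‖ ≤ ‖Z‖ ≤ 2` contains no zero of `jT (q * Z) (q ^ 3)`. -/
lemma norm_jT_q_mul_ge {q Z : ℂ} (hq0 : q ≠ 0) (hq : ‖q‖ ≤ 1 / 1000) (h1 : 2 * ‖q‖ ≤ ‖Z‖)
    (h2 : ‖Z‖ ≤ 2) : 1 / 2 ≤ ‖jT (q * Z) (q ^ 3)‖ := by
  have hqp := norm_pos_iff.2 hq0
  have hZp : 0 < ‖Z‖ := by linarith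
  have hq3 : ‖q ^ 3‖ ≤ 1 / 1000 := by
    rw [norm_pow]; exact (pow_le_of_le_one hqp.le (by linarith) (by norm_num)).trans hq
  have ha := norm_qP_ge (Z := q * Z) (q := q ^ 3) (by rw [norm_mul]; nlinarith) hq3
  have hb := norm_qP_ge (Z := q ^ 3 / (q * Z)) (q := q ^ 3) (by
    rw [show q ^ 3 / (q * Z) = q * (q / Z) by field_simp, norm_mul, norm_div]
    have : ‖q‖ / ‖Z‖ ≤ 1 / 2 := by rw [div_le_iff₀ hZp]; linarith
    nlinarith [div_nonneg hqp.le hZp.le]) hq3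
  unfold jT
  rw [norm_mul]
  nlinarith

lemma norm_jT_le {q Z : ℂ} (hq0 : q ≠ 0) (hq : ‖q‖ ≤ 1 / 1000) (h1 : 2 * ‖q‖ ≤ ‖Z‖)
    (h2 : ‖Z‖ ≤ 2) : ‖jT Z (q ^ 3)‖ ≤ 81 := by
  have hqp := norm_pos_iff.2 hq0
  have hZp : 0 < ‖Z‖ := by linarith
  have hq3 : ‖q ^ 3‖ ≤ 1 / 1000 := by
    rw [norm_pow]; exact (pow_le_of_le_one hqp.le (by linarith) (by norm_num)).trans hq
  have ha := norm_qP_le_twenty_seven h2 hq3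
  have hb := norm_qP_le_three (Z := q ^ 3 / Z) (q := q ^ 3) (by
    rw [show q ^ 3 / Z = q ^ 2 * (q / Z) by field_simp, norm_mul, norm_div, norm_pow]
    have : ‖q‖ / ‖Z‖ ≤ 1 / 2 := by rw [div_le_iff₀ hZp]; linarith
    have h3 : ‖q‖ ^ 2 ≤ 1 := pow_le_one₀ hqp.le (by linarith)
    nlinarith [div_nonneg hqp.le hZp.le]) hq3
  unfold jT
  rw [norm_mul]
  nlinarith [norm_nonneg (qP Z (q ^ 3)), norm_nonneg (qP (q ^ 3 / Z) (q ^ 3))]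

lemma norm_jT_sq_mul_le {q Z : ℂ} (hq0 : q ≠ 0) (hq : ‖q‖ ≤ 1 / 1000) (h1 : 2 * ‖q‖ ≤ ‖Z‖)
    (h2 : ‖Z‖ ≤ 2) : ‖jT (q ^ 2 * Z) (q ^ 3)‖ ≤ 9 := by
  have hqp := norm_pos_iff.2 hq0
  have hZp : 0 < ‖Z‖ := by linarith
  have hq3 : ‖q ^ 3‖ ≤ 1 / 1000 := by
    rw [norm_pow]; exact (pow_le_of_le_one hqp.le (by linarith) (by norm_num)).trans hq
  have ha := norm_qP_le_three (Z := q ^ 2 * Z) (q := q ^ 3) (by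
    rw [norm_mul, norm_pow]
    have h3 : ‖q‖ ^ 2 ≤ 1 / 1000 :=
      (pow_le_of_le_one hqp.le (by linarith) (by norm_num)).trans hq
    nlinarith) hq3
  have hb := norm_qP_le_three (Z := q ^ 3 / (q ^ 2 * Z)) (q := q ^ 3) (by
    rw [show q ^ 3 / (q ^ 2 * Z) = q / Z by field_simp, norm_div, div_le_iff₀ hZp]
    linarith) hq3
  unfold jT
  rw [norm_mul]
  nlinarith [norm_nonneg (qP (q ^ 2 * Z) (q ^ 3)), norm_nonneg (qP (q ^ 3 / (q ^ 2 * Z)) (q ^ 3))]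

lemma norm_xK_lt {ϖ q Z : ℂ} (hϖ : ‖ϖ‖ < 1 / 10000) (hq0 : q ≠ 0) (hq : ‖q‖ ≤ 1 / 1000)
    (h1 : 2 * ‖q‖ ≤ ‖Z‖) (h2 : ‖Z‖ ≤ 2) : ‖xK ϖ q Z‖ < 1 := by
  have a0 := norm_jT_le hq0 hq h1 h2
  have a1 := norm_jT_q_mul_ge hq0 hq h1 h2
  have a2 := norm_jT_sq_mul_le hq0 hq h1 h2
  unfold xK
  rw [norm_div, norm_mul, norm_mul, norm_pow, div_lt_one (by positivity)]
  have h3 : ‖jT Z (q ^ 3)‖ * ‖jT (q ^ 2 * Z) (q ^ 3)‖ ≤ 81 * 9 :=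
    mul_le_mul a0 a2 (norm_nonneg _) (by norm_num)
  have h4 : 1 / 4 ≤ ‖jT (q * Z) (q ^ 3)‖ ^ 2 := by nlinarith
  have h5 : ‖ϖ‖ * (‖jT Z (q ^ 3)‖ * ‖jT (q ^ 2 * Z) (q ^ 3)‖) ≤ ‖ϖ‖ * (81 * 9) :=
    mul_le_mul_of_nonneg_left h3 (norm_nonneg _)
  rw [mul_assoc]
  linarith

/-! ### The function `a` near the cusp -/

/-- A formula for `aF` that extends holomorphically to the whole unit disc. -/
def aG (q : ℂ) : ℂ := qP (q ^ 3) (q ^ 3) ^ 3 *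
  (2 * (qP (-q) (q ^ 3) * qP (-q ^ 2) (q ^ 3)) ^ 3 + q * (qP (-1) (q ^ 3) * qP (-q ^ 3) (q ^ 3)) ^ 3) /
    (qP q q * (qP (-1) q * qP (-q) q))

lemma qP_neg_one_ne_zero {q : ℂ} (hq : ‖q‖ < 1) : qP (-1) q ≠ 0 := by
  rw [qP_succ _ hq]
  exact mul_ne_zero (by norm_num) (qP_ne_zero_of_norm_lt hq (by simpa using hq))

lemma aF_eq_aG {q : ℂ} (hq0 : q ≠ 0) (hq : ‖q‖ < 1) : aF q = aG q := by
  have h := cubic_theta hq0 hq (Z := -1) (by norm_num)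
  have hA : qP q q ≠ 0 := qP_ne_zero_of_norm_lt hq hq
  have h1 := qP_neg_one_ne_zero hq
  have h2 : qP (-q) q ≠ 0 := qP_ne_zero_of_norm_lt hq (by simpa using hq)
  unfold jT at h
  rw [show q ^ 3 / (q * -1) = -q ^ 2 by field_simp, show q ^ 3 / (q ^ 2 * -1) = -q by field_simp,
    show q ^ 3 / -1 = -q ^ 3 by ring, show q / -1 = -q by ring, show q * -1 = -q by ring,
    show q ^ 2 * -1 = -q ^ 2 by ring] at h
  unfold aG
  rw [eq_div_iff (by simp [*])]
  linear_combination -h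

lemma aG_differentiableOn : DifferentiableOn ℂ aG (Metric.ball 0 1) := by
  have h1 : ∀ u ∈ Metric.ball (0 : ℂ) 1, ‖u‖ < 1 := fun u hu => mem_ball_zero_iff.1 hu
  have h3 : ∀ u ∈ Metric.ball (0 : ℂ) 1, ‖u ^ 3‖ < 1 := fun u hu =>
    norm_pow_lt_one (h1 u hu) (by norm_num)
  have hd3 : ∀ Z : ℂ → ℂ, Differentiable ℂ Z →
      DifferentiableOn ℂ (fun u => qP (Z u) (u ^ 3)) (Metric.ball 0 1) := fun Z hZ =>
    qP_differentiableOn Metric.isOpen_ball hZ.differentiableOn (by fun_prop) h3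
  have hd1 : ∀ Z : ℂ → ℂ, Differentiable ℂ Z →
      DifferentiableOn ℂ (fun u => qP (Z u) u) (Metric.ball 0 1) := fun Z hZ =>
    qP_differentiableOn Metric.isOpen_ball hZ.differentiableOn (by fun_prop) h1
  unfold aG
  refine DifferentiableOn.div (((hd3 _ (by fun_prop)).pow 3).mul
    (((((hd3 _ (by fun_prop)).mul (hd3 _ (by fun_prop))).pow 3).const_mul 2).add
      (differentiableOn_id.mul (((hd3 _ (by fun_prop)).mul (hd3 _ (by fun_prop))).pow 3))))
    ((hd1 _ (by fun_prop)).mul ((hd1 _ (by fun_prop)).mul (hd1 _ (by fun_prop)))) fun u hu => ?_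
  exact mul_ne_zero (qP_ne_zero_of_norm_lt (h1 u hu) (h1 u hu))
    (mul_ne_zero (qP_neg_one_ne_zero (h1 u hu))
      (qP_ne_zero_of_norm_lt (h1 u hu) (by simpa using h1 u hu)))

lemma aG_num_ge {q : ℂ} (hq : ‖q‖ ≤ 1 / 10 ^ 9) :
    1 ≤ ‖2 * (qP (-q) (q ^ 3) * qP (-q ^ 2) (q ^ 3)) ^ 3 +
      q * (qP (-1) (q ^ 3) * qP (-q ^ 3) (q ^ 3)) ^ 3‖ := by
  have hp : ∀ k : ℕ, k ≠ 0 → ‖q ^ k‖ ≤ 1 / 1000 := fun k hk => by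
    rw [norm_pow]
    exact (pow_le_of_le_one (norm_nonneg _) (by linarith) hk).trans (by linarith)
  have e1 := norm_qP_ge (Z := -q) (q := q ^ 3) (by rw [norm_neg]; linarith) (hp 3 (by norm_num))
  have e2 := norm_qP_ge (Z := -q ^ 2) (q := q ^ 3)
    (by rw [norm_neg]; linarith [hp 2 (by norm_num)]) (hp 3 (by norm_num))
  have e3 := norm_qP_le_twenty_seven (Z := -1) (q := q ^ 3) (by simp) (hp 3 (by norm_num))
  have e4 := norm_qP_le_three (Z := -q ^ 3) (q := q ^ 3)
    (by rw [norm_neg]; linarith [hp 3 (by norm_num)]) (hp 3 (by norm_num))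
  have f1 : (81 / 100) ^ 3 ≤ ‖(qP (-q) (q ^ 3) * qP (-q ^ 2) (q ^ 3)) ^ 3‖ := by
    rw [norm_pow, norm_mul]
    exact pow_le_pow_left₀ (by norm_num) (by nlinarith) 3
  have f2 : ‖(qP (-1) (q ^ 3) * qP (-q ^ 3) (q ^ 3)) ^ 3‖ ≤ 81 ^ 3 := by
    rw [norm_pow, norm_mul]
    refine pow_le_pow_left₀ (by positivity) ?_ 3
    nlinarith [norm_nonneg (qP (-1) (q ^ 3)), norm_nonneg (qP (-q ^ 3) (q ^ 3))]
  have h := norm_sub_le_norm_add (2 * (qP (-q) (q ^ 3) * qP (-q ^ 2) (q ^ 3)) ^ 3)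
    (q * (qP (-1) (q ^ 3) * qP (-q ^ 3) (q ^ 3)) ^ 3)
  rw [norm_mul, norm_mul] at h
  have f3 : ‖q‖ * ‖(qP (-1) (q ^ 3) * qP (-q ^ 3) (q ^ 3)) ^ 3‖ ≤ 1 / 10 ^ 9 * 81 ^ 3 :=
    mul_le_mul hq f2 (norm_nonneg _) (by norm_num)
  norm_num at h f1 f3
  linarith

lemma aG_ne_zero {q : ℂ} (hq : ‖q‖ ≤ 1 / 10 ^ 9) : aG q ≠ 0 := by
  have h1 : ‖q‖ < 1 := by linarith
  have hB : qP (q ^ 3) (q ^ 3) ≠ 0 :=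
    qP_ne_zero_of_norm_lt (norm_pow_lt_one h1 (by norm_num)) (norm_pow_lt_one h1 (by norm_num))
  have hN := aG_num_ge hq
  refine div_ne_zero (mul_ne_zero (pow_ne_zero 3 hB) (norm_pos_iff.1 (by linarith)))
    (mul_ne_zero (qP_ne_zero_of_norm_lt h1 h1)
    (mul_ne_zero (qP_neg_one_ne_zero h1) (qP_ne_zero_of_norm_lt h1 (by simpa using h1))))

lemma norm_tK_le {ϖ q : ℂ} (hϖ : ‖ϖ‖ < 1 / 10000) (hq0 : q ≠ 0) (hq : ‖q‖ ≤ 1 / 10 ^ 9) :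
    ‖tK ϖ q‖ ≤ 1 / 100 := by
  have h1 : ‖q‖ < 1 := by linarith
  have hB : qP (q ^ 3) (q ^ 3) ≠ 0 :=
    qP_ne_zero_of_norm_lt (norm_pow_lt_one h1 (by norm_num)) (norm_pow_lt_one h1 (by norm_num))
  have hA : qP q q ≠ 0 := qP_ne_zero_of_norm_lt h1 h1
  have hD1 := qP_neg_one_ne_zero h1
  have hD2 : qP (-q) q ≠ 0 := qP_ne_zero_of_norm_lt h1 (by simpa using h1)
  have hN := aG_num_ge hq
  unfold tK
  rw [aF_eq_aG hq0 h1]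
  unfold aG
  set N := 2 * (qP (-q) (q ^ 3) * qP (-q ^ 2) (q ^ 3)) ^ 3 +
      q * (qP (-1) (q ^ 3) * qP (-q ^ 3) (q ^ 3)) ^ 3
  have hN0 : N ≠ 0 := norm_pos_iff.1 (by linarith)
  have e : ϖ * qP (q ^ 3) (q ^ 3) ^ 3 / (qP q q * (qP (q ^ 3) (q ^ 3) ^ 3 * N /
      (qP q q * (qP (-1) q * qP (-q) q)))) = ϖ * (qP (-1) q * qP (-q) q) / N := by
    field_simp
  have e3 := norm_qP_le_twenty_seven (Z := -1) (q := q) (by simp) (by linarith)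
  have e4 := norm_qP_le_three (Z := -q) (q := q) (by rw [norm_neg]; linarith) (by linarith)
  rw [e, norm_div, norm_mul, norm_mul, div_le_iff₀ (by linarith)]
  have h5 : ‖qP (-1) q‖ * ‖qP (-q) q‖ ≤ 27 * 3 := mul_le_mul e3 e4 (norm_nonneg _) (by norm_num)
  have h6 : ‖ϖ‖ * (‖qP (-1) q‖ * ‖qP (-q) q‖) ≤ 1 / 10000 * (27 * 3) :=
    mul_le_mul hϖ.le h5 (by positivity) (by norm_num)
  linarith

/-! ### Laurent coefficients of the parametrisation -/

/-- The function `yK` with its double pole at `q` removed. -/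
def gK (ϖ q Z : ℂ) : ℂ := -ϖ * Z * jT Z (q ^ 3) * jT (q * Z) (q ^ 3) /
  (qP (q ^ 4 / Z) (q ^ 3) * qP (q ^ 2 * Z) (q ^ 3)) ^ 2

lemma jT_sq_mul_eq {q Z : ℂ} (hq0 : q ≠ 0) (hq : ‖q‖ < 1) (hZ : Z ≠ 0) :
    jT (q ^ 2 * Z) (q ^ 3) = (1 - q / Z) * (qP (q ^ 4 / Z) (q ^ 3) * qP (q ^ 2 * Z) (q ^ 3)) := by
  unfold jT
  rw [show q ^ 3 / (q ^ 2 * Z) = q / Z by field_simp,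
    qP_succ (q / Z) (norm_pow_lt_one hq (by norm_num)), show q / Z * q ^ 3 = q ^ 4 / Z by ring]
  ring

lemma yK_eq_gK (ϖ : ℂ) {q Z : ℂ} (hq0 : q ≠ 0) (hq : ‖q‖ < 1) (hZ : Z ≠ 0) :
    yK ϖ q Z = gK ϖ q Z / (Z - q) ^ 2 := by
  unfold yK gK
  rw [jT_sq_mul_eq hq0 hq hZ, one_sub_div hZ, mul_pow, div_pow, div_mul_eq_mul_div,
    div_div_eq_mul_div, div_div, mul_comm ((Z - q) ^ 2)]
  congr 1
  field_simp

lemma gK_factor_ne_zero {q Z : ℂ} (hq0 : q ≠ 0) (hq : ‖q‖ ≤ 1 / 1000)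
    (h1 : 2 * ‖q ^ 3‖ ≤ ‖Z‖) (h2 : ‖Z‖ ≤ 2) :
    qP (q ^ 4 / Z) (q ^ 3) * qP (q ^ 2 * Z) (q ^ 3) ≠ 0 := by
  have hqp := norm_pos_iff.2 hq0
  have hq1 : ‖q‖ < 1 := by linarith
  have hQp : 0 < ‖q ^ 3‖ := norm_pos_iff.2 (pow_ne_zero 3 hq0)
  have hq3 : ‖q ^ 3‖ < 1 := norm_pow_lt_one hq1 (by norm_num)
  refine mul_ne_zero (qP_ne_zero_of_norm_lt hq3 ?_) (qP_ne_zero_of_norm_lt hq3 ?_)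
  · rw [norm_div, div_lt_one (by linarith), pow_succ, norm_mul]
    nlinarith
  · rw [norm_mul]
    have : ‖q ^ 2‖ ≤ 1 / 1000 := by
      rw [norm_pow]; exact (pow_le_of_le_one hqp.le hq1.le (by norm_num)).trans hq
    nlinarith [norm_nonneg (q ^ 2)]

lemma jT_comp_differentiableAt {c q Z : ℂ} (hc : c ≠ 0) (hq : ‖q‖ < 1) (hZ : Z ≠ 0) :
    DifferentiableAt ℂ (fun Z => jT (c * Z) q) Z :=
  (jT_differentiableAt (mul_ne_zero hc hZ) hq).comp Z (differentiableAt_id.const_mul c)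

lemma gK_differentiableAt (ϖ : ℂ) {q Z : ℂ} (hq0 : q ≠ 0) (hq : ‖q‖ ≤ 1 / 1000)
    (h1 : 2 * ‖q ^ 3‖ ≤ ‖Z‖) (h2 : ‖Z‖ ≤ 2) : DifferentiableAt ℂ (gK ϖ q) Z := by
  have hQp : 0 < ‖q ^ 3‖ := norm_pos_iff.2 (pow_ne_zero 3 hq0)
  have hq1 : ‖q‖ < 1 := by linarith
  have hq3 : ‖q ^ 3‖ < 1 := norm_pow_lt_one hq1 (by norm_num)
  have hZ : Z ≠ 0 := norm_pos_iff.1 (by linarith)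
  have d1 : DifferentiableAt ℂ (fun Z => qP (q ^ 4 / Z) (q ^ 3)) Z :=
    (qP_differentiable_left hq3 _).comp Z ((differentiableAt_const _).div differentiableAt_id hZ)
  have d2 : DifferentiableAt ℂ (fun Z => qP (q ^ 2 * Z) (q ^ 3)) Z :=
    (qP_differentiable_left hq3 _).comp Z (differentiableAt_id.const_mul _)
  unfold gK
  exact (((differentiableAt_id.const_mul (-ϖ)).mul (jT_differentiableAt hZ hq3)).mul
    (jT_comp_differentiableAt hq0 hq3 hZ)).div ((d1.mul d2).pow 2)
    (pow_ne_zero 2 (gK_factor_ne_zero hq0 hq h1 h2))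

lemma yK_coeff (ϖ : ℂ) {q : ℂ} (hq0 : q ≠ 0) (hq : ‖q‖ ≤ 1 / 1000) (n : ℤ) :
    lc (yK ϖ q) 2 n * (1 - q ^ (3 * n)) = gK ϖ q q / q ^ 2 * n * q ^ (2 * n) := by
  have hqp := norm_pos_iff.2 hq0
  have hq1 : ‖q‖ < 1 := by linarith
  have hQp : 0 < ‖q ^ 3‖ := norm_pos_iff.2 (pow_ne_zero 3 hq0)
  have hq30 : q ^ 3 ≠ 0 := pow_ne_zero 3 hq0
  have hsm : 2 * ‖q ^ 3‖ < ‖q‖ := by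
    rw [norm_pow]
    nlinarith [mul_pos hqp hqp]
  have key : ∀ n : ℤ, lc (yK ϖ q) 2 n * (1 - ((q ^ 3) ^ n)⁻¹) =
      q ^ (-n - 1) * (deriv (gK ϖ q) q - (n + 1) * (gK ϖ q q / q)) := by
    intro n
    have hG : ∀ z : ℂ, ‖q ^ 3‖ * 2 ≤ ‖z‖ → ‖z‖ ≤ 2 →
        DifferentiableAt ℂ (fun z => z ^ (-n - 1) * gK ϖ q z) z := fun z hz1 hz2 =>
      (differentiableAt_zpow.2 (Or.inl (norm_pos_iff.1 (by linarith)))).mul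
        (gK_differentiableAt ϖ hq0 hq (by linarith) hz2)
    have h := circleIntegral_double_pole (w := q) (by positivity) (by linarith)
      (by linarith) hG
    have hlc : ∀ r : ℝ, 0 < r → (2 * Real.pi * Complex.I)⁻¹ *
        (∮ z in C(0, r), z ^ (-n - 1) * gK ϖ q z / (z - q) ^ 2) = lc (yK ϖ q) r n := by
      intro r hr
      unfold lc
      congr 1
      refine circleIntegral.integral_congr hr.le fun z hz => ?_
      simp only [yK_eq_gK ϖ hq0 hq1 (ne_zero_of_mem_sphere hr hz)]
      ring
    have h2 : lc (yK ϖ q) 2 n - lc (yK ϖ q) (‖q ^ 3‖ * 2) n =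
        deriv (fun z => z ^ (-n - 1) * gK ϖ q z) q := by
      rw [← hlc 2 two_pos, ← hlc (‖q ^ 3‖ * 2) (by positivity), ← mul_sub, h,
        inv_mul_cancel_left₀ Complex.two_pi_I_ne_zero]
    have h3 : lc (yK ϖ q) 2 n = (q ^ 3) ^ n * lc (yK ϖ q) (‖q ^ 3‖ * 2) n := by
      rw [← lc_dilate _ hq30 two_pos]
      exact lc_congr two_pos (fun z hz => (yK_periodic ϖ hq0 hq1
        (norm_pos_iff.1 (by rw [hz]; exact two_pos))).symm) n
    have h4 : deriv (fun z => z ^ (-n - 1) * gK ϖ q z) q =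
        q ^ (-n - 1) * (deriv (gK ϖ q) q - (n + 1) * (gK ϖ q q / q)) := by
      have hd := (hasDerivAt_zpow (-n - 1) q (Or.inl hq0)).mul
        (gK_differentiableAt ϖ hq0 hq hsm.le (by linarith)).hasDerivAt
      refine hd.deriv.trans ?_
      rw [zpow_sub_one₀ hq0 (-n - 1)]
      push_cast
      field_simp
      ring
    have hQn : (q ^ 3) ^ n ≠ 0 := zpow_ne_zero n hq30
    rw [← h4, ← h2, h3]
    field_simp
  have h0 := key 0
  simp only [zpow_zero, inv_one, sub_self, mul_zero, Int.cast_zero, zero_add, one_mul] at h0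
  have hz : deriv (gK ϖ q) q = gK ϖ q q / q := by
    have := (mul_eq_zero.1 h0.symm).resolve_left (zpow_ne_zero _ hq0)
    exact sub_eq_zero.1 this
  have hn := key n
  rw [hz] at hn
  have e1 : q ^ (3 * n) = (q ^ n) ^ 3 := by rw [mul_comm, zpow_mul]; norm_cast
  have e2 : q ^ (2 * n) = (q ^ n) ^ 2 := by rw [mul_comm, zpow_mul]; norm_cast
  have e3 : (q ^ 3) ^ n = (q ^ n) ^ 3 := by rw [← zpow_natCast, ← zpow_natCast, ← zpow_mul, ← zpow_mul, mul_comm]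
  rw [e3, zpow_sub_one₀ hq0, zpow_neg] at hn
  rw [e1, e2]
  have hqn : q ^ n ≠ 0 := zpow_ne_zero n hq0
  field_simp at hn ⊢
  linear_combination (-1) * hn

lemma gK_self {ϖ q : ℂ} (hq0 : q ≠ 0) (hq : ‖q‖ < 1) :
    gK ϖ q q = -ϖ * q * qP q q ^ 2 / qP (q ^ 3) (q ^ 3) ^ 6 := by
  have hq3 : ‖q ^ 3‖ < 1 := norm_pow_lt_one hq (by norm_num)
  have hB : qP (q ^ 3) (q ^ 3) ≠ 0 := qP_ne_zero_of_norm_lt hq3 hq3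
  have hP : jT (q * q) (q ^ 3) = jT q (q ^ 3) := by
    rw [← jT_div (q * q) (pow_ne_zero 3 hq0), show q ^ 3 / (q * q) = q by field_simp]
  unfold gK
  rw [hP, show q ^ 4 / q = q ^ 3 by field_simp, ← pow_succ, ← jT_self_cube hq0 hq]
  field_simp

/-! ### Solution of the kernel equation -/

/-- The combination of generating functions satisfying a `q`-difference equation. -/
def hK (s ϖ q Z : ℂ) : ℂ := xK ϖ q Z -
  tK ϖ q * (-Z * jT (q ^ 2 * Z) (q ^ 3) ^ 3 / jT (q * Z) (q ^ 3) ^ 3) *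
    genA s (tK ϖ q) (xK ϖ q Z) +
  tK ϖ q * s * (genB s (tK ϖ q) (xK ϖ q Z) - genE s (tK ϖ q))

lemma jT_q_mul_ne_zero {q Z : ℂ} (hq0 : q ≠ 0) (hq : ‖q‖ ≤ 1 / 1000) (h1 : 2 * ‖q‖ ≤ ‖Z‖)
    (h2 : ‖Z‖ ≤ 2) : jT (q * Z) (q ^ 3) ≠ 0 :=
  norm_pos_iff.1 (by linarith [norm_jT_q_mul_ge hq0 hq h1 h2])

lemma jT_sq_mul_ne_zero {q Z : ℂ} (hq0 : q ≠ 0) (hq : ‖q‖ ≤ 1 / 1000) (h1 : 2 * ‖q‖ ≤ ‖Z‖)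
    (h2 : ‖Z‖ ≤ 2) : jT (q ^ 2 * Z) (q ^ 3) ≠ 0 := by
  have hqp := norm_pos_iff.2 hq0
  have hZ : Z ≠ 0 := norm_pos_iff.1 (by linarith)
  rw [jT_sq_mul_eq hq0 (by linarith) hZ]
  refine mul_ne_zero (sub_ne_zero.2 fun h => ?_) (gK_factor_ne_zero hq0 hq ?_ h2)
  · rw [eq_div_iff hZ, one_mul] at h
    rw [h] at h1; linarith
  · have : ‖q ^ 3‖ ≤ ‖q‖ := by
      rw [norm_pow]; exact pow_le_of_le_one hqp.le (by linarith) (by norm_num)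
    linarith

lemma xK_differentiableAt (ϖ : ℂ) {q Z : ℂ} (hq0 : q ≠ 0) (hq : ‖q‖ ≤ 1 / 1000)
    (h1 : 2 * ‖q‖ ≤ ‖Z‖) (h2 : ‖Z‖ ≤ 2) : DifferentiableAt ℂ (xK ϖ q) Z := by
  have hqp := norm_pos_iff.2 hq0
  have hZ : Z ≠ 0 := norm_pos_iff.1 (by linarith)
  have hq3 : ‖q ^ 3‖ < 1 := norm_pow_lt_one (by linarith) (by norm_num)
  unfold xK
  exact (((jT_differentiableAt hZ hq3).const_mul ϖ).mul
    (jT_comp_differentiableAt (pow_ne_zero 2 hq0) hq3 hZ)).div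
    ((jT_comp_differentiableAt hq0 hq3 hZ).pow 2) (pow_ne_zero 2 (jT_q_mul_ne_zero hq0 hq h1 h2))

lemma yK_differentiableAt (ϖ : ℂ) {q Z : ℂ} (hq0 : q ≠ 0) (hq : ‖q‖ ≤ 1 / 1000)
    (h1 : 2 * ‖q‖ ≤ ‖Z‖) (h2 : ‖Z‖ ≤ 2) : DifferentiableAt ℂ (yK ϖ q) Z := by
  have hqp := norm_pos_iff.2 hq0
  have hZ : Z ≠ 0 := norm_pos_iff.1 (by linarith)
  have hq3 : ‖q ^ 3‖ < 1 := norm_pow_lt_one (by linarith) (by norm_num)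
  unfold yK
  exact ((((differentiableAt_inv hZ).const_mul (-ϖ)).mul (jT_differentiableAt hZ hq3)).mul
    (jT_comp_differentiableAt hq0 hq3 hZ)).div
    ((jT_comp_differentiableAt (pow_ne_zero 2 hq0) hq3 hZ).pow 2)
    (pow_ne_zero 2 (jT_sq_mul_ne_zero hq0 hq h1 h2))

lemma hK_differentiableAt {s ϖ q Z : ℂ} (hs : ‖s‖ = 1) (hϖ : ‖ϖ‖ < 1 / 10000) (hq0 : q ≠ 0)
    (hq : ‖q‖ ≤ 1 / 10 ^ 9) (h1 : 2 * ‖q‖ ≤ ‖Z‖) (h2 : ‖Z‖ ≤ 2) :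
    DifferentiableAt ℂ (hK s ϖ q) Z := by
  have hq' : ‖q‖ ≤ 1 / 1000 := by linarith
  have hqp := norm_pos_iff.2 hq0
  have hZ : Z ≠ 0 := norm_pos_iff.1 (by linarith)
  have hq3 : ‖q ^ 3‖ < 1 := norm_pow_lt_one (by linarith) (by norm_num)
  have ht : ‖tK ϖ q‖ < 1 / 3 := (norm_tK_le hϖ hq0 hq).trans_lt (by norm_num)
  have hx := xK_differentiableAt ϖ hq0 hq' h1 h2
  have hb : xK ϖ q Z ∈ Metric.ball (0 : ℂ) 1 :=
    mem_ball_zero_iff.2 (norm_xK_lt hϖ hq0 hq' h1 h2)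
  have hA := ((genA_differentiableOn hs ht).differentiableAt (Metric.isOpen_ball.mem_nhds hb)).comp
    Z hx
  have hB := ((genB_differentiableOn hs ht).differentiableAt (Metric.isOpen_ball.mem_nhds hb)).comp
    Z hx
  unfold hK
  exact (hx.sub (((((differentiableAt_id.neg.mul
    ((jT_comp_differentiableAt (pow_ne_zero 2 hq0) hq3 hZ).pow 3)).div
    ((jT_comp_differentiableAt hq0 hq3 hZ).pow 3)
      (pow_ne_zero 3 (jT_q_mul_ne_zero hq0 hq' h1 h2))).const_mul _)).mul hA)).add
    ((hB.sub_const _).const_mul _)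

lemma hK_one {s ϖ q : ℂ} (hq0 : q ≠ 0) (hq : ‖q‖ ≤ 1 / 1000) :
    hK s ϖ q 1 = tK ϖ q * genE s (tK ϖ q) := by
  have hq3 : ‖q ^ 3‖ < 1 := norm_pow_lt_one (by linarith) (by norm_num)
  have hx : xK ϖ q 1 = 0 := by simp [xK, jT_one hq3]
  have h1 := jT_q_mul_ne_zero (Z := 1) hq0 hq (by rw [norm_one]; linarith) (by simp)
  have hP : jT (q ^ 2 * 1) (q ^ 3) = jT (q * 1) (q ^ 3) := by
    rw [← jT_div (q ^ 2 * 1) (pow_ne_zero 3 hq0), show q ^ 3 / (q ^ 2 * 1) = q * 1 by field_simp]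
  unfold hK
  rw [hx, genA_zero, genB_zero, hP, mul_div_assoc, div_self (pow_ne_zero 3 h1)]
  ring

lemma hK_shift {s ϖ q Z : ℂ} (hs : ‖s‖ = 1) (hϖ : ‖ϖ‖ < 1 / 10000) (hϖq : ϖ ^ 3 = q)
    (hq0 : q ≠ 0) (hq : ‖q‖ ≤ 1 / 10 ^ 9) (hZ2 : ‖Z‖ = 2) :
    hK s ϖ q (q * Z) =
      s * hK s ϖ q Z + (yK ϖ q Z + -(tK ϖ q * s * genE s (tK ϖ q))) := by
  have hs0 : s ≠ 0 := by rintro rfl; simp at hs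
  have hϖ0 : ϖ ≠ 0 := by rintro rfl; simp at hϖq; exact hq0 hϖq.symm
  have hq' : ‖q‖ ≤ 1 / 1000 := by linarith
  have hq1 : ‖q‖ < 1 := by linarith
  have hqp := norm_pos_iff.2 hq0
  have hZ : Z ≠ 0 := norm_pos_iff.1 (by linarith)
  have hq3 : ‖q ^ 3‖ < 1 := norm_pow_lt_one (by linarith) (by norm_num)
  have ht : ‖tK ϖ q‖ < 1 / 3 := (norm_tK_le hϖ hq0 hq).trans_lt (by norm_num)
  have h1 : 2 * ‖q‖ ≤ ‖Z‖ := by linarith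
  have hj1 := jT_q_mul_ne_zero hq0 hq' h1 hZ2.le
  have hj2 := jT_sq_mul_ne_zero hq0 hq' h1 hZ2.le
  have hsmall : ‖q ^ 3‖ ≤ 1 / 1000 := by
    rw [norm_pow]; exact (pow_le_of_le_one hqp.le hq1.le (by norm_num)).trans hq'
  have hj0 : jT Z (q ^ 3) ≠ 0 := by
    refine jT_ne_zero hq3 (fun n hn => ?_) fun n hn => ?_
    · have := congrArg norm hn
      rw [norm_mul, norm_pow, norm_one, hZ2] at this
      rcases n with _ | n
      · norm_num at this
      · have h3 : ‖q ^ 3‖ ^ (n + 1) ≤ 1 / 1000 :=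
          (pow_le_of_le_one (norm_nonneg _) hq3.le (by omega)).trans hsmall
        linarith
    · have := congrArg norm hn
      rw [norm_mul, norm_pow, norm_one, norm_div, hZ2] at this
      have h3 : ‖q ^ 3‖ ^ n ≤ 1 := pow_le_one₀ (norm_nonneg _) hq3.le
      nlinarith [norm_nonneg (q ^ 3)]
  have hx := norm_xK_lt hϖ hq0 hq' h1 hZ2.le
  have hy : ‖yK ϖ q Z‖ < 1 := by
    rw [← xK_shift ϖ hq0 hq1 hZ]
    refine norm_xK_lt hϖ hq0 hq' ?_ ?_ <;> rw [norm_mul, hZ2] <;> linarith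
  have hy0 : yK ϖ q Z ≠ 0 := by
    unfold yK
    exact div_ne_zero (by simp [*]) (pow_ne_zero 2 hj2)
  have hk := kernel_identity hs ht hx.le hy.le (kernel_param hϖq hq0 hq1 hZ
    (by rw [aF_eq_aG hq0 hq1]; exact aG_ne_zero hq) hj1 hj2)
  have hr : yK ϖ q Z * (-Z * jT (q ^ 2 * Z) (q ^ 3) ^ 3 / jT (q * Z) (q ^ 3) ^ 3) = xK ϖ q Z := by
    unfold yK xK
    field_simp
  have hr' : -(q * Z) * (-Z⁻¹ * jT Z (q ^ 3)) ^ 3 / jT (q ^ 2 * Z) (q ^ 3) ^ 3 =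
      xK ϖ q Z * yK ϖ q Z ^ 2 := by
    unfold yK xK
    field_simp
    rw [hϖq]
  unfold hK
  rw [xK_shift ϖ hq0 hq1 hZ, jT_three_shift hq0 hq1 hZ, ← mul_assoc q q, ← sq, hr']
  generalize -Z * jT (q ^ 2 * Z) (q ^ 3) ^ 3 / jT (q * Z) (q ^ 3) ^ 3 = r at hr ⊢
  rw [← hr] at hk ⊢
  refine mul_left_cancel₀ hy0 ?_
  have : s * s⁻¹ = 1 := mul_inv_cancel₀ hs0
  generalize tK ϖ q = t at *
  generalize genA s t (yK ϖ q Z * r) = a1 at *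
  generalize genA s t (yK ϖ q Z) = a2 at *
  generalize genB s t (yK ϖ q Z * r) = b1 at *
  generalize genB s t (yK ϖ q Z) = b2 at *
  generalize yK ϖ q Z = y at *
  linear_combination (-s) * hk + t * r * y ^ 4 * a2 * this

lemma hasSum_tK_mul_genE {s ϖ q : ℂ} (hs : ‖s‖ = 1) (hs1 : s ≠ 1) (hϖ : ‖ϖ‖ < 1 / 10000)
    (hϖq : ϖ ^ 3 = q) (hq0 : q ≠ 0) (hq : ‖q‖ ≤ 1 / 10 ^ 9) :
    HasSum (fun n : ℕ => -(gK ϖ q q / q ^ 2) * (n * q ^ n * (1 - (q ^ n) ^ 2) /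
      ((1 + q ^ n + (q ^ n) ^ 2) * (1 - (s + s⁻¹) * q ^ n + (q ^ n) ^ 2))))
      (tK ϖ q * genE s (tK ϖ q)) := by
  have hs0 : s ≠ 0 := by rintro rfl; simp at hs
  have hq' : ‖q‖ ≤ 1 / 1000 := by linarith
  have hq1 : ‖q‖ < 1 := by linarith
  have hqp := norm_pos_iff.2 hq0
  have hq3 : ‖q ^ 3‖ < 1 := norm_pow_lt_one (by linarith) (by norm_num)
  set c := lc (hK s ϖ q) 2 with hc
  set y := lc (yK ϖ q) 2 with hy
  set e := tK ϖ q * genE s (tK ϖ q) with he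
  have hdiff : ∀ z : ℂ, ‖q‖ * 2 ≤ ‖z‖ → ‖z‖ ≤ 2 → DifferentiableAt ℂ (hK s ϖ q) z :=
    fun z h1 h2 => hK_differentiableAt hs hϖ hq0 hq (by linarith) h2
  have hydiff : ∀ z : ℂ, ‖q‖ * 2 ≤ ‖z‖ → ‖z‖ ≤ 2 → DifferentiableAt ℂ (yK ϖ q) z :=
    fun z h1 h2 => yK_differentiableAt ϖ hq0 hq' (by linarith) h2
  have hrec : ∀ n : ℤ, q ^ n * c n = s * c n + (y n + if n = 0 then -(s * e) else 0) := by
    intro n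
    have h1 := lc_dilate (hK s ϖ q) hq0 two_pos n
    rw [← lc_annulus_eq (by positivity) (by linarith) hdiff] at h1
    rw [hc, ← h1, lc_congr two_pos (fun z hz => hK_shift hs hϖ hϖq hq0 hq hz) n,
      lc_add two_pos (fun z hz => ((hdiff z (by linarith) hz.le).const_mul s).continuousAt)
        (fun z hz => ((hydiff z (by linarith) hz.le).add_const _).continuousAt),
      lc_add two_pos (fun z hz => (hydiff z (by linarith) hz.le).continuousAt)
        (fun z _ => continuousAt_const), lc_const_mul, lc_const _ two_pos, he]
    congr 3
    ring
  have hC : HasSum c e := by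
    have := hasSum_lc (w := 1) (by positivity) (by rw [norm_one]; linarith) (by simp) hdiff
    simpa [hK_one hq0 hq'] using this
  have hY : HasSum y 0 := by
    have := hasSum_lc (w := 1) (by positivity) (by rw [norm_one]; linarith) (by simp) hydiff
    simpa [yK, jT_one hq3] using this
  have hns : ∀ n : ℤ, q ^ n - s ≠ 0 := by
    intro n hn
    have h0 : q ^ n = s := sub_eq_zero.1 hn
    have h1 : ‖q‖ ^ n = 1 := by rw [← norm_zpow, h0, hs]
    have h2 : n = 0 := (zpow_eq_one_iff_right₀ hqp.le hq1.ne).1 h1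
    rw [h2, zpow_zero] at h0
    exact hs1 h0.symm
  have hD : HasSum (fun n : ℤ => y n * (1 - q ^ n) / (q ^ n - s)) e := by
    have h := ((hC.mul_left (1 - s)).sub hY).add (hasSum_ite_eq (0 : ℤ) (s * e))
    rw [show (1 - s) * e - 0 + s * e = e by ring] at h
    refine h.congr_fun fun n => ?_
    · rw [div_eq_iff (hns n)]
      have := hrec n
      split_ifs at this ⊢ with h0
      · subst h0
        simp only [zpow_zero] at this ⊢
        linear_combination (-(1 - s)) * this
      · linear_combination (-(1 - s)) * this
  have h2 := hD.nat_add_neg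
  simp only [zpow_zero, sub_self, mul_zero, zero_div, add_zero] at h2
  refine h2.congr_fun fun n => ?_
  rcases Nat.eq_zero_or_pos n with rfl | hn
  · simp
  have y1 := yK_coeff ϖ hq0 hq' n
  have y2 := yK_coeff ϖ hq0 hq' (-n)
  rw [← hy] at y1 y2
  have n1 := hns n
  have n2 := hns (-n)
  simp only [zpow_neg, mul_comm (3 : ℤ), mul_comm (2 : ℤ), zpow_mul] at y1 y2 n1 n2 ⊢
  norm_cast at y1 y2 n1 n2 ⊢
  set u := q ^ n with hu
  have hu0 : u ≠ 0 := pow_ne_zero n hq0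
  have hu3 : 1 - u ^ 3 ≠ 0 := by
    intro h
    have h3 := norm_pow_lt_one (norm_pow_lt_one hq1 hn.ne') (k := 3) (by norm_num)
    rw [← hu, ← sub_eq_zero.1 h, norm_one] at h3
    exact lt_irrefl _ h3
  have hf : 1 - u ^ 3 = (1 - u) * (1 + u + u ^ 2) := by ring
  have hu1 : 1 - u ≠ 0 := fun h => hu3 (by rw [hf, h, zero_mul])
  have hu2 : 1 + u + u ^ 2 ≠ 0 := fun h => hu3 (by rw [hf, h, mul_zero])
  have n2' : 1 - s * u ≠ 0 := fun h => n2 (by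
    rw [inv_eq_one_div, div_sub' hu0, mul_comm u, h, zero_div])
  have hden : 1 - (s + s⁻¹) * u + u ^ 2 = (u - s) * (1 - s * u) / -s := by
    field_simp
    ring
  have Y1 : y n = gK ϖ q q / q ^ 2 * n * u ^ 2 / (1 - u ^ 3) := (eq_div_iff hu3).2 y1
  have Y2 : y (-n) = gK ϖ q q / q ^ 2 * n * u / (1 - u ^ 3) := by
    rw [eq_div_iff hu3]
    push_cast at y2
    field_simp at y2 ⊢
    linear_combination (-1) * y2
  have e2 : (1 - u⁻¹) / (u⁻¹ - s) = -(1 - u) / (1 - s * u) := by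
    rw [div_eq_div_iff n2 n2']
    field_simp
    ring
  rw [mul_div_assoc (y (-n)), e2, hden, Y1, Y2, hf]
  change u - s ≠ 0 at n1
  have n2'' : 1 - u * s ≠ 0 := by rwa [mul_comm]
  field_simp
  ring

/-! ### The generating function in terms of theta products -/

/-- The product `∏ (1 - (s + s⁻¹) q ^ k + q ^ (2k))` over `k ≥ 1`. -/
def thP (s q : ℂ) : ℂ := qP (s * q) q * qP (s⁻¹ * q) q

lemma thP_ne_zero {s q : ℂ} (hs : ‖s‖ = 1) (hq : ‖q‖ < 1) : thP s q ≠ 0 :=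
  mul_ne_zero (qP_ne_zero_of_norm_lt hq (by simpa [hs] using hq))
    (qP_ne_zero_of_norm_lt hq (by simpa [hs] using hq))

lemma qP_mul_self_differentiableOn (s : ℂ) :
    DifferentiableOn ℂ (fun q => qP (s * q) q) (Metric.ball 0 1) :=
  qP_differentiableOn Metric.isOpen_ball (differentiableOn_id.const_mul s) differentiableOn_id
    fun _ hu => mem_ball_zero_iff.1 hu

lemma thP_differentiableOn (s : ℂ) : DifferentiableOn ℂ (thP s) (Metric.ball 0 1) :=
  (qP_mul_self_differentiableOn s).mul (qP_mul_self_differentiableOn s⁻¹)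

lemma mul_pow_ne_one {s q : ℂ} (hs : ‖s‖ = 1) (hq : ‖q‖ < 1) (n : ℕ) : s * q * q ^ n ≠ 1 := by
  intro h
  have := congrArg norm h
  rw [mul_assoc, ← pow_succ', norm_mul, hs, one_mul, norm_one] at this
  exact (norm_pow_lt_one hq (Nat.succ_ne_zero n)).ne this

lemma hasSum_logDeriv_qP_mul {s q : ℂ} (hs : ‖s‖ = 1) (hq : ‖q‖ < 1) :
    HasSum (fun n : ℕ => -(n * (s * q ^ n) / (1 - s * q ^ n)))
      (q * logDeriv (fun u => qP (s * u) u) q) := by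
  have hb : q ∈ Metric.ball (0 : ℂ) 1 := mem_ball_zero_iff.2 hq
  have h := (logDeriv_qP Metric.isOpen_ball (differentiableOn_id.const_mul s) differentiableOn_id
    (fun u hu => mem_ball_zero_iff.1 hu) hb (fun n => mul_pow_ne_one hs hq n)).mul_left q
  refine (hasSum_nat_add_iff' 1).1 ?_
  simp only [Finset.range_one, Finset.sum_singleton, Nat.cast_zero, zero_mul, zero_div, neg_zero,
    sub_zero]
  refine h.congr_fun fun n => ?_
  have h1 : deriv (fun u : ℂ => s * u) q = s := by simp
  have h2 : deriv (fun u : ℂ => s * id u) q = s := h1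
  rw [h2, deriv_id]
  simp only [id]
  rcases n with _ | n
  · simp; ring
  · push_cast
    ring

lemma one_sub_add_sq_ne_zero {s q : ℂ} (hs : ‖s‖ = 1) (hq : ‖q‖ < 1) {n : ℕ} (hn : n ≠ 0) :
    1 - (s + s⁻¹) * q ^ n + (q ^ n) ^ 2 ≠ 0 := by
  have hs0 : s ≠ 0 := by rintro rfl; simp at hs
  have h1 : ∀ s : ℂ, ‖s‖ = 1 → 1 - s * q ^ n ≠ 0 := by
    intro s hs h
    have := norm_pow_lt_one hq hn
    have h2 := congrArg norm (sub_eq_zero.1 h)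
    rw [norm_mul, hs, one_mul, norm_one] at h2
    exact this.ne h2.symm
  have := mul_ne_zero (h1 s hs) (h1 s⁻¹ (by rw [norm_inv, hs, inv_one]))
  convert this using 1
  field_simp
  ring

lemma hasSum_logDeriv_thP {s q : ℂ} (hs : ‖s‖ = 1) (hq : ‖q‖ < 1) :
    HasSum (fun n : ℕ => -(n * q ^ n * (s + s⁻¹ - 2 * q ^ n) /
      (1 - (s + s⁻¹) * q ^ n + (q ^ n) ^ 2))) (q * logDeriv (thP s) q) := by
  have hs0 : s ≠ 0 := by rintro rfl; simp at hs
  have hs' : ‖s⁻¹‖ = 1 := by rw [norm_inv, hs, inv_one]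
  have hb : Metric.ball (0 : ℂ) 1 ∈ 𝓝 q := Metric.isOpen_ball.mem_nhds (mem_ball_zero_iff.2 hq)
  have e : logDeriv (thP s) q = logDeriv (fun u => qP (s * u) u) q +
      logDeriv (fun u => qP (s⁻¹ * u) u) q :=
    logDeriv_mul q (qP_ne_zero_of_norm_lt hq (by simpa [hs] using hq))
      (qP_ne_zero_of_norm_lt hq (by simpa [hs] using hq))
      ((qP_mul_self_differentiableOn s).differentiableAt hb)
      ((qP_mul_self_differentiableOn s⁻¹).differentiableAt hb)
  rw [e, mul_add]
  refine ((hasSum_logDeriv_qP_mul hs hq).add (hasSum_logDeriv_qP_mul hs' hq)).congr_fun fun n => ?_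
  rcases eq_or_ne n 0 with rfl | hn
  · simp
  have hD := one_sub_add_sq_ne_zero hs hq hn
  have hf : 1 - (s + s⁻¹) * q ^ n + (q ^ n) ^ 2 = (1 - s * q ^ n) * (1 - s⁻¹ * q ^ n) := by
    field_simp
    ring
  rw [hf] at hD ⊢
  have h1 := left_ne_zero_of_mul hD
  have h2 := right_ne_zero_of_mul hD
  have e2 : 2 * q ^ n = s * s⁻¹ * q ^ n + s * s⁻¹ * q ^ n := by rw [mul_inv_cancel₀ hs0]; ring
  rw [e2, ← neg_add, div_add_div _ _ h1 h2]
  congr 2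
  ring

/-- The primitive cube root of unity `e^{2πi/3}`. -/
def ω : ℂ := ex (1 / 3)

lemma norm_ω : ‖ω‖ = 1 := by
  rw [ω, norm_ex]; simp

lemma ω_cube : ω ^ 3 = 1 := by
  rw [ω, ← ex_nat_mul]
  norm_num [ex_one]

lemma ω_ne_one : ω ≠ 1 := by
  intro h
  obtain ⟨n, hn⟩ := Complex.exp_eq_one_iff.1 h
  have h2 : (2 * (Real.pi : ℂ) * Complex.I) ≠ 0 := Complex.two_pi_I_ne_zero
  have h3 : (1 / 3 : ℂ) = n := by
    refine mul_left_cancel₀ h2 ?_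
    rw [mul_comm _ (n : ℂ)]
    exact hn
  have h4 : ((3 * n : ℤ) : ℂ) = ((1 : ℤ) : ℂ) := by
    push_cast
    rw [← h3]
    norm_num
  have := Int.cast_injective h4
  omega

lemma one_add_ω_add_sq : 1 + ω + ω ^ 2 = 0 := by
  have h : (ω - 1) * (1 + ω + ω ^ 2) = 0 := by
    have := ω_cube
    linear_combination this
  exact (mul_eq_zero.1 h).resolve_left (sub_ne_zero.2 ω_ne_one)

lemma ω_add_inv : ω + ω⁻¹ = -1 := by
  have h0 : ω ≠ 0 := ex_ne_zero _
  field_simp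
  linear_combination one_add_ω_add_sq

/-- The difference of the logarithmic derivatives of `thP s` and `thP ω`. -/
def LD (s q : ℂ) : ℂ := logDeriv (thP s) q - logDeriv (thP ω) q

lemma hasSum_LD {s q : ℂ} (hs : ‖s‖ = 1) (hq : ‖q‖ < 1) :
    HasSum (fun n : ℕ => -(s + s⁻¹ + 1) * (n * q ^ n * (1 - (q ^ n) ^ 2) /
      ((1 + q ^ n + (q ^ n) ^ 2) * (1 - (s + s⁻¹) * q ^ n + (q ^ n) ^ 2)))) (q * LD s q) := by
  rw [LD, mul_sub]
  refine ((hasSum_logDeriv_thP hs hq).sub (hasSum_logDeriv_thP norm_ω hq)).congr_fun fun n => ?_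
  rcases eq_or_ne n 0 with rfl | hn
  · simp
  have h1 := one_sub_add_sq_ne_zero hs hq hn
  have h2 := one_sub_add_sq_ne_zero norm_ω hq hn
  rw [ω_add_inv] at h2 ⊢
  have h3 : 1 - -1 * q ^ n + (q ^ n) ^ 2 = 1 + q ^ n + (q ^ n) ^ 2 := by ring
  rw [h3] at h2 ⊢
  generalize q ^ n = u at *
  generalize s + s⁻¹ = σ at *
  field_simp
  ring

lemma differentiableOn_logDeriv {f : ℂ → ℂ} {U : Set ℂ} (hU : IsOpen U)
    (hf : DifferentiableOn ℂ f U) (h0 : ∀ z ∈ U, f z ≠ 0) : DifferentiableOn ℂ (logDeriv f) U :=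
  (hf.deriv hU).div hf h0

lemma LD_differentiableOn {s : ℂ} (hs : ‖s‖ = 1) :
    DifferentiableOn ℂ (LD s) (Metric.ball 0 1) :=
  (differentiableOn_logDeriv Metric.isOpen_ball (thP_differentiableOn s)
    fun _ hz => thP_ne_zero hs (mem_ball_zero_iff.1 hz)).sub
  (differentiableOn_logDeriv Metric.isOpen_ball (thP_differentiableOn ω)
    fun _ hz => thP_ne_zero norm_ω (mem_ball_zero_iff.1 hz))

/-- The generating function `genE s`, as a function of the modular parameter. -/
def EF (s q : ℂ) : ℂ :=
  -(qP q q ^ 3 * aG q / (qP (q ^ 3) (q ^ 3) ^ 9 * (s + s⁻¹ + 1))) * LD s q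

lemma qP_self_ne_zero {q : ℂ} (hq : ‖q‖ < 1) : qP q q ≠ 0 := qP_ne_zero_of_norm_lt hq hq

lemma qP_cube_ne_zero {q : ℂ} (hq : ‖q‖ < 1) : qP (q ^ 3) (q ^ 3) ≠ 0 :=
  qP_self_ne_zero (norm_pow_lt_one hq three_ne_zero)

lemma qP_self_differentiableOn : DifferentiableOn ℂ (fun q => qP q q) (Metric.ball 0 1) :=
  qP_differentiableOn Metric.isOpen_ball differentiableOn_id differentiableOn_id
    fun _ hu => mem_ball_zero_iff.1 hu

lemma qP_cube_differentiableOn :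
    DifferentiableOn ℂ (fun q : ℂ => qP (q ^ 3) (q ^ 3)) (Metric.ball 0 1) :=
  qP_differentiableOn Metric.isOpen_ball (differentiableOn_id.pow 3) (differentiableOn_id.pow 3)
    fun _ hu => norm_pow_lt_one (mem_ball_zero_iff.1 hu) three_ne_zero

lemma EF_differentiableOn {s : ℂ} (hs : ‖s‖ = 1) (h1 : s + s⁻¹ + 1 ≠ 0) :
    DifferentiableOn ℂ (EF s) (Metric.ball 0 1) := by
  refine (((qP_self_differentiableOn.pow 3).mul aG_differentiableOn).div
    ((qP_cube_differentiableOn.pow 9).mul_const _) fun q hq => ?_).neg.mul (LD_differentiableOn hs)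
  exact mul_ne_zero (pow_ne_zero _ (qP_cube_ne_zero (mem_ball_zero_iff.1 hq))) h1

lemma genE_eq_EF {s ϖ q : ℂ} (hs : ‖s‖ = 1) (hs1 : s ≠ 1) (h1 : s + s⁻¹ + 1 ≠ 0)
    (hϖ : ‖ϖ‖ < 1 / 10000) (hϖq : ϖ ^ 3 = q) (hq0 : q ≠ 0) (hq : ‖q‖ ≤ 1 / 10 ^ 9) :
    genE s (tK ϖ q) = EF s q := by
  have hq1 : ‖q‖ < 1 := hq.trans_lt (by norm_num)
  have hϖ0 : ϖ ≠ 0 := by rintro rfl; exact hq0 (by rw [← hϖq]; norm_num)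
  have hA := qP_self_ne_zero hq1
  have hB := qP_cube_ne_zero hq1
  have ha := aG_ne_zero hq
  have h2 := (hasSum_tK_mul_genE hs hs1 hϖ hϖq hq0 hq).unique
    ((((hasSum_LD hs hq1).mul_left (-(s + s⁻¹ + 1)⁻¹)).mul_left (-(gK ϖ q q / q ^ 2))).congr_fun
      fun n => by rw [← mul_assoc (-(s + s⁻¹ + 1)⁻¹), neg_mul_neg, inv_mul_cancel₀ h1, one_mul])
  rw [gK_self hq0 hq1] at h2
  have ht : tK ϖ q ≠ 0 := by
    rw [tK, aF_eq_aG hq0 hq1]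
    positivity
  refine mul_left_cancel₀ ht (h2.trans ?_)
  rw [tK, aF_eq_aG hq0 hq1, EF]
  field_simp

/-! ### Extraction of coefficients by a contour integral -/

lemma hasSum_circleIntegral {f : ℕ → ℂ → ℂ} {g : ℂ → ℂ} {r : ℝ} (hr : 0 < r) {b : ℕ → ℝ}
    (hb : Summable b) (hf : ∀ n, ContinuousOn (f n) (Metric.sphere 0 r))
    (hfb : ∀ n, ∀ z ∈ Metric.sphere (0 : ℂ) r, ‖f n z‖ ≤ b n)
    (hg : ∀ z ∈ Metric.sphere (0 : ℂ) r, HasSum (fun n => f n z) (g z)) :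
    HasSum (fun n => ∮ z in C(0, r), f n z) (∮ z in C(0, r), g z) := by
  have hm : ∀ θ : ℝ, circleMap 0 r θ ∈ Metric.sphere (0 : ℂ) r :=
    fun θ => circleMap_mem_sphere 0 hr.le θ
  refine intervalIntegral.hasSum_integral_of_dominated_convergence (fun n _ => |r| * b n)
    (fun n => ?_) (fun n => ?_) ?_ ?_ ?_
  · have h1 : Continuous fun θ => f n (circleMap 0 r θ) :=
      (hf n).comp_continuous (continuous_circleMap 0 r) hm
    have h2 : Continuous (deriv (circleMap 0 r)) := by
      rw [show deriv (circleMap 0 r) = fun θ => circleMap 0 r θ * Complex.I from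
        funext fun θ => deriv_circleMap 0 r θ]
      exact (continuous_circleMap 0 r).mul continuous_const
    exact (h2.smul h1).aestronglyMeasurable
  · refine Eventually.of_forall fun θ _ => ?_
    rw [norm_smul]
    have : ‖deriv (circleMap 0 r) θ‖ = |r| := by simp
    rw [this]
    exact mul_le_mul_of_nonneg_left (hfb n _ (hm θ)) (abs_nonneg r)
  · exact Eventually.of_forall fun θ _ => hb.mul_left _
  · exact intervalIntegrable_const
  · exact Eventually.of_forall fun θ _ => (hg _ (hm θ)).const_smul _

lemma hasSum_genE_cube {s t : ℂ} (hs : ‖s‖ = 1) (ht : ‖t‖ < 1 / 3) :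
    HasSum (fun j : ℕ => walkSum (3 * j) (wtE s) * (t ^ 3) ^ j) (genE s t) := by
  have h := (summable_genF (wtE s) ht (norm_wtE_le hs)).hasSum
  have hi : Function.Injective fun j : ℕ => 3 * j := fun a b h => by simpa using h
  have h2 := (hi.hasSum_iff (f := fun n => t ^ n * walkSum n (wtE s)) fun n hn => by
    rw [walkSum_wtE_eq_zero n s, mul_zero]
    rintro ⟨k, rfl⟩
    exact hn ⟨k, rfl⟩).2 h
  refine h2.congr_fun fun j => ?_
  rw [Function.comp_apply, ← pow_mul, mul_comm]

lemma norm_walkSum_wtE_le {s : ℂ} (hs : ‖s‖ = 1) (j : ℕ) :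
    ‖walkSum (3 * j) (wtE s)‖ ≤ 27 ^ j := by
  have := norm_walkSum_le (3 * j) (wtE s) 1 (norm_wtE_le hs)
  rw [pow_mul, mul_one] at this
  norm_num at this
  exact this

/-- The numerator of `YF`. -/
def WF (q : ℂ) : ℂ := qP q q ^ 3 * aG q ^ 3 / qP (q ^ 3) (q ^ 3) ^ 9

/-- The function `t⁻³` in terms of the modular parameter. -/
def YF (q : ℂ) : ℂ := WF q / q

lemma WF_differentiableOn : DifferentiableOn ℂ WF (Metric.ball 0 1) :=
  ((qP_self_differentiableOn.pow 3).mul (aG_differentiableOn.pow 3)).div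
    (qP_cube_differentiableOn.pow 9)
    fun _ hq => pow_ne_zero _ (qP_cube_ne_zero (mem_ball_zero_iff.1 hq))

lemma WF_ne_zero {q : ℂ} (hq : ‖q‖ ≤ 1 / 10 ^ 9) : WF q ≠ 0 := by
  have hq1 : ‖q‖ < 1 := hq.trans_lt (by norm_num)
  have hA := qP_self_ne_zero hq1
  have hB := qP_cube_ne_zero hq1
  have ha := aG_ne_zero hq
  unfold WF
  positivity

lemma YF_differentiableAt {q : ℂ} (hq0 : q ≠ 0) (hq : ‖q‖ < 1) : DifferentiableAt ℂ YF q :=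
  (WF_differentiableOn.differentiableAt
    (Metric.isOpen_ball.mem_nhds (mem_ball_zero_iff.2 hq))).div differentiableAt_id hq0

lemma isOpen_punctured : IsOpen (Metric.ball (0 : ℂ) 1 \ {0}) :=
  Metric.isOpen_ball.sdiff isClosed_singleton

lemma YF_differentiableOn : DifferentiableOn ℂ YF (Metric.ball 0 1 \ {0}) :=
  fun _ hq => (YF_differentiableAt hq.2 (mem_ball_zero_iff.1 hq.1)).differentiableWithinAt

lemma deriv_YF_differentiableOn : DifferentiableOn ℂ (deriv YF) (Metric.ball 0 1 \ {0}) :=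
  YF_differentiableOn.deriv isOpen_punctured

lemma circleIntegral_zpow_YF {k : ℤ} (hk : k ≠ -1) {r : ℝ} (hr : 0 < r) (hr1 : r ≤ 1 / 10 ^ 9) :
    (∮ z in C(0, r), YF z ^ k * deriv YF z) = 0 := by
  have hk1 : ((k + 1 : ℤ) : ℂ) ≠ 0 := Int.cast_ne_zero.2 (by omega)
  refine circleIntegral.integral_eq_zero_of_hasDerivWithinAt
    (f := fun z => YF z ^ (k + 1) / ((k + 1 : ℤ) : ℂ)) hr.le fun z hz => ?_
  have hz1 : ‖z‖ = r := mem_sphere_zero_iff_norm.1 hz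
  have hz0 : z ≠ 0 := norm_pos_iff.1 (by rw [hz1]; exact hr)
  have hz2 : ‖z‖ < 1 := hz1.trans_lt (hr1.trans_lt (by norm_num))
  have hY : YF z ≠ 0 := div_ne_zero (WF_ne_zero (hz1.trans_le hr1)) hz0
  have h := (hasDerivAt_zpow (k + 1) (YF z) (Or.inl hY)).comp z
    (YF_differentiableAt hz0 hz2).hasDerivAt
  have h2 := (h.div_const ((k + 1 : ℤ) : ℂ)).hasDerivWithinAt (s := Metric.sphere 0 r)
  rw [add_sub_cancel_right, mul_assoc, mul_div_cancel_left₀ _ hk1] at h2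
  exact h2

lemma circleIntegral_logDeriv_YF {r : ℝ} (hr : 0 < r) (hr1 : r ≤ 1 / 10 ^ 9) :
    (∮ z in C(0, r), YF z ^ (-1 : ℤ) * deriv YF z) = -(2 * Real.pi * Complex.I) := by
  have hsub : Metric.closedBall (0 : ℂ) r ⊆ Metric.ball 0 1 :=
    Metric.closedBall_subset_ball (hr1.trans_lt (by norm_num))
  have hW : ∀ z ∈ Metric.closedBall (0 : ℂ) r, DifferentiableAt ℂ (logDeriv WF) z := by
    intro z hz
    have hn := Metric.isOpen_ball.mem_nhds (hsub hz)
    exact ((WF_differentiableOn.deriv Metric.isOpen_ball).differentiableAt hn).div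
      (WF_differentiableOn.differentiableAt hn)
      (WF_ne_zero ((mem_closedBall_zero_iff.1 hz).trans hr1))
  have h1 : (∮ z in C(0, r), logDeriv WF z) = 0 :=
    Complex.circleIntegral_eq_zero_of_differentiable_on_off_countable hr.le Set.countable_empty
      (fun z hz => (hW z hz).continuousAt.continuousWithinAt)
      fun z hz => hW z (Metric.ball_subset_closedBall hz.1)
  have h2 : (∮ z in C(0, r), (z - 0)⁻¹) = 2 * Real.pi * Complex.I :=
    circleIntegral.integral_sub_center_inv 0 hr.ne'
  have h3 : (∮ z in C(0, r), YF z ^ (-1 : ℤ) * deriv YF z) =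
      ∮ z in C(0, r), (logDeriv WF z - (z - 0)⁻¹) := by
    refine circleIntegral.integral_congr hr.le fun z hz => ?_
    have hz1 : ‖z‖ = r := mem_sphere_zero_iff_norm.1 hz
    have hz0 : z ≠ 0 := norm_pos_iff.1 (by rw [hz1]; exact hr)
    have h := logDeriv_div (f := WF) (g := id) z (WF_ne_zero (hz1.trans_le hr1)) hz0
      (WF_differentiableOn.differentiableAt (Metric.isOpen_ball.mem_nhds
        (hsub (Metric.sphere_subset_closedBall hz)))) differentiableAt_id
    rw [logDeriv_id] at h
    have h5 : YF z ^ (-1 : ℤ) * deriv YF z = logDeriv (fun z => WF z / id z) z := by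
      rw [logDeriv_apply, zpow_neg_one, div_eq_inv_mul]
      rfl
    rw [h5, h, sub_zero, one_div]
  rw [h3, circleIntegral.integral_sub, h1, h2, zero_sub]
  · exact circleIntegrable_of_continuousAt hr fun z hz =>
      (hW z (mem_closedBall_zero_iff.2 hz.le)).continuousAt
  · refine circleIntegrable_of_continuousAt hr fun z hz => ?_
    have hz0 : z - 0 ≠ 0 := norm_pos_iff.1 (by rw [sub_zero, hz]; exact hr)
    exact (continuousAt_id.sub continuousAt_const).inv₀ hz0

lemma EF_hasSum {s q : ℂ} (hs : ‖s‖ = 1) (hs1 : s ≠ 1) (h1 : s + s⁻¹ + 1 ≠ 0) (hq0 : q ≠ 0)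
    (hq : ‖q‖ ≤ 1 / 10 ^ 13) : ‖(YF q)⁻¹‖ ≤ 1 / 10 ^ 6 ∧
      HasSum (fun j : ℕ => walkSum (3 * j) (wtE s) * (YF q)⁻¹ ^ j) (EF s q) := by
  have hq9 : ‖q‖ ≤ 1 / 10 ^ 9 := hq.trans (by norm_num)
  have hq1 : ‖q‖ < 1 := hq.trans_lt (by norm_num)
  obtain ⟨ϖ, hϖ⟩ := IsAlgClosed.exists_pow_nat_eq q three_pos
  have hn : ‖ϖ‖ < 1 / 10000 := by
    by_contra! h
    have h2 := pow_le_pow_left₀ (by norm_num) h 3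
    rw [← norm_pow, hϖ] at h2
    norm_num at h2 hq
    linarith
  have ht := norm_tK_le hn hq0 hq9
  have hX : tK ϖ q ^ 3 = (YF q)⁻¹ := by
    rw [tK, aF_eq_aG hq0 hq1, YF, WF, ← hϖ]
    field_simp
  rw [← hX, ← genE_eq_EF hs hs1 h1 hn hϖ hq0 hq9]
  refine ⟨?_, hasSum_genE_cube hs (ht.trans_lt (by norm_num))⟩
  rw [norm_pow]
  exact (pow_le_pow_left₀ (norm_nonneg _) ht 3).trans (by norm_num)

lemma walkSum_eq_small_circleIntegral {s : ℂ} (hs : ‖s‖ = 1) (hs1 : s ≠ 1)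
    (h1 : s + s⁻¹ + 1 ≠ 0) (m : ℕ) :
    (∮ z in C(0, 1 / 10 ^ 13), EF s z * YF z ^ m * deriv YF z) =
      -(2 * Real.pi * Complex.I) * walkSum (3 * (m + 1)) (wtE s) := by
  set r : ℝ := 1 / 10 ^ 13 with hr
  have hr0 : 0 < r := by rw [hr]; norm_num
  have hr9 : r ≤ 1 / 10 ^ 9 := by rw [hr]; norm_num
  have hne : ∀ z ∈ Metric.sphere (0 : ℂ) r, z ≠ 0 := fun z hz =>
    norm_pos_iff.1 (by rw [mem_sphere_zero_iff_norm.1 hz]; exact hr0)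
  have hlt : ∀ z ∈ Metric.sphere (0 : ℂ) r, z ∈ Metric.ball (0 : ℂ) 1 \ {0} := fun z hz =>
    ⟨mem_ball_zero_iff.2 ((mem_sphere_zero_iff_norm.1 hz).trans_lt (by rw [hr]; norm_num)), hne z hz⟩
  have hY : ∀ z ∈ Metric.sphere (0 : ℂ) r, YF z ≠ 0 := fun z hz =>
    div_ne_zero (WF_ne_zero ((mem_sphere_zero_iff_norm.1 hz).trans_le hr9)) (hne z hz)
  have hcY : ContinuousOn YF (Metric.sphere 0 r) := YF_differentiableOn.continuousOn.mono hlt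
  have hcY' : ContinuousOn (deriv YF) (Metric.sphere 0 r) :=
    deriv_YF_differentiableOn.continuousOn.mono hlt
  obtain ⟨C, hC⟩ := (isCompact_sphere (0 : ℂ) r).exists_bound_of_continuousOn
    ((hcY.pow m).mul hcY')
  have hsum := hasSum_circleIntegral (f := fun j z => walkSum (3 * j) (wtE s) * (YF z)⁻¹ ^ j *
      (YF z ^ m * deriv YF z)) (g := fun z => EF s z * (YF z ^ m * deriv YF z)) hr0
      (b := fun j => (27 / 10 ^ 6 : ℝ) ^ j * C)
      ((summable_geometric_of_lt_one (by norm_num) (by norm_num)).mul_right C)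
      (fun j => (continuousOn_const.mul ((hcY.inv₀ hY).pow j)).mul ((hcY.pow m).mul hcY'))
      (fun j z hz => ?_) (fun z hz => ?_)
  · simp only [mul_assoc] at hsum ⊢
    refine hsum.unique ?_
    have h2 : ∀ j : ℕ, (∮ z in C(0, r), walkSum (3 * j) (wtE s) * ((YF z)⁻¹ ^ j *
        (YF z ^ m * deriv YF z))) =
        walkSum (3 * j) (wtE s) * ∮ z in C(0, r), YF z ^ ((m : ℤ) - j) * deriv YF z := by
      intro j
      rw [← circleIntegral.integral_const_mul]
      refine circleIntegral.integral_congr hr0.le fun z hz => ?_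
      have := hY z hz
      rw [zpow_sub₀ this, zpow_natCast, zpow_natCast, inv_pow]
      field_simp
    simp only [h2]
    have h3 := hasSum_single (f := fun j : ℕ => walkSum (3 * j) (wtE s) *
      ∮ z in C(0, r), YF z ^ ((m : ℤ) - j) * deriv YF z) (m + 1) fun j hj => by
        rw [circleIntegral_zpow_YF (by omega) hr0 hr9, mul_zero]
    convert h3 using 1
    have h4 : ((m : ℤ) - ((m + 1 : ℕ) : ℤ)) = -1 := by push_cast; ring
    rw [h4, circleIntegral_logDeriv_YF hr0 hr9]
    ring
  · have h2 := (EF_hasSum hs hs1 h1 (hne z hz) (mem_sphere_zero_iff_norm.1 hz).le).1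
    rw [norm_mul, norm_mul, norm_pow]
    have h3 : (27 / 10 ^ 6 : ℝ) ^ j = 27 ^ j * (1 / 10 ^ 6) ^ j := by
      rw [← mul_pow]; norm_num
    rw [h3]
    gcongr
    · exact norm_walkSum_wtE_le hs j
    · exact hC z hz
  · exact (EF_hasSum hs hs1 h1 (hne z hz) (mem_sphere_zero_iff_norm.1 hz).le).2.mul_right _

/-- The coefficients of `genE s` as contour integrals over any circle in the unit disc. -/
lemma walkSum_eq_circleIntegral {s : ℂ} (hs : ‖s‖ = 1) (hs1 : s ≠ 1)
    (h1 : s + s⁻¹ + 1 ≠ 0) (m : ℕ) {r : ℝ} (hr : 1 / 10 ^ 13 ≤ r) (hr1 : r < 1) :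
    (∮ z in C(0, r), EF s z * YF z ^ m * deriv YF z) =
      -(2 * Real.pi * Complex.I) * walkSum (3 * (m + 1)) (wtE s) := by
  rw [← walkSum_eq_small_circleIntegral hs hs1 h1]
  refine circleIntegral_annulus_eq (by norm_num) hr fun z hz1 hz2 => ?_
  have hz0 : z ≠ 0 := norm_pos_iff.1 (lt_of_lt_of_le (by norm_num) hz1)
  have hz3 : ‖z‖ < 1 := hz2.trans_lt hr1
  have hb := mem_ball_zero_iff.2 hz3
  exact (((EF_differentiableOn hs h1).differentiableAt (Metric.isOpen_ball.mem_nhds hb)).mul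
    ((YF_differentiableAt hz0 hz3).pow m)).mul
    (deriv_YF_differentiableOn.differentiableAt (isOpen_punctured.mem_nhds ⟨hb, hz0⟩))

/-! ### Modular relations -/

/-- The Lambert series `1 + 6 ∑ pⁿ / (1 + pⁿ + p²ⁿ)`. -/
def a1 (p : ℂ) : ℂ := 1 + 6 * ∑' n : ℕ, p ^ (n + 1) / (1 + p ^ (n + 1) + (p ^ (n + 1)) ^ 2)

/-- The square root of `-3`. -/
def κ : ℂ := ω - ω⁻¹

lemma ω_ne_zero : ω ≠ 0 := ex_ne_zero _

lemma ω_inv : ω⁻¹ = ω ^ 2 := by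
  refine inv_eq_of_mul_eq_one_right ?_
  linear_combination ω_cube

lemma κ_sq : κ ^ 2 = -3 := by
  rw [κ, ω_inv]
  have := one_add_ω_add_sq
  linear_combination (ω ^ 2 - 3 * ω + 3) * this

lemma κ_ne_zero : κ ≠ 0 := by
  intro h
  have := κ_sq
  rw [h] at this
  norm_num at this

lemma hasSum_logDeriv_jT {Z q : ℂ} (hq : ‖q‖ < 1) (hZ : ‖Z‖ = 1) (hZ1 : Z ≠ 1) :
    HasSum (fun n : ℕ => -(Z * q ^ (n + 1)) / (1 - Z * q ^ (n + 1)) +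
      Z⁻¹ * q ^ (n + 1) / (1 - Z⁻¹ * q ^ (n + 1)))
      (Z * logDeriv (fun Z => jT Z q) Z + Z / (1 - Z)) := by
  have hZ0 : Z ≠ 0 := by rintro rfl; simp at hZ
  have hU : IsOpen ({0}ᶜ : Set ℂ) := isOpen_compl_singleton
  have hZi : ‖Z⁻¹‖ = 1 := by rw [norm_inv, hZ, inv_one]
  have hn1 : ∀ n : ℕ, Z * q ^ n ≠ 1 := by
    intro n h
    rcases n with _ | n
    · simp [hZ1] at h
    · rw [pow_succ', ← mul_assoc] at h
      exact mul_pow_ne_one hZ hq n h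
  have hn2 : ∀ n : ℕ, q / Z * q ^ n ≠ 1 := by
    intro n h
    rw [div_eq_inv_mul] at h
    exact mul_pow_ne_one hZi hq n h
  have h1 := logDeriv_qP (Z := fun u => u) (q := fun _ => q) hU differentiableOn_id
    (differentiableOn_const q) (fun _ _ => hq) (x := Z) hZ0 hn1
  have hd : ∀ x ∈ ({0}ᶜ : Set ℂ), HasDerivAt (fun u : ℂ => q / u) (q * -(x ^ 2)⁻¹) x := by
    intro x hx
    simp only [div_eq_mul_inv]
    exact (hasDerivAt_inv hx).const_mul q
  have h2 := logDeriv_qP (Z := fun u => q / u) (q := fun _ => q) hU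
    (fun x hx => (hd x hx).differentiableAt.differentiableWithinAt)
    (differentiableOn_const q) (fun _ _ => hq) (x := Z) hZ0 hn2
  have e : logDeriv (fun Z => jT Z q) Z = logDeriv (fun u => qP u q) Z +
      logDeriv (fun u => qP (q / u) q) Z :=
    logDeriv_mul Z (qP_ne_zero hq hn1) (qP_ne_zero hq hn2) (qP_differentiable_left hq Z)
      ((qP_differentiable_left hq _).comp Z (hd Z hZ0).differentiableAt)
  rw [e, mul_add, add_right_comm]
  refine HasSum.add ?_ ?_
  · have h3 := (hasSum_nat_add_iff' 1).2 (h1.mul_left Z)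
    have hne : 1 - Z ≠ 0 := sub_ne_zero.2 hZ1.symm
    simp only [Finset.range_one, Finset.sum_singleton, deriv_id'', deriv_const, pow_zero,
      mul_zero, add_zero, mul_one, one_mul] at h3
    have h5 : Z * logDeriv (fun u => qP u q) Z + Z / (1 - Z) =
        Z * logDeriv (fun u => qP u q) Z - Z * (-1 / (1 + -Z)) := by
      rw [← sub_eq_add_neg 1 Z]; ring
    rw [h5]
    refine h3.congr_fun fun n => ?_
    rw [← sub_eq_add_neg]; ring
  · refine (h2.mul_left Z).congr_fun fun n => ?_
    rw [(hd Z hZ0).deriv, deriv_const]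
    have h4 : 1 + -(q / Z * q ^ n) = 1 - Z⁻¹ * q ^ (n + 1) := by rw [pow_succ]; ring
    rw [h4, mul_zero, mul_zero, add_zero, ← mul_div_assoc]
    congr 1
    rw [pow_succ]
    field_simp

lemma hasSum_a1 {p : ℂ} (hp : ‖p‖ < 1) :
    HasSum (fun n : ℕ => p ^ (n + 1) / (1 + p ^ (n + 1) + (p ^ (n + 1)) ^ 2))
      (-κ⁻¹ * (ω * logDeriv (fun Z => jT Z p) ω + ω / (1 - ω))) := by
  refine ((hasSum_logDeriv_jT hp norm_ω ω_ne_one).mul_left (-κ⁻¹)).congr_fun fun n => ?_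
  have hD := one_sub_add_sq_ne_zero norm_ω hp (Nat.succ_ne_zero n)
  rw [Nat.succ_eq_add_one] at hD
  generalize p ^ (n + 1) = u at *
  have hω := ω_ne_zero
  have hf : 1 - (ω + ω⁻¹) * u + u ^ 2 = (1 - ω * u) * (1 - ω⁻¹ * u) := by
    field_simp
    ring
  have hf2 : 1 + u + u ^ 2 = (1 - ω * u) * (1 - ω⁻¹ * u) := by
    rw [← hf, ω_add_inv]; ring
  rw [hf] at hD
  rw [hf2]
  have h1 := left_ne_zero_of_mul hD
  have h2 := right_ne_zero_of_mul hD
  have hk := κ_ne_zero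
  rw [div_add_div _ _ h1 h2, ← mul_div_assoc]
  congr 1
  have : -(ω * u) * (1 - ω⁻¹ * u) + (1 - ω * u) * (ω⁻¹ * u) = -κ * u := by
    rw [κ]; ring
  rw [this]
  field_simp

lemma a1_eq {p : ℂ} (hp : ‖p‖ < 1) :
    κ * a1 p = 3 * (1 - 2 * (ω * logDeriv (fun Z => jT Z p) ω)) := by
  rw [a1, (hasSum_a1 hp).tsum_eq]
  have hk := κ_ne_zero
  have hne : 1 - ω ≠ 0 := sub_ne_zero.2 ω_ne_one.symm
  have h2 : κ * (1 - ω) = 3 * (1 + ω) := by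
    rw [κ, ω_inv]
    linear_combination (ω - 3) * one_add_ω_add_sq
  have h3 : κ = 3 * (1 + ω) / (1 - ω) := by rw [eq_div_iff hne, h2]
  rw [mul_add, mul_one, show ∀ L : ℂ, κ * (6 * (-κ⁻¹ * L)) = -6 * L by intro L; field_simp]
  nth_rewrite 1 [h3]
  field_simp
  ring

lemma jT_ω {p : ℂ} (hp : ‖p‖ < 1) :
    jT ω p * qP p p = (1 - ω) * qP (p ^ 3) (p ^ 3) := by
  have h := qP_cube p ω one_add_ω_add_sq hp
  unfold jT
  rw [qP_succ ω hp, div_eq_inv_mul, ω_inv, ← h]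
  ring

/-- The point `-1/(3t)`. -/
def S3 (t : ℂ) : ℂ := -1 / (3 * t)

lemma ne_zero_of_im_pos {t : ℂ} (ht : 0 < t.im) : t ≠ 0 := by rintro rfl; simp at ht

lemma S3_im_pos {t : ℂ} (ht : 0 < t.im) : 0 < (S3 t).im := by
  have h0 := Complex.normSq_pos.2 (ne_zero_of_im_pos ht)
  have : S3 t = ((1 / 3 : ℝ) : ℂ) * (-t⁻¹) := by
    have := ne_zero_of_im_pos ht
    rw [S3]; push_cast; field_simp
  rw [this, Complex.im_ofReal_mul, Complex.neg_im, Complex.inv_im]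
  rw [neg_div, neg_neg]
  positivity

lemma jT_inversion_three {t : ℂ} (ht : 0 < t.im) : ∃ G : ℂ, G ≠ 0 ∧ ∀ z : ℂ,
    jT (ex z) (ex (S3 t) ^ 3) = G * Complex.exp (Real.pi * Complex.I * (z ^ 2 * t + z * t + z)) *
      jT (ex (-z * t)) (ex t) := by
  have ht0 := ne_zero_of_im_pos ht
  have h3 : 3 * S3 t = -t⁻¹ := by rw [S3]; field_simp
  have him : 0 < (3 * S3 t).im := by
    have := S3_im_pos ht
    simpa using this
  obtain ⟨G, hG, h⟩ := jT_inversion him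
  refine ⟨G, hG, fun z => ?_⟩
  have := h z
  rw [ex_three_mul, h3] at this
  rw [this]
  congr 3
  · congr 1
    field_simp
    ring
  · field_simp
  · field_simp

lemma hasDerivAt_jT_ex {c q : ℂ} (z : ℂ) (hq : ‖q‖ < 1) (t : ℂ) (hc : c = ex (z * t)) :
    HasDerivAt (fun z => jT (ex (z * t)) q)
      (2 * Real.pi * Complex.I * t * (c * deriv (fun Z => jT Z q) c)) z := by
  subst hc
  have h1 : HasDerivAt (fun z => ex (z * t)) (2 * Real.pi * Complex.I * ex (z * t) * t) z := by
    have := (hasDerivAt_ex (z * t)).comp z ((hasDerivAt_id z).mul_const t)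
    rwa [one_mul] at this
  have := (jT_differentiableAt (ex_ne_zero (z * t)) hq).hasDerivAt.comp z h1
  refine this.congr_deriv ?_
  ring

/-- The modular relations of the theta products under `t ↦ -1/(3t)`. -/
lemma modular_relations {t : ℂ} (ht : 0 < t.im) :
    aG (ex (S3 t)) = -κ * t * a1 (ex t) ∧
    κ * ex (S3 t / 3) * qP (ex (S3 t) ^ 3) (ex (S3 t) ^ 3) ^ 3 * qP (ex t ^ 3) (ex t ^ 3) =
      t * qP (ex t) (ex t) ^ 3 * qP (ex (S3 t)) (ex (S3 t)) := by
  obtain ⟨G, hG, hJ⟩ := jT_inversion_three ht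
  have ht0 := ne_zero_of_im_pos ht
  have hq := norm_ex_lt_one (S3_im_pos ht)
  have hp := norm_ex_lt_one ht
  have hq0 := ex_ne_zero (S3 t)
  have hq3 := norm_pow_lt_one hq three_ne_zero
  set q := ex (S3 t) with hqdef
  set p := ex t with hpdef
  have hπ : (2 * Real.pi * Complex.I : ℂ) ≠ 0 := Complex.two_pi_I_ne_zero
  have hexp : ∀ z : ℂ, HasDerivAt
      (fun z : ℂ => Complex.exp (Real.pi * Complex.I * (z ^ 2 * t + z * t + z)))
      (Complex.exp (Real.pi * Complex.I * (z ^ 2 * t + z * t + z)) *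
        (Real.pi * Complex.I * (2 * z * t + t + 1))) z := by
    intro z
    have h1 : HasDerivAt (fun z : ℂ => z ^ 2 * t + z * t + z) (2 * z * t + t + 1) z := by
      have := ((((hasDerivAt_id z).pow 2).mul_const t).add ((hasDerivAt_id z).mul_const t)).add
        (hasDerivAt_id z)
      refine this.congr_deriv ?_
      simp
    exact (h1.const_mul _).cexp
  have hR : ∀ z c : ℂ, c = ex (-z * t) → HasDerivAt (fun z => jT (ex (-z * t)) p)
      (-(2 * Real.pi * Complex.I * t * (c * deriv (fun Z => jT Z p) c))) z := by
    intro z c hc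
    have := (hasDerivAt_jT_ex (-z) hp t hc).comp z (hasDerivAt_neg z)
    refine this.congr_deriv ?_
    ring
  have hL : ∀ z c : ℂ, c = ex z → HasDerivAt (fun z => jT (ex z) (q ^ 3))
      (2 * Real.pi * Complex.I * (c * deriv (fun Z => jT Z (q ^ 3)) c)) z := by
    intro z c hc
    have := hasDerivAt_jT_ex z hq3 1 (c := c) (by rw [mul_one, hc])
    simpa using this
  have hD : ∀ z c d : ℂ, c = ex z → d = ex (-z * t) →
      2 * Real.pi * Complex.I * (c * deriv (fun Z => jT Z (q ^ 3)) c) =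
      G * (Complex.exp (Real.pi * Complex.I * (z ^ 2 * t + z * t + z)) *
        (Real.pi * Complex.I * (2 * z * t + t + 1))) * jT (ex (-z * t)) p +
      G * Complex.exp (Real.pi * Complex.I * (z ^ 2 * t + z * t + z)) *
        -(2 * Real.pi * Complex.I * t * (d * deriv (fun Z => jT Z p) d)) := by
    intro z c d hc hd
    refine (hL z c hc).unique ?_
    have h2 := ((hexp z).const_mul G).mul (hR z d hd)
    refine h2.congr_of_eventuallyEq (Eventually.of_forall fun w => hJ w)
  have hB : qP (q ^ 3) (q ^ 3) ^ 2 = -t * G * qP p p ^ 2 := by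
    have h := hD 0 1 1 ex_zero.symm (by rw [neg_zero, zero_mul, ex_zero])
    rw [(hasDerivAt_jT_one hq3).deriv, (hasDerivAt_jT_one hp).deriv, neg_zero, zero_mul, ex_zero,
      jT_one hp] at h
    simp only [mul_zero, zero_mul, zero_add, ne_eq, OfNat.ofNat_ne_zero, not_false_eq_true,
      zero_pow, Complex.exp_zero] at h
    refine mul_left_cancel₀ hπ ?_
    linear_combination -h
  have hS : -S3 t * t = 1 / 3 := by rw [S3]; field_simp
  have hZ : ex (-S3 t * t) = ω := by rw [hS, ω]
  have hE : Complex.exp (Real.pi * Complex.I * (S3 t ^ 2 * t + S3 t * t + S3 t)) =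
      -ω * ex (S3 t / 3) := by
    have e1 : -ω = ex (-1 / 6) := by
      rw [show (-1 / 6 : ℂ) = 1 / 2 + 1 / 3 - 1 by norm_num, ex_sub, ex_add, ex_half, ex_one, ω]
      ring
    have h5 : S3 t ^ 2 * t + S3 t * t + S3 t = 2 * (-1 / 6 + S3 t / 3) := by
      linear_combination (-S3 t - 1) * hS
    rw [e1, ← ex_add, ex, h5]
    congr 1
    ring
  have hA : jT q (q ^ 3) = G * (-ω * ex (S3 t / 3)) * jT ω p := by
    have h := hJ (S3 t)
    rwa [hZ, hE, ← hqdef] at h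
  have hBne : qP (q ^ 3) (q ^ 3) ≠ 0 := qP_cube_ne_zero hq
  have hAne : qP q q ≠ 0 := qP_self_ne_zero hq
  have hApne : qP p p ≠ 0 := qP_self_ne_zero hp
  have hjq : jT q (q ^ 3) ≠ 0 := by
    have := jT_self_cube hq0 hq
    intro h0
    rw [h0, zero_mul] at this
    exact hAne this.symm
  have hjω : jT ω p ≠ 0 := by
    intro h0
    rw [h0, mul_zero] at hA
    exact hjq hA
  constructor
  · rw [← aF_eq_aG hq0 hq, aF]
    have hd : deriv (fun Z => jT (q * Z) (q ^ 3)) 1 = q * deriv (fun Z => jT Z (q ^ 3)) q := by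
      have h1 : HasDerivAt (fun Z : ℂ => q * Z) q 1 := by
        simpa using (hasDerivAt_id (1 : ℂ)).const_mul q
      have h2 : HasDerivAt (fun Z => jT Z (q ^ 3)) (deriv (fun Z => jT Z (q ^ 3)) q) (q * 1) := by
        rw [mul_one]
        exact (jT_differentiableAt hq0 hq3).hasDerivAt
      have := (h2.comp 1 h1).deriv
      rw [mul_comm] at this
      exact this
    rw [logDeriv_apply, hd, mul_one]
    have h := hD (S3 t) q ω rfl hZ.symm
    rw [hE, hZ] at h
    have hk := a1_eq hp
    rw [logDeriv_apply] at hk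
    rw [show -κ * t * a1 p = -t * (κ * a1 p) by ring, hk]
    have h6 : 2 * S3 t * t = -2 / 3 := by linear_combination -2 * hS
    rw [h6] at h
    have h7 : q * deriv (fun Z => jT Z (q ^ 3)) q = jT q (q ^ 3) *
        ((1 / 3 + t) / 2 - t * (ω * (deriv (fun Z => jT Z p) ω / jT ω p))) := by
      rw [hA]
      refine mul_left_cancel₀ hπ ?_
      rw [h]
      field_simp
      ring
    rw [h7, mul_div_cancel_left₀ _ hjq]
    ring
  · have h1 := jT_self_cube hq0 hq
    have h2 := jT_ω hp
    have h3 : κ = ω * (1 - ω) := by rw [κ, ω_inv]; ring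
    rw [h3]
    refine mul_right_cancel₀ hApne ?_
    refine mul_left_cancel₀ hG ?_
    calc G * (ω * (1 - ω) * ex (S3 t / 3) * qP (q ^ 3) (q ^ 3) ^ 3 * qP (p ^ 3) (p ^ 3) * qP p p)
        = (G * (ω * ex (S3 t / 3)) * ((1 - ω) * qP (p ^ 3) (p ^ 3))) *
          qP (q ^ 3) (q ^ 3) * qP (q ^ 3) (q ^ 3) ^ 2 * qP p p := by ring
      _ = -(G * (-ω * ex (S3 t / 3)) * jT ω p * qP (q ^ 3) (q ^ 3)) * qP (q ^ 3) (q ^ 3) ^ 2 *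
          qP p p ^ 2 := by rw [← h2]; ring
      _ = G * (t * qP p p ^ 3 * qP q q * qP p p) := by rw [← hA, h1, hB]; ring

/-- The eta quotient `∏ (1 - pⁿ)³ / (1 - p³ⁿ)`. -/
def bF (p : ℂ) : ℂ := qP p p ^ 3 / qP (p ^ 3) (p ^ 3)

/-- The quotient of `a1` and `bF`. -/
def uF (p : ℂ) : ℂ := a1 p / bF p

lemma bF_ne_zero {p : ℂ} (hp : ‖p‖ < 1) : bF p ≠ 0 :=
  div_ne_zero (pow_ne_zero _ (qP_self_ne_zero hp)) (qP_cube_ne_zero hp)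

lemma bF_differentiableOn : DifferentiableOn ℂ bF (Metric.ball 0 1) :=
  (qP_self_differentiableOn.pow 3).div qP_cube_differentiableOn
    fun _ hq => qP_cube_ne_zero (mem_ball_zero_iff.1 hq)

lemma eta_S3 {t : ℂ} (ht : 0 < t.im) :
    qP (ex (S3 t)) (ex (S3 t)) ^ 3 / (ex (S3 t) * qP (ex (S3 t) ^ 3) (ex (S3 t) ^ 3) ^ 9) =
      (κ / (t * bF (ex t))) ^ 3 := by
  have h := (modular_relations ht).2
  have hA := qP_self_ne_zero (norm_ex_lt_one ht)
  have hB := qP_cube_ne_zero (norm_ex_lt_one ht)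
  have hA' := qP_self_ne_zero (norm_ex_lt_one (S3_im_pos ht))
  have hB' := qP_cube_ne_zero (norm_ex_lt_one (S3_im_pos ht))
  have ht0 := ne_zero_of_im_pos ht
  have hϖ := ex_ne_zero (S3 t / 3)
  have h3 : ex (S3 t) = ex (S3 t / 3) ^ 3 := by rw [← ex_three_mul]; congr 1; ring
  have h1 : qP (ex (S3 t)) (ex (S3 t)) / (ex (S3 t / 3) * qP (ex (S3 t) ^ 3) (ex (S3 t) ^ 3) ^ 3) =
      κ / (t * bF (ex t)) := by
    rw [bF]
    rw [div_eq_div_iff (by positivity) (by positivity)]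
    field_simp
    linear_combination -h
  rw [← h1, div_pow, mul_pow, ← h3, ← pow_mul]

lemma YF_S3 {t : ℂ} (ht : 0 < t.im) : YF (ex (S3 t)) = 27 * uF (ex t) ^ 3 := by
  have h := eta_S3 ht
  have ht0 := ne_zero_of_im_pos ht
  have hb := bF_ne_zero (norm_ex_lt_one ht)
  have hk : κ ^ 6 = -27 := by
    rw [show κ ^ 6 = (κ ^ 2) ^ 3 by ring, κ_sq]; norm_num
  rw [YF, WF, (modular_relations ht).1, uF]
  calc _ = (qP (ex (S3 t)) (ex (S3 t)) ^ 3 /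
        (ex (S3 t) * qP (ex (S3 t) ^ 3) (ex (S3 t) ^ 3) ^ 9)) * (-κ * t * a1 (ex t)) ^ 3 := by
        rw [div_div, div_mul_eq_mul_div, mul_comm (ex (S3 t))]
    _ = _ := by
      rw [h]
      field_simp
      linear_combination -a1 (ex t) ^ 3 * hk

lemma hasDerivAt_S3 {t : ℂ} (ht : t ≠ 0) : HasDerivAt S3 (1 / (3 * t ^ 2)) t := by
  have h := (hasDerivAt_inv ht).const_mul (-1 / 3 : ℂ)
  have e : S3 = fun t => -1 / 3 * t⁻¹ := by
    funext t
    rw [S3, ← div_div, div_eq_mul_inv (-1 / 3 : ℂ)]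
  rw [e]
  refine h.congr_deriv ?_
  field_simp

lemma hasDerivAt_ex_S3 {t : ℂ} (ht : t ≠ 0) :
    HasDerivAt (fun t => ex (S3 t)) (2 * Real.pi * Complex.I * ex (S3 t) * (1 / (3 * t ^ 2))) t :=
  (hasDerivAt_ex (S3 t)).comp t (hasDerivAt_S3 ht)

/-- The theta product `∏ (1 - e^{2πi(3k+ν)t}) (1 - e^{2πi(3k+3-ν)t})`. -/
def Nn (ν t : ℂ) : ℂ := qP (ex (ν * t)) (ex (3 * t)) * qP (ex ((3 - ν) * t)) (ex (3 * t))

/-- The exponential prefactor in the inversion formula. -/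
def Ef (z t : ℂ) : ℂ := Complex.exp (Real.pi * Complex.I * ((3 * z ^ 2 - 3 * z) * t + z))

lemma jT_ex_eq_thP (s : ℂ) {q : ℂ} (hq : ‖q‖ < 1) : jT s q = (1 - s) * thP s q := by
  rw [jT, qP_succ s hq, thP, div_eq_inv_mul, mul_assoc]

lemma thP_S3 {t : ℂ} (ht : 0 < t.im) : ∃ G : ℂ, G ≠ 0 ∧ ∀ z : ℂ,
    (1 - ex z) * thP (ex z) (ex (S3 t)) = G * Ef z t * Nn (3 * z) t := by
  obtain ⟨G, hG, h⟩ := jT_inversion (S3_im_pos ht)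
  have ht0 := ne_zero_of_im_pos ht
  have him : 0 < (3 * t).im := by simpa using ht
  refine ⟨-G, neg_ne_zero.2 hG, fun z => ?_⟩
  rw [← jT_ex_eq_thP _ (norm_ex_lt_one (S3_im_pos ht)), h z]
  have h1 : -1 / S3 t = 3 * t := by rw [S3]; field_simp
  have h2 : z / S3 t = -(3 * z * t) := by rw [S3]; field_simp
  rw [h1]
  have h3 : jT (ex (3 * z * t)) (ex (3 * t)) = Nn (3 * z) t := by
    rw [jT, Nn, ← ex_sub, sub_mul]
  have h4 : Complex.exp (Real.pi * Complex.I * (-z ^ 2 / S3 t - z / S3 t + z)) *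
      ex (-(3 * z * t)) = Ef z t := by
    rw [ex, Ef, ← Complex.exp_add, neg_div, pow_two, mul_div_assoc, h2]
    congr 1
    ring
  have h5 : jT (ex (z / S3 t)) (ex (3 * t)) = -ex (-(3 * z * t)) * Nn (3 * z) t := by
    rw [h2, ex_neg, jT_inv (ex_ne_zero _) (norm_ex_lt_one him), h3]
  rw [h5, ← h4]
  ring

lemma thP_cross {t : ℂ} (ht : 0 < t.im) (γ : ℂ) :
    (1 - ex γ) * (thP (ex γ) (ex (S3 t)) * (Ef (1 / 3) t * Nn 1 t)) =
      (1 - ω) * (thP ω (ex (S3 t)) * (Ef γ t * Nn (3 * γ) t)) := by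
  obtain ⟨G, hG, h⟩ := thP_S3 ht
  have h1 := h (1 / 3)
  have h2 := h γ
  rw [show (3 : ℂ) * (1 / 3) = 1 by norm_num] at h1
  change (1 - ω) * thP ω (ex (S3 t)) = _ at h1
  calc _ = ((1 - ex γ) * thP (ex γ) (ex (S3 t))) * (Ef (1 / 3) t * Nn 1 t) := by ring
    _ = ((1 - ω) * thP ω (ex (S3 t))) * (Ef γ t * Nn (3 * γ) t) := by rw [h1, h2]; ring
    _ = _ := by ring

lemma isOpen_upper : IsOpen {t : ℂ | 0 < t.im} := isOpen_lt continuous_const Complex.continuous_im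

lemma hasDerivAt_ex_mul (μ t : ℂ) :
    HasDerivAt (fun t => ex (μ * t)) (2 * Real.pi * Complex.I * μ * ex (μ * t)) t := by
  have := (hasDerivAt_ex (μ * t)).comp t ((hasDerivAt_id t).const_mul μ)
  refine this.congr_deriv ?_
  ring

lemma norm_ex_mul (μ : ℝ) (t : ℂ) : ‖ex (μ * t)‖ = Real.exp (-(2 * Real.pi * μ * t.im)) := by
  rw [norm_ex]
  congr 1
  simp
  ring

lemma norm_ex_mul_lt_one {μ : ℝ} (hμ : 0 < μ) {t : ℂ} (ht : 0 < t.im) : ‖ex (μ * t)‖ < 1 := by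
  rw [norm_ex_mul, Real.exp_lt_one_iff]
  have := Real.pi_pos
  have : 0 < 2 * Real.pi * μ * t.im := by positivity
  linarith

lemma ex_ne_one {μ : ℝ} (hμ : 0 < μ) {t : ℂ} (ht : 0 < t.im) : ex (μ * t) ≠ 1 := by
  intro h
  have := norm_ex_mul_lt_one hμ ht
  rw [h, norm_one] at this
  exact lt_irrefl _ this

lemma ex_mul_pow (μ t : ℂ) (n : ℕ) : ex (μ * t) * ex (3 * t) ^ n = ex ((μ + 3 * n) * t) := by
  rw [← ex_nat_mul, ← ex_add]
  congr 1
  ring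

lemma qP_ex_differentiableOn (μ : ℂ) :
    DifferentiableOn ℂ (fun t => qP (ex (μ * t)) (ex (3 * t))) {t | 0 < t.im} :=
  qP_differentiableOn isOpen_upper
    (fun t _ => (hasDerivAt_ex_mul μ t).differentiableAt.differentiableWithinAt)
    (fun t _ => (hasDerivAt_ex_mul 3 t).differentiableAt.differentiableWithinAt)
    fun t ht => norm_ex_lt_one (by simpa using ht)

lemma qP_ex_ne_one {μ : ℝ} (hμ : 0 < μ) {t : ℂ} (ht : 0 < t.im) (n : ℕ) :
    ex (μ * t) * ex (3 * t) ^ n ≠ 1 := by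
  rw [ex_mul_pow]
  have := ex_ne_one (μ := μ + 3 * n) (by positivity) ht
  push_cast at this
  exact this

lemma qP_ex_ne_zero {μ : ℝ} (hμ : 0 < μ) {t : ℂ} (ht : 0 < t.im) :
    qP (ex (μ * t)) (ex (3 * t)) ≠ 0 :=
  qP_ne_zero (norm_ex_lt_one (by simpa using ht)) (qP_ex_ne_one hμ ht)

lemma hasSum_logDeriv_qP_ex {μ : ℝ} (hμ : 0 < μ) {t : ℂ} (ht : 0 < t.im) :
    HasSum (fun n : ℕ => -(2 * Real.pi * Complex.I) *
      ((μ + 3 * n : ℝ) * ex ((μ + 3 * n : ℝ) * t) / (1 - ex ((μ + 3 * n : ℝ) * t))))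
      (logDeriv (fun t => qP (ex (μ * t)) (ex (3 * t))) t) := by
  have h := logDeriv_qP (Z := fun t => ex (μ * t)) (q := fun t => ex (3 * t)) isOpen_upper
    (fun t _ => (hasDerivAt_ex_mul μ t).differentiableAt.differentiableWithinAt)
    (fun t _ => (hasDerivAt_ex_mul 3 t).differentiableAt.differentiableWithinAt)
    (fun t ht => norm_ex_lt_one (by simpa using ht)) ht (qP_ex_ne_one hμ ht)
  refine h.congr_fun fun n => ?_
  have e := ex_mul_pow μ t n
  push_cast
  rw [(hasDerivAt_ex_mul μ t).deriv, (hasDerivAt_ex_mul 3 t).deriv, ← e, ← sub_eq_add_neg,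
    ← mul_div_assoc]
  congr 1
  rcases n with _ | n
  · simp
    ring
  · push_cast
    ring

lemma Nn_differentiableOn (ν : ℂ) : DifferentiableOn ℂ (Nn ν) {t | 0 < t.im} :=
  (qP_ex_differentiableOn ν).mul (qP_ex_differentiableOn (3 - ν))

lemma Nn_ne_zero {ν : ℝ} (h0 : 0 < ν) (h3 : ν < 3) {t : ℂ} (ht : 0 < t.im) : Nn ν t ≠ 0 := by
  refine mul_ne_zero (qP_ex_ne_zero h0 ht) ?_
  have := qP_ex_ne_zero (μ := 3 - ν) (by linarith) ht
  push_cast at this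
  exact this

lemma hasDerivAt_Ef (z t : ℂ) :
    HasDerivAt (Ef z) (Ef z t * (Real.pi * Complex.I * (3 * z ^ 2 - 3 * z))) t := by
  have h1 : HasDerivAt (fun t : ℂ => (3 * z ^ 2 - 3 * z) * t + z) (3 * z ^ 2 - 3 * z) t := by
    have := ((hasDerivAt_id t).const_mul (3 * z ^ 2 - 3 * z)).add_const z
    refine this.congr_deriv ?_
    ring
  exact (h1.const_mul _).cexp

lemma Ef_ne_zero (z t : ℂ) : Ef z t ≠ 0 := Complex.exp_ne_zero _

lemma logDeriv_Ef (z t : ℂ) : logDeriv (Ef z) t = Real.pi * Complex.I * (3 * z ^ 2 - 3 * z) := by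
  rw [logDeriv_apply, (hasDerivAt_Ef z t).deriv, mul_div_cancel_left₀ _ (Ef_ne_zero z t)]

/-- The transformed logarithmic derivative. -/
def Ψ (γ t : ℂ) : ℂ := Real.pi * Complex.I * (3 * γ ^ 2 - 3 * γ + 2 / 3) +
  (logDeriv (Nn (3 * γ)) t - logDeriv (Nn 1) t)

lemma LD_S3 {γ : ℝ} (h0 : 0 < γ) (h1 : γ < 1) {t : ℂ} (ht : 0 < t.im) :
    2 * Real.pi * Complex.I * ex (S3 t) * (1 / (3 * t ^ 2)) * LD (ex γ) (ex (S3 t)) = Ψ γ t := by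
  have ht0 := ne_zero_of_im_pos ht
  have hU := isOpen_upper.mem_nhds ht
  have hq := norm_ex_lt_one (S3_im_pos ht)
  have hγ1 : ‖ex γ‖ = 1 := by rw [norm_ex]; simp
  have hθ : ∀ s : ℂ, ‖s‖ = 1 → logDeriv (fun t => thP s (ex (S3 t))) t =
      logDeriv (thP s) (ex (S3 t)) * (2 * Real.pi * Complex.I * ex (S3 t) * (1 / (3 * t ^ 2))) ∧
      DifferentiableAt ℂ (fun t => thP s (ex (S3 t))) t := by
    intro s _
    have h1 := ((thP_differentiableOn s).differentiableAt
      (Metric.isOpen_ball.mem_nhds (mem_ball_zero_iff.2 hq))).hasDerivAt.comp t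
      (hasDerivAt_ex_S3 ht0)
    refine ⟨?_, h1.differentiableAt⟩
    rw [logDeriv_apply, logDeriv_apply]
    have h2 := h1.deriv
    rw [Function.comp_def] at h2
    rw [h2]
    ring
  have hN : ∀ ν : ℝ, 0 < ν → ν < 3 → DifferentiableAt ℂ (Nn ν) t ∧ Nn ν t ≠ 0 := fun ν a b =>
    ⟨(Nn_differentiableOn ν).differentiableAt hU, Nn_ne_zero a b ht⟩
  have key : ∀ (s z : ℂ) (ν : ℝ) (c : ℂ), ‖s‖ = 1 → c ≠ 0 → 0 < ν → ν < 3 →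
      logDeriv (fun t => c * (thP s (ex (S3 t)) * (Ef z t * Nn ν t))) t =
      logDeriv (thP s) (ex (S3 t)) * (2 * Real.pi * Complex.I * ex (S3 t) * (1 / (3 * t ^ 2))) +
        (Real.pi * Complex.I * (3 * z ^ 2 - 3 * z) + logDeriv (Nn ν) t) := by
    intro s z ν c hs hc a b
    obtain ⟨n1, n2⟩ := hN ν a b
    obtain ⟨t1, t2⟩ := hθ s hs
    have hE := (hasDerivAt_Ef z t).differentiableAt
    have hE0 : Ef z t ≠ 0 := Complex.exp_ne_zero _
    have h3 := logDeriv_mul (f := fun t => thP s (ex (S3 t))) (g := fun t => Ef z t * Nn ν t) t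
      (thP_ne_zero hs hq) (mul_ne_zero hE0 n2) t2 (hE.mul n1)
    have h4 := logDeriv_mul (f := Ef z) (g := Nn ν) t hE0 n2 hE n1
    rw [logDeriv_const_mul t c hc, h3, h4, t1, logDeriv_Ef]
  have hω1 : (1 - ω) ≠ 0 := sub_ne_zero.2 ω_ne_one.symm
  have hs1 : ex γ ≠ 1 := by
    intro h
    obtain ⟨n, hn⟩ := Complex.exp_eq_one_iff.1 h
    have h3 : (γ : ℂ) = n := by
      refine mul_left_cancel₀ Complex.two_pi_I_ne_zero ?_
      rw [mul_comm _ (n : ℂ)]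
      exact hn
    have h4 : γ = n := by exact_mod_cast h3
    have h5 : (0 : ℝ) < n := h4 ▸ h0
    have h6 : (n : ℝ) < 1 := h4 ▸ h1
    norm_cast at h5 h6
    omega
  have e1 := key (ex γ) (1 / 3) 1 (1 - ex γ) hγ1 (sub_ne_zero.2 hs1.symm) one_pos (by norm_num)
  have e2 := key ω γ (3 * γ) (1 - ω) norm_ω hω1 (by linarith) (by linarith)
  have e3 : logDeriv (fun t => (1 - ex γ) * (thP (ex γ) (ex (S3 t)) *
      (Ef (1 / 3) t * Nn (1 : ℝ) t))) t = logDeriv (fun t => (1 - ω) * (thP ω (ex (S3 t)) *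
      (Ef γ t * Nn (3 * γ : ℝ) t))) t := by
    have : (fun t => (1 - ex γ) * (thP (ex γ) (ex (S3 t)) * (Ef (1 / 3) t * Nn (1 : ℝ) t))) =ᶠ[𝓝 t]
        fun t => (1 - ω) * (thP ω (ex (S3 t)) * (Ef γ t * Nn (3 * γ : ℝ) t)) := by
      filter_upwards [hU] with w hw
      have := thP_cross hw γ
      push_cast
      exact this
    rw [logDeriv_apply, logDeriv_apply, this.deriv_eq, this.eq_of_nhds]
  rw [e1, e2] at e3
  push_cast at e3
  rw [LD, Ψ]
  linear_combination e3

lemma EF_S3 {γ : ℝ} (h0 : 0 < γ) (h1 : γ < 1) {t : ℂ} (ht : 0 < t.im) :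
    EF (ex γ) (ex (S3 t)) = 27 * a1 (ex t) /
      (bF (ex t) ^ 3 * (ex γ + (ex γ)⁻¹ + 1) * (2 * Real.pi * Complex.I)) * Ψ γ t := by
  have h := eta_S3 ht
  have ht0 := ne_zero_of_im_pos ht
  have hq0 := ex_ne_zero (S3 t)
  have hb := bF_ne_zero (norm_ex_lt_one ht)
  have hπ : (2 * Real.pi * Complex.I : ℂ) ≠ 0 := Complex.two_pi_I_ne_zero
  have hk : κ ^ 4 = 9 := by
    rw [show κ ^ 4 = (κ ^ 2) ^ 2 by ring, κ_sq]; norm_num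
  have hB := qP_cube_ne_zero (norm_ex_lt_one (S3_im_pos ht))
  rw [← LD_S3 h0 h1 ht, EF, (modular_relations ht).1]
  generalize ex γ + (ex γ)⁻¹ + 1 = c
  generalize LD (ex γ) (ex (S3 t)) = L
  generalize 2 * Real.pi * Complex.I = P at *
  calc _ = (qP (ex (S3 t)) (ex (S3 t)) ^ 3 /
        (ex (S3 t) * qP (ex (S3 t) ^ 3) (ex (S3 t) ^ 3) ^ 9)) * (κ * t * a1 (ex t)) / c *
        (ex (S3 t) * L) := by
        field_simp
    _ = κ ^ 4 * a1 (ex t) / (t ^ 2 * bF (ex t) ^ 3) / c * (ex (S3 t) * L) := by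
      rw [h]
      field_simp
    _ = _ := by
      rw [hk]
      field_simp
      ring

lemma norm_one_add_add_sq_ge {u : ℂ} (hu : ‖u‖ ≤ 1) : (1 - ‖u‖) ^ 2 ≤ ‖1 + u + u ^ 2‖ := by
  have h : 1 + u + u ^ 2 = (1 - ω * u) * (1 - ω⁻¹ * u) := by
    have hω := ω_ne_zero
    have := ω_add_inv
    have h2 : (1 - ω * u) * (1 - ω⁻¹ * u) = 1 - (ω + ω⁻¹) * u + u ^ 2 := by
      field_simp
      ring
    rw [h2, this]
    ring
  have h1 : ∀ s : ℂ, ‖s‖ = 1 → 1 - ‖u‖ ≤ ‖1 - s * u‖ := by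
    intro s hs
    have := norm_sub_norm_le 1 (s * u)
    rwa [norm_one, norm_mul, hs, one_mul] at this
  rw [h, norm_mul, sq]
  exact mul_le_mul (h1 _ norm_ω) (h1 _ (by rw [norm_inv, norm_ω, inv_one])) (by linarith)
    (norm_nonneg _)

lemma one_add_add_sq_ne_zero {u : ℂ} (hu : ‖u‖ < 1) : 1 + u + u ^ 2 ≠ 0 := by
  have := norm_one_add_add_sq_ge hu.le
  have h2 : 0 < (1 - ‖u‖) ^ 2 := by
    have : 0 < 1 - ‖u‖ := by linarith
    positivity
  exact norm_pos_iff.1 (h2.trans_le this)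

lemma norm_a1_term_le {p : ℂ} {ρ : ℝ} (hρ : ρ < 1) (hp : ‖p‖ ≤ ρ) (n : ℕ) :
    ‖p ^ (n + 1) / (1 + p ^ (n + 1) + (p ^ (n + 1)) ^ 2)‖ ≤ ρ ^ (n + 1) * ((1 - ρ) ^ 2)⁻¹ := by
  have h0 : 0 ≤ ρ := (norm_nonneg p).trans hp
  have h1 : ‖p ^ (n + 1)‖ ≤ ρ := by
    rw [norm_pow]
    exact (pow_le_of_le_one (norm_nonneg _) (hp.trans hρ.le) n.succ_ne_zero).trans hp
  have h2 := norm_one_add_add_sq_ge (h1.trans hρ.le)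
  have h3 : (1 - ρ) ^ 2 ≤ (1 - ‖p ^ (n + 1)‖) ^ 2 := pow_le_pow_left₀ (by linarith) (by linarith) 2
  have h4 : 0 < (1 - ρ) ^ 2 := pow_pos (by linarith) 2
  rw [norm_div, div_eq_mul_inv]
  refine mul_le_mul ?_ (inv_anti₀ h4 (h3.trans h2)) (by positivity) (by positivity)
  rw [norm_pow]
  exact pow_le_pow_left₀ (norm_nonneg _) hp _

lemma a1_differentiableOn : DifferentiableOn ℂ a1 (Metric.ball 0 1) := by
  intro p hp
  have hp1 : ‖p‖ < 1 := mem_ball_zero_iff.1 hp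
  obtain ⟨ρ, h1, h2⟩ := exists_between hp1
  have h0 : 0 ≤ ρ := (norm_nonneg p).trans h1.le
  have hs : Summable fun n : ℕ => ρ ^ (n + 1) * ((1 - ρ) ^ 2)⁻¹ :=
    ((summable_nat_add_iff 1).2 (summable_geometric_of_lt_one h0 h2)).mul_right _
  have hd : DifferentiableOn ℂ (fun p : ℂ => ∑' n : ℕ,
      p ^ (n + 1) / (1 + p ^ (n + 1) + (p ^ (n + 1)) ^ 2)) (Metric.ball 0 ρ) := by
    refine Complex.differentiableOn_tsum_of_summable_norm hs (fun n => ?_) Metric.isOpen_ball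
      fun n z hz => norm_a1_term_le h2 (mem_ball_zero_iff.1 hz).le n
    refine DifferentiableOn.div (by fun_prop) (by fun_prop) fun z hz => ?_
    exact one_add_add_sq_ne_zero (norm_pow_lt_one ((mem_ball_zero_iff.1 hz).trans h2)
      n.succ_ne_zero)
  have := ((hd.const_mul 6).const_add 1).differentiableAt
    (Metric.isOpen_ball.mem_nhds (mem_ball_zero_iff.2 h1))
  exact this.differentiableWithinAt

lemma uF_differentiableOn : DifferentiableOn ℂ uF (Metric.ball 0 1) :=
  a1_differentiableOn.div bF_differentiableOn fun _ hp => bF_ne_zero (mem_ball_zero_iff.1 hp)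

lemma uF_differentiableAt {p : ℂ} (hp : ‖p‖ < 1) : DifferentiableAt ℂ uF p :=
  uF_differentiableOn.differentiableAt (Metric.isOpen_ball.mem_nhds (mem_ball_zero_iff.2 hp))

lemma circleIntegral_eq_line (f : ℂ → ℂ) (h : ℝ) :
    (∮ z in C(0, Real.exp (-(2 * Real.pi * h))), f z) =
      ∫ x in (-1 / 2 : ℝ)..(1 / 2), 2 * Real.pi * Complex.I * ex (x + h * Complex.I) *
        f (ex (x + h * Complex.I)) := by
  set g : ℝ → ℂ := fun x => Complex.I * ex (x + h * Complex.I) * f (ex (x + h * Complex.I)) with hg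
  have hc : ∀ x : ℝ, circleMap 0 (Real.exp (-(2 * Real.pi * h))) (2 * Real.pi * x) =
      ex (x + h * Complex.I) := by
    intro x
    rw [circleMap, zero_add, Complex.ofReal_exp, ← Complex.exp_add, ex]
    congr 1
    push_cast
    linear_combination (-2 * Real.pi * h : ℂ) * Complex.I_sq
  have hper : Function.Periodic g 1 := by
    intro x
    have : ex (((x + 1 : ℝ) : ℂ) + h * Complex.I) = ex (x + h * Complex.I) := by
      rw [show ((x + 1 : ℝ) : ℂ) + h * Complex.I = x + h * Complex.I + 1 by push_cast; ring,
        ex_add, ex_one, mul_one]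
    simp only [hg, this]
  have h1 : (∮ z in C(0, Real.exp (-(2 * Real.pi * h))), f z) =
      (2 * Real.pi : ℝ) • ∫ x in (0 : ℝ)..1, g x := by
    rw [circleIntegral]
    have := intervalIntegral.smul_integral_comp_mul_left (a := 0) (b := 1) (fun θ =>
      deriv (circleMap 0 (Real.exp (-(2 * Real.pi * h)))) θ •
        f (circleMap 0 (Real.exp (-(2 * Real.pi * h))) θ)) (2 * Real.pi)
    rw [mul_zero, mul_one] at this
    rw [← this]
    congr 1
    refine intervalIntegral.integral_congr fun x _ => ?_
    simp only [hg, deriv_circleMap, hc, smul_eq_mul]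
    ring
  have h2 := hper.intervalIntegral_add_eq 0 (-1 / 2)
  rw [zero_add, show (-1 / 2 : ℝ) + 1 = 1 / 2 by norm_num] at h2
  rw [h1, h2, ← intervalIntegral.integral_smul]
  refine intervalIntegral.integral_congr fun x _ => ?_
  simp only [hg, Complex.real_smul]
  push_cast
  ring

/-- The height of the fixed arc of the transformation `S3` over `±1/2`. -/
def h0 : ℝ := √3 / 6

lemma h0_pos : 0 < h0 := by unfold h0; positivity

lemma h0_sq : h0 ^ 2 = 1 / 12 := by
  rw [h0, div_pow, Real.sq_sqrt (by norm_num)]; norm_num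

lemma h0_ge : 1 / 4 ≤ h0 := by
  nlinarith [h0_sq, h0_pos]

lemma h0_le : h0 ≤ 3 / 10 := by
  nlinarith [h0_sq, h0_pos]

lemma im_line (x : ℝ) (h : ℝ) : ((x : ℂ) + h * Complex.I).im = h := by simp

lemma re_line (x : ℝ) (h : ℝ) : ((x : ℂ) + h * Complex.I).re = x := by simp

lemma mem_big_ball {w : ℂ} (h : Complex.normSq w + 2 < 20 * w.im) :
    w ∈ Metric.ball (10 * Complex.I) 9.9 := by
  rw [Metric.mem_ball, Complex.dist_eq, ← sq_lt_sq₀ (norm_nonneg _) (by norm_num),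
    ← Complex.normSq_eq_norm_sq, Complex.normSq_apply]
  rw [Complex.normSq_apply] at h
  simp only [Complex.sub_re, Complex.mul_re, Complex.I_re, Complex.I_im, Complex.sub_im,
    Complex.mul_im, Complex.re_ofNat, Complex.im_ofNat]
  norm_num
  nlinarith

lemma im_pos_of_mem_big_ball {w : ℂ} (h : w ∈ Metric.ball (10 * Complex.I) 9.9) : 0 < w.im := by
  rw [Metric.mem_ball, Complex.dist_eq] at h
  have h1 := (Complex.abs_im_le_norm (w - 10 * Complex.I)).trans_lt h
  simp only [Complex.sub_im, Complex.mul_im, Complex.I_re, Complex.I_im, Complex.re_ofNat,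
    Complex.im_ofNat] at h1
  rw [abs_lt] at h1
  norm_num at h1
  linarith [h1.1]

lemma S3_normSq_im (t : ℂ) : Complex.normSq (S3 t) = 1 / (9 * Complex.normSq t) ∧
    (S3 t).im = t.im / (3 * Complex.normSq t) := by
  have : S3 t = ((-1 / 3 : ℝ) : ℂ) * t⁻¹ := by
    rw [S3, ← div_div, div_eq_mul_inv]
    push_cast
    rfl
  constructor
  · rw [this, map_mul, Complex.normSq_ofReal, map_inv₀]
    field_simp
    norm_num
  · rw [this, Complex.im_ofReal_mul, Complex.inv_im]
    field_simp

lemma integral_line_S3 {F : ℂ → ℂ} (hF : DifferentiableOn ℂ F {t | 0 < t.im}) :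
    (∫ x in (-1 / 2 : ℝ)..(1 / 2), F (x + h0 * Complex.I)) =
      -∫ x in (-1 / 2 : ℝ)..(1 / 2), F (S3 (x + h0 * Complex.I)) *
        (1 / (3 * (x + h0 * Complex.I) ^ 2)) := by
  have hFb : DifferentiableOn ℂ F (Metric.ball (10 * Complex.I) 9.9) :=
    hF.mono fun w hw => im_pos_of_mem_big_ball hw
  obtain ⟨P, hP⟩ := hFb.isExactOn_ball
  have hline : ∀ x : ℝ, HasDerivAt (fun x : ℝ => (x : ℂ) + h0 * Complex.I) 1 x := fun x =>
    (Complex.ofRealCLM.hasDerivAt (x := x)).add_const _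
  have hcl : Continuous fun x : ℝ => (x : ℂ) + h0 * Complex.I := by fun_prop
  have hx : ∀ x ∈ Set.uIcc (-1 / 2 : ℝ) (1 / 2), x ^ 2 ≤ 1 / 4 := by
    intro x hx
    rw [Set.uIcc_of_le (by norm_num)] at hx
    nlinarith [hx.1, hx.2]
  have hnS : ∀ x : ℝ, Complex.normSq ((x : ℂ) + h0 * Complex.I) = x ^ 2 + 1 / 12 := by
    intro x
    rw [Complex.normSq_apply, re_line, im_line, ← h0_sq]
    ring
  have hup : ∀ x : ℝ, 0 < ((x : ℂ) + h0 * Complex.I).im := fun x => by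
    rw [im_line]; exact h0_pos
  have hm1 : ∀ x ∈ Set.uIcc (-1 / 2 : ℝ) (1 / 2),
      (x : ℂ) + h0 * Complex.I ∈ Metric.ball (10 * Complex.I) 9.9 := by
    intro x h
    refine mem_big_ball ?_
    rw [hnS, im_line]
    linarith [hx x h, h0_ge]
  have hm2 : ∀ x ∈ Set.uIcc (-1 / 2 : ℝ) (1 / 2),
      S3 ((x : ℂ) + h0 * Complex.I) ∈ Metric.ball (10 * Complex.I) 9.9 := by
    intro x h
    refine mem_big_ball ?_
    obtain ⟨e1, e2⟩ := S3_normSq_im ((x : ℂ) + h0 * Complex.I)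
    rw [e1, e2, hnS, im_line]
    have h2 := hx x h
    have h3 := sq_nonneg x
    have h4 : 0 < x ^ 2 + 1 / 12 := by positivity
    rw [← sub_pos]
    have : 20 * (h0 / (3 * (x ^ 2 + 1 / 12))) - (1 / (9 * (x ^ 2 + 1 / 12)) + 2) =
        (60 * h0 - 1 - 18 * (x ^ 2 + 1 / 12)) / (9 * (x ^ 2 + 1 / 12)) := by
      field_simp
      ring
    rw [this]
    refine div_pos ?_ (by positivity)
    linarith [h0_ge]
  have hFc : ContinuousOn F {t | 0 < t.im} := hF.continuousOn
  have hI1 : IntervalIntegrable (fun x : ℝ => F (x + h0 * Complex.I)) MeasureTheory.volume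
      (-1 / 2) (1 / 2) :=
    (hFc.comp_continuous hcl hup).intervalIntegrable _ _
  have hSc : Continuous fun x : ℝ => S3 ((x : ℂ) + h0 * Complex.I) := by
    unfold S3
    refine continuous_const.div (by fun_prop) fun x => ?_
    exact mul_ne_zero (by norm_num) (ne_zero_of_im_pos (hup x))
  have hI2 : IntervalIntegrable (fun x : ℝ => F (S3 (x + h0 * Complex.I)) *
      (1 / (3 * (x + h0 * Complex.I) ^ 2))) MeasureTheory.volume (-1 / 2) (1 / 2) := by
    refine Continuous.intervalIntegrable ?_ _ _
    refine (hFc.comp_continuous hSc fun x => S3_im_pos (hup x)).mul ?_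
    refine continuous_const.div (by fun_prop) fun x => ?_
    exact mul_ne_zero (by norm_num) (pow_ne_zero _ (ne_zero_of_im_pos (hup x)))
  have i1 := intervalIntegral.integral_eq_sub_of_hasDerivAt (f := fun x : ℝ => P (x + h0 * Complex.I))
    (fun x h => ((hP _ (hm1 x h)).comp x (hline x)).congr_deriv (mul_one _)) hI1
  have hSd : ∀ x : ℝ, HasDerivAt (fun x : ℝ => S3 ((x : ℂ) + h0 * Complex.I))
      (1 / (3 * ((x : ℂ) + h0 * Complex.I) ^ 2)) x := by
    intro x
    have h1 := (hasDerivAt_S3 (ne_zero_of_im_pos (hup x))).comp x (hline x)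
    rw [mul_one] at h1
    exact h1
  have i2 := intervalIntegral.integral_eq_sub_of_hasDerivAt
    (f := fun x : ℝ => P (S3 (x + h0 * Complex.I)))
    (fun x h => (hP _ (hm2 x h)).comp x (hSd x)) hI2
  have hend : ∀ x : ℝ, x ^ 2 = 1 / 4 →
      S3 ((x : ℂ) + h0 * Complex.I) = ((-x : ℝ) : ℂ) + h0 * Complex.I := by
    intro x hx
    have hne := ne_zero_of_im_pos (hup x)
    rw [S3, div_eq_iff (mul_ne_zero (by norm_num) hne)]
    have e1 : (x : ℂ) ^ 2 = 1 / 4 := by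
      rw [← Complex.ofReal_pow, hx]
      norm_num
    have e2 : (h0 : ℂ) ^ 2 = 1 / 12 := by
      rw [← Complex.ofReal_pow, h0_sq]
      norm_num
    push_cast
    linear_combination 3 * e1 - 3 * (h0 : ℂ) ^ 2 * Complex.I_sq + 3 * e2
  rw [i1, i2, hend (1 / 2) (by norm_num), hend (-1 / 2) (by norm_num)]
  rw [show (-(1 / 2) : ℝ) = -1 / 2 by norm_num, show (-(-1 / 2) : ℝ) = 1 / 2 by norm_num]
  ring

/-- The periodic factor of the line integrand, as a function of `p = ex t`. -/
def Hp (M : ℕ) (p : ℂ) : ℂ :=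
  uF p ^ (3 * M) * (2 * Real.pi * Complex.I * p * deriv uF p) / bF p ^ 2

lemma ex_mem_punctured {t : ℂ} (ht : 0 < t.im) : ex t ∈ Metric.ball (0 : ℂ) 1 \ {0} :=
  ⟨mem_ball_zero_iff.2 (norm_ex_lt_one ht), ex_ne_zero t⟩

lemma deriv_YF_S3 {t : ℂ} (ht : 0 < t.im) :
    deriv YF (ex (S3 t)) * (2 * Real.pi * Complex.I * ex (S3 t) * (1 / (3 * t ^ 2))) =
      81 * uF (ex t) ^ 2 * (2 * Real.pi * Complex.I * ex t * deriv uF (ex t)) := by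
  have hS := S3_im_pos ht
  have h1 : HasDerivAt (fun t => YF (ex (S3 t)))
      (deriv YF (ex (S3 t)) * (2 * Real.pi * Complex.I * ex (S3 t) * (1 / (3 * t ^ 2)))) t := by
    have := (YF_differentiableAt (ex_ne_zero _) (norm_ex_lt_one hS)).hasDerivAt.comp t
      (hasDerivAt_ex_S3 (ne_zero_of_im_pos ht))
    exact this
  have h2 : HasDerivAt (fun t => uF (ex t))
      (deriv uF (ex t) * (2 * Real.pi * Complex.I * ex t)) t :=
    (uF_differentiableAt (norm_ex_lt_one ht)).hasDerivAt.comp t (hasDerivAt_ex t)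
  have h3 := (h2.pow 3).const_mul 27
  have h4 : (fun t => YF (ex (S3 t))) =ᶠ[𝓝 t] fun t => 27 * uF (ex t) ^ 3 := by
    filter_upwards [isOpen_upper.mem_nhds ht] with w hw using YF_S3 hw
  rw [h1.unique (h3.congr_of_eventuallyEq h4)]
  push_cast
  ring

lemma exp_h0_ge : 1 / 10 ^ 13 ≤ Real.exp (-(2 * Real.pi * h0)) := by
  have h1 : 2 * Real.pi * h0 ≤ 2 := by nlinarith [h0_le, Real.pi_lt_d2, Real.pi_pos, h0_pos]
  have h2 : Real.exp (-2) ≤ Real.exp (-(2 * Real.pi * h0)) := Real.exp_le_exp.2 (by linarith)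
  have h3 : Real.exp (-2) = (Real.exp 1 ^ 2)⁻¹ := by
    rw [Real.exp_neg, ← Real.exp_nat_mul]; norm_num
  refine le_trans ?_ h2
  rw [h3, one_div]
  refine inv_anti₀ (by positivity) ?_
  nlinarith [Real.exp_one_lt_d9, Real.exp_pos 1]

lemma walkSum_eq_line {γ : ℝ} (h0' : 0 < γ) (h1 : γ < 1)
    (hc : ex γ + (ex γ)⁻¹ + 1 ≠ 0) {M : ℕ} (hM : 1 ≤ M) :
    walkSum (3 * M) (wtE (ex γ)) =
      27 ^ M * 81 / ((2 * Real.pi * Complex.I) ^ 2 * (ex γ + (ex γ)⁻¹ + 1)) *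
        ∫ x in (-1 / 2 : ℝ)..(1 / 2), Hp M (ex (x + h0 * Complex.I)) *
          Ψ γ (x + h0 * Complex.I) := by
  obtain ⟨m, rfl⟩ := Nat.exists_eq_add_of_le' hM
  have hs : ‖ex γ‖ = 1 := by simp [norm_ex]
  have hs1 : ex (γ : ℂ) ≠ 1 := by
    intro h
    rw [ex, Complex.exp_eq_one_iff] at h
    obtain ⟨n, hn⟩ := h
    have h2 : (γ : ℂ) = n := by
      have := Complex.two_pi_I_ne_zero
      exact mul_left_cancel₀ this (by rw [hn]; ring)
    have h3 : γ = n := by exact_mod_cast h2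
    rw [h3] at h0' h1
    have a : 0 < n := by exact_mod_cast h0'
    have b : n < 1 := by exact_mod_cast h1
    omega
  have key := walkSum_eq_circleIntegral hs hs1 hc m exp_h0_ge
    (by rw [Real.exp_lt_one_iff]; have := Real.pi_pos; have := h0_pos; nlinarith [mul_pos ‹0 < Real.pi› h0_pos])
  rw [circleIntegral_eq_line] at key
  have hF : DifferentiableOn ℂ (fun t => 2 * Real.pi * Complex.I * ex t *
      (EF (ex γ) (ex t) * YF (ex t) ^ m * deriv YF (ex t))) {t | 0 < t.im} := by
    have he : DifferentiableOn ℂ ex {t | 0 < t.im} := fun t _ =>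
      (hasDerivAt_ex t).differentiableAt.differentiableWithinAt
    have hm : Set.MapsTo ex {t : ℂ | 0 < t.im} (Metric.ball (0 : ℂ) 1 \ {0}) :=
      fun t ht => ex_mem_punctured ht
    have hm' : Set.MapsTo ex {t : ℂ | 0 < t.im} (Metric.ball (0 : ℂ) 1) :=
      fun t ht => (ex_mem_punctured ht).1
    exact (he.const_mul _).mul ((((EF_differentiableOn hs hc).comp he hm').mul
      ((YF_differentiableOn.comp he hm).pow m)).mul (deriv_YF_differentiableOn.comp he hm))
  have h2 := integral_line_S3 hF
  rw [h2, neg_mul, neg_inj] at key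
  have hI := Complex.two_pi_I_ne_zero
  rw [← mul_right_inj' hI, ← key, ← mul_assoc, ← intervalIntegral.integral_const_mul]
  refine intervalIntegral.integral_congr fun x _ => ?_
  have ht : 0 < ((x : ℂ) + h0 * Complex.I).im := by rw [im_line]; exact h0_pos
  generalize (x : ℂ) + h0 * Complex.I = t at ht ⊢
  have hb := bF_ne_zero (norm_ex_lt_one ht)
  have ha : a1 (ex t) = uF (ex t) * bF (ex t) := by rw [uF, div_mul_cancel₀ _ hb]
  have hd := deriv_YF_S3 ht
  calc _ = EF (ex γ) (ex (S3 t)) * YF (ex (S3 t)) ^ m * (deriv YF (ex (S3 t)) *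
        (2 * Real.pi * Complex.I * ex (S3 t) * (1 / (3 * t ^ 2)))) := by ring
    _ = _ := by
      rw [hd, YF_S3 ht, EF_S3 h0' h1 ht, ha, Hp]
      generalize ex (γ : ℂ) + (ex (γ : ℂ))⁻¹ + 1 = c at hc ⊢
      have hπ : (Real.pi : ℂ) ≠ 0 := by exact_mod_cast Real.pi_ne_zero
      field_simp
      ring

lemma norm_logDeriv_qP_ex_add_le {μ : ℝ} (hμ : 0 < μ) : ∃ K : ℝ, ∀ t : ℂ, h0 ≤ t.im →
    ‖logDeriv (fun t => qP (ex (μ * t)) (ex (3 * t))) t + 2 * Real.pi * Complex.I * μ * ex (μ * t)‖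
      ≤ K * Real.exp (-(2 * Real.pi * (μ + min μ 3) * t.im)) := by
  have hh := h0_pos
  have hπ := Real.pi_pos
  set C : ℝ := 1 - Real.exp (-(2 * Real.pi * μ * h0)) with hC
  have hC0 : 0 < C := by
    have : Real.exp (-(2 * Real.pi * μ * h0)) < 1 := Real.exp_lt_one_iff.2 (by
      have : 0 < 2 * Real.pi * μ * h0 := by positivity
      linarith)
    linarith
  set ρ : ℝ := Real.exp (-(6 * Real.pi * h0)) with hρ
  have hρ1 : ‖ρ‖ < 1 := by
    rw [Real.norm_of_nonneg (Real.exp_pos _).le]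
    exact Real.exp_lt_one_iff.2 (by nlinarith [mul_pos hπ hh])
  set b : ℕ → ℝ := fun n => 2 * Real.pi * (Real.exp (12 * Real.pi * h0) / C) *
    ((μ + 3 * n) * ρ ^ n) with hb
  have hbs : Summable b := by
    refine Summable.mul_left _ ?_
    have h1 := (summable_geometric_of_norm_lt_one hρ1).mul_left μ
    have h2 := (summable_pow_mul_geometric_of_norm_lt_one 1 hρ1).mul_left 3
    refine (h1.add h2).congr fun n => ?_
    simp only [pow_one]
    ring
  refine ⟨∑' n, b n, fun t ht => ?_⟩
  have htp : 0 < t.im := hh.trans_le ht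
  set E : ℝ := Real.exp (-(2 * Real.pi * (μ + min μ 3) * t.im)) with hE
  have hsum := hasSum_logDeriv_qP_ex hμ htp
  have hlead : HasSum (fun n : ℕ => if n = 0 then 2 * Real.pi * Complex.I * μ * ex (μ * t) else 0)
      (2 * Real.pi * Complex.I * μ * ex (μ * t)) := by
    simpa using hasSum_ite_eq (0 : ℕ) (2 * Real.pi * Complex.I * μ * ex (μ * t))
  have hs := hsum.add hlead
  rw [← hs.tsum_eq, mul_comm _ E, ← tsum_mul_left]
  have hxle : ∀ n : ℕ, C ≤ ‖1 - ex ((μ + 3 * n : ℝ) * t)‖ := by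
    intro n
    have h1 : ‖ex ((μ + 3 * n : ℝ) * t)‖ ≤ Real.exp (-(2 * Real.pi * μ * h0)) := by
      rw [norm_ex_mul, Real.exp_le_exp, neg_le_neg_iff]
      gcongr
      linarith [Nat.cast_nonneg (α := ℝ) n]
    have h2 := norm_sub_norm_le (1 : ℂ) (ex ((μ + 3 * n : ℝ) * t))
    rw [norm_one] at h2
    linarith
  have hexp : ∀ (e : ℝ) (n : ℕ), μ + min μ 3 ≤ e → μ + min μ 3 + 3 * n - 6 ≤ e →
      Real.exp (-(2 * Real.pi * e * t.im)) ≤ E * (Real.exp (12 * Real.pi * h0) * ρ ^ n) := by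
    intro e n h1 h2
    rw [hE, hρ, ← Real.exp_nat_mul, ← Real.exp_add, ← Real.exp_add, Real.exp_le_exp]
    have h3 : 0 ≤ 2 * Real.pi * (e - (μ + min μ 3)) * (t.im - h0) :=
      mul_nonneg (mul_nonneg (by positivity) (by linarith)) (by linarith)
    have h4 : 0 ≤ 2 * Real.pi * h0 * (e - (μ + min μ 3 + 3 * n - 6)) :=
      mul_nonneg (by positivity) (by linarith)
    nlinarith
  refine tsum_of_norm_bounded (hbs.mul_left E).hasSum fun n => ?_
  have hx1 : 1 - ex ((μ + 3 * n : ℝ) * t) ≠ 0 := norm_pos_iff.1 (hC0.trans_le (hxle n))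
  rcases Nat.eq_zero_or_pos n with rfl | hn
  · simp only [Nat.cast_zero, mul_zero, add_zero, if_true] at hx1 ⊢
    have e1 : -(2 * Real.pi * Complex.I) * (μ * ex (μ * t) / (1 - ex (μ * t))) +
        2 * Real.pi * Complex.I * μ * ex (μ * t) =
        -(2 * Real.pi * Complex.I) * (μ * ex (μ * t) ^ 2 / (1 - ex (μ * t))) := by
      field_simp
      ring
    rw [e1]
    have h5 := hxle 0
    simp only [Nat.cast_zero, mul_zero, add_zero] at h5
    have h6 : ‖ex (μ * t)‖ ^ 2 ≤ E * (Real.exp (12 * Real.pi * h0) * ρ ^ 0) := by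
      rw [norm_ex_mul, ← Real.exp_nat_mul]
      refine le_trans (le_of_eq ?_) (hexp (2 * μ) 0 ?_ ?_)
      · congr 1; push_cast; ring
      · linarith [min_le_left μ 3]
      · push_cast; linarith [min_le_left μ 3]
    rw [pow_zero, mul_one] at h6
    simp only [norm_mul, norm_neg, norm_div, norm_pow, Complex.norm_I, Complex.norm_real,
      Real.norm_of_nonneg hμ.le, Real.norm_of_nonneg hπ.le, Complex.norm_ofNat, mul_one]
    calc 2 * Real.pi * (μ * ‖ex (μ * t)‖ ^ 2 / ‖1 - ex (μ * t)‖)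
        ≤ 2 * Real.pi * (μ * (E * Real.exp (12 * Real.pi * h0)) / C) := by gcongr
      _ = _ := by simp only [hb]; push_cast; ring
  · rw [if_neg hn.ne', add_zero]
    have hn1 : (1 : ℝ) ≤ n := by exact_mod_cast hn
    have h6 : ‖ex ((μ + 3 * n : ℝ) * t)‖ ≤ E * (Real.exp (12 * Real.pi * h0) * ρ ^ n) := by
      rw [norm_ex_mul]
      exact hexp _ n (by linarith [min_le_right μ 3]) (by linarith [min_le_right μ 3])
    simp only [norm_mul, norm_neg, norm_div, Complex.norm_I, Complex.norm_real,
      Real.norm_of_nonneg (show 0 ≤ μ + 3 * n by positivity), Real.norm_of_nonneg hπ.le,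
      Complex.norm_ofNat, mul_one]
    calc 2 * Real.pi * ((μ + 3 * n) * ‖ex ((μ + 3 * n : ℝ) * t)‖ / ‖1 - ex ((μ + 3 * n : ℝ) * t)‖)
        ≤ 2 * Real.pi * ((μ + 3 * n) * (E * (Real.exp (12 * Real.pi * h0) * ρ ^ n)) / C) := by
          have := hxle n
          gcongr
      _ = _ := by simp only [hb]; ring

lemma exists_norm_logDeriv_Nn_add_le {ν : ℝ} (hν : 0 < ν) (hν' : ν < 3 / 2) :
    ∃ δ : ℝ, 0 < δ ∧ ∃ K : ℝ, 0 ≤ K ∧ ∀ t : ℂ, h0 ≤ t.im →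
      ‖logDeriv (Nn ν) t + 2 * Real.pi * Complex.I * ν * ex (ν * t)‖ ≤
        K * Real.exp (-(2 * Real.pi * (ν + δ) * t.im)) := by
  have hπ := Real.pi_pos
  obtain ⟨K₁, hK₁⟩ := norm_logDeriv_qP_ex_add_le hν
  obtain ⟨K₂, hK₂⟩ := norm_logDeriv_qP_ex_add_le (μ := 3 - ν) (by linarith)
  refine ⟨min ν (3 - 2 * ν), lt_min hν (by linarith), |K₁| + (|K₂| + 2 * Real.pi * (3 - ν)),
    ?_, fun t ht => ?_⟩
  · have : 0 < 3 - ν := by linarith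
    positivity
  have htp : 0 < t.im := h0_pos.trans_le ht
  have h1 := hK₁ t ht
  have h2 := hK₂ t ht
  have hd1 := (qP_ex_differentiableOn ν).differentiableAt (isOpen_upper.mem_nhds htp)
  have hd2 := (qP_ex_differentiableOn (3 - ν : ℝ)).differentiableAt (isOpen_upper.mem_nhds htp)
  have hm := logDeriv_mul t (qP_ex_ne_zero hν htp)
    (qP_ex_ne_zero (μ := 3 - ν) (by linarith) htp) hd1 hd2
  have hN : Nn ν = fun t => qP (ex (ν * t)) (ex (3 * t)) *
      qP (ex ((3 - ν : ℝ) * t)) (ex (3 * t)) := by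
    funext t
    simp [Nn]
  rw [hN, hm]
  set A := logDeriv (fun t => qP (ex (ν * t)) (ex (3 * t))) t
  set B := logDeriv (fun t => qP (ex ((3 - ν : ℝ) * t)) (ex (3 * t))) t
  have hle : ∀ e : ℝ, ν + min ν (3 - 2 * ν) ≤ e → Real.exp (-(2 * Real.pi * e * t.im)) ≤
      Real.exp (-(2 * Real.pi * (ν + min ν (3 - 2 * ν)) * t.im)) := by
    intro e he
    rw [Real.exp_le_exp, neg_le_neg_iff]
    gcongr
  set R := Real.exp (-(2 * Real.pi * (ν + min ν (3 - 2 * ν)) * t.im))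
  have hR : 0 < R := Real.exp_pos _
  have h3 : ‖A + 2 * Real.pi * Complex.I * ν * ex (ν * t)‖ ≤ |K₁| * R := by
    refine h1.trans (mul_le_mul (le_abs_self _) (hle _ ?_) (Real.exp_pos _).le (abs_nonneg _))
    have : min ν 3 = ν := min_eq_left (by linarith)
    rw [this]
    linarith [min_le_left ν (3 - 2 * ν)]
  have h4 : ‖B + 2 * Real.pi * Complex.I * (3 - ν : ℝ) * ex ((3 - ν : ℝ) * t)‖ ≤ |K₂| * R := by
    refine h2.trans (mul_le_mul (le_abs_self _) (hle _ ?_) (Real.exp_pos _).le (abs_nonneg _))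
    have : 0 ≤ min (3 - ν) 3 := le_min (by linarith) (by norm_num)
    linarith [min_le_right ν (3 - 2 * ν)]
  have h5 : ‖2 * Real.pi * Complex.I * (3 - ν : ℝ) * ex ((3 - ν : ℝ) * t)‖ ≤
      2 * Real.pi * (3 - ν) * R := by
    simp only [norm_mul, norm_ex_mul, Complex.norm_I, Complex.norm_real,
      Real.norm_of_nonneg (show 0 ≤ 3 - ν by linarith), Real.norm_of_nonneg hπ.le,
      Complex.norm_ofNat, mul_one]
    refine mul_le_mul_of_nonneg_left (hle _ ?_) ?_
    · linarith [min_le_right ν (3 - 2 * ν)]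
    · have : 0 < 3 - ν := by linarith
      positivity
  have e : A + B + 2 * Real.pi * Complex.I * ν * ex (ν * t) =
      (A + 2 * Real.pi * Complex.I * ν * ex (ν * t)) +
      ((B + 2 * Real.pi * Complex.I * (3 - ν : ℝ) * ex ((3 - ν : ℝ) * t)) -
        2 * Real.pi * Complex.I * (3 - ν : ℝ) * ex ((3 - ν : ℝ) * t)) := by ring
  rw [e]
  refine (norm_add_le _ _).trans ?_
  have h6 := norm_sub_le (B + 2 * Real.pi * Complex.I * (3 - ν : ℝ) * ex ((3 - ν : ℝ) * t))
    (2 * Real.pi * Complex.I * (3 - ν : ℝ) * ex ((3 - ν : ℝ) * t))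
  nlinarith

/-- The jump of the logarithmic derivative of `Nn ν` between the two sides of the strip. -/
def Δ (ν y : ℝ) : ℂ :=
  logDeriv (Nn ν) (-1 / 2 + y * Complex.I) - logDeriv (Nn ν) (1 / 2 + y * Complex.I)

lemma norm_Δ_add_le {ν : ℝ} (hν : 0 < ν) (hν' : ν < 3 / 2) :
    ∃ δ : ℝ, 0 < δ ∧ ∃ K : ℝ, 0 ≤ K ∧ ∀ y : ℝ, h0 ≤ y →
      ‖Δ ν y + 4 * Real.pi * ν * Real.sin (Real.pi * ν) * Real.exp (-(2 * Real.pi * ν * y))‖ ≤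
        K * Real.exp (-(2 * Real.pi * (ν + δ) * y)) := by
  obtain ⟨δ, hδ, K, hK, h⟩ := exists_norm_logDeriv_Nn_add_le hν hν'
  refine ⟨δ, hδ, K + K, by positivity, fun y hy => ?_⟩
  have h1 := h (-1 / 2 + y * Complex.I) (by simpa using hy)
  have h2 := h (1 / 2 + y * Complex.I) (by simpa using hy)
  have i1 : (-1 / 2 + y * Complex.I : ℂ).im = y := by simp
  have i2 : (1 / 2 + y * Complex.I : ℂ).im = y := by simp
  rw [i1] at h1
  rw [i2] at h2
  have e1 : ∀ a : ℂ, ex (ν * (a + y * Complex.I)) =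
      Complex.exp (2 * Real.pi * ν * a * Complex.I) * Real.exp (-(2 * Real.pi * ν * y)) := by
    intro a
    rw [ex, Complex.ofReal_exp, ← Complex.exp_add]
    congr 1
    push_cast
    linear_combination 2 * (Real.pi : ℂ) * ν * y * Complex.I_sq
  have e2 : (Real.sin (Real.pi * ν) : ℂ) = (Complex.exp (-(Real.pi * ν) * Complex.I) -
      Complex.exp ((Real.pi * ν) * Complex.I)) * Complex.I / 2 := by
    rw [Complex.ofReal_sin, Complex.sin]
    push_cast
    rfl
  have e3 : 2 * Real.pi * Complex.I * ν * ex (ν * (-1 / 2 + y * Complex.I)) -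
      2 * Real.pi * Complex.I * ν * ex (ν * (1 / 2 + y * Complex.I)) =
      4 * Real.pi * ν * Real.sin (Real.pi * ν) * Real.exp (-(2 * Real.pi * ν * y)) := by
    rw [e1, e1, e2, show (2 * Real.pi * ν * (-1 / 2) * Complex.I : ℂ) =
      -(Real.pi * ν) * Complex.I by ring, show (2 * Real.pi * ν * (1 / 2) * Complex.I : ℂ) =
      (Real.pi * ν) * Complex.I by ring]
    ring
  rw [← e3, Δ, add_mul]
  refine le_trans (le_of_eq ?_) ((norm_sub_le _ _).trans (add_le_add h1 h2))
  congr 1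
  ring

/-- The factor of `Hp` that does not depend on the exponent. -/
def gF (p : ℂ) : ℂ := 2 * Real.pi * Complex.I * deriv uF p / bF p ^ 2

lemma Hp_eq (M : ℕ) (p : ℂ) : Hp M p = uF p ^ (3 * M) * (p * gF p) := by
  rw [Hp, gF]
  ring

lemma gF_differentiableOn : DifferentiableOn ℂ gF (Metric.ball 0 1) :=
  ((uF_differentiableOn.deriv Metric.isOpen_ball).const_mul _).div (bF_differentiableOn.pow 2)
    fun _ hp => pow_ne_zero _ (bF_ne_zero (mem_ball_zero_iff.1 hp))

lemma Hp_differentiableOn (M : ℕ) : DifferentiableOn ℂ (Hp M) (Metric.ball 0 1) := by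
  have : Hp M = fun p => uF p ^ (3 * M) * (p * gF p) := funext (Hp_eq M)
  rw [this]
  exact (uF_differentiableOn.pow _).mul (differentiableOn_id.mul gF_differentiableOn)

/-- The radius of the circle of integration. -/
def r0 : ℝ := Real.exp (-(2 * Real.pi * h0))

lemma r0_pos : 0 < r0 := Real.exp_pos _

lemma r0_lt_one : r0 < 1 :=
  Real.exp_lt_one_iff.2 (by nlinarith [mul_pos Real.pi_pos h0_pos])

lemma exp_le_r0 {y : ℝ} (hy : h0 ≤ y) : Real.exp (-(2 * Real.pi * y)) ≤ r0 := by
  rw [r0, Real.exp_le_exp, neg_le_neg_iff]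
  have := Real.pi_pos
  gcongr

lemma exists_norm_le_of_differentiableOn {f : ℂ → ℂ}
    (hf : DifferentiableOn ℂ f (Metric.ball 0 1)) :
    ∃ C : ℝ, 0 ≤ C ∧ ∀ p : ℂ, ‖p‖ ≤ r0 → ‖f p‖ ≤ C := by
  have hK := isCompact_closedBall (0 : ℂ) r0
  obtain ⟨C, hC⟩ := hK.exists_bound_of_continuousOn
    (hf.continuousOn.mono (Metric.closedBall_subset_ball r0_lt_one))
  refine ⟨|C|, abs_nonneg _, fun p hp => ?_⟩
  exact (hC p (mem_closedBall_zero_iff.2 hp)).trans (le_abs_self _)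

lemma ex_side {a : ℂ} (ha : a = 1 / 2 ∨ a = -1 / 2) (y : ℝ) :
    ex (a + y * Complex.I) = -(Real.exp (-(2 * Real.pi * y)) : ℂ) := by
  have h1 : ex a = -1 := by
    rcases ha with rfl | rfl
    · exact ex_half
    · rw [neg_div, ex_neg, ex_half]; norm_num
  rw [ex_add, h1, neg_one_mul, ex, Complex.ofReal_exp]
  congr 2
  push_cast
  linear_combination 2 * (Real.pi : ℂ) * y * Complex.I_sq

lemma logDeriv_Nn_one_add_one (t : ℂ) : logDeriv (Nn 1) (t + 1) = logDeriv (Nn 1) t := by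
  have h : (fun t => Nn 1 (t + 1)) = Nn 1 := by
    funext t
    have h3 : ex (3 : ℂ) = 1 := by
      rw [show (3 : ℂ) = 1 + 1 + 1 by norm_num, ex_add, ex_add, ex_one]; norm_num
    have h2 : ex (2 : ℂ) = 1 := by
      rw [show (2 : ℂ) = 1 + 1 by norm_num, ex_add, ex_one]; norm_num
    simp only [Nn, mul_add, one_mul, mul_one, ex_add, h3, ex_one,
      show (3 - 1 : ℂ) = 2 by norm_num, h2]
  rw [logDeriv_apply, logDeriv_apply, ← deriv_comp_add_const (Nn 1) 1 t, h,
    show Nn 1 (t + 1) = Nn 1 t from congrFun h t]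

lemma Ψ_side_sub (γ y : ℝ) : Ψ γ (-1 / 2 + y * Complex.I) - Ψ γ (1 / 2 + y * Complex.I) =
    Δ (3 * γ) y := by
  have h := logDeriv_Nn_one_add_one (-1 / 2 + y * Complex.I)
  rw [show (-1 / 2 + y * Complex.I + 1 : ℂ) = 1 / 2 + y * Complex.I by ring] at h
  rw [Ψ, Ψ, Δ, h]
  push_cast
  ring

lemma Ψ_differentiableOn {γ : ℝ} (h0' : 0 < γ) (h1 : γ < 1) :
    DifferentiableOn ℂ (Ψ γ) {t | 0 < t.im} := by
  have hN : ∀ ν : ℝ, 0 < ν → ν < 3 → DifferentiableOn ℂ (logDeriv (Nn ν)) {t | 0 < t.im} :=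
    fun ν hν hν' => differentiableOn_logDeriv isOpen_upper (Nn_differentiableOn ν)
      fun t ht => Nn_ne_zero hν hν' ht
  have e1 := hN (3 * γ) (by linarith) (by linarith)
  have e2 := hN 1 (by norm_num) (by norm_num)
  push_cast at e1 e2
  exact (e1.sub e2).const_add _

lemma exists_norm_logDeriv_Nn_le {ν : ℝ} (hν : 0 < ν) (hν' : ν < 3 / 2) :
    ∃ K : ℝ, ∀ t : ℂ, h0 ≤ t.im → ‖logDeriv (Nn ν) t‖ ≤ K := by
  obtain ⟨δ, hδ, K, hK, h⟩ := exists_norm_logDeriv_Nn_add_le hν hν'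
  refine ⟨K + 2 * Real.pi * ν, fun t ht => ?_⟩
  have hπ := Real.pi_pos
  have htp : 0 < t.im := h0_pos.trans_le ht
  have h1 := h t ht
  have h2 : Real.exp (-(2 * Real.pi * (ν + δ) * t.im)) ≤ 1 :=
    Real.exp_le_one_iff.2 (neg_nonpos.2 (by positivity))
  have h3 : ‖2 * Real.pi * Complex.I * ν * ex (ν * t)‖ ≤ 2 * Real.pi * ν := by
    simp only [norm_mul, Complex.norm_I, Complex.norm_real,
      Real.norm_of_nonneg hν.le, Real.norm_of_nonneg hπ.le, Complex.norm_ofNat, mul_one]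
    exact mul_le_of_le_one_right (by positivity) (norm_ex_mul_lt_one hν htp).le
  have h4 := norm_sub_le (logDeriv (Nn ν) t + 2 * Real.pi * Complex.I * ν * ex (ν * t))
    (2 * Real.pi * Complex.I * ν * ex (ν * t))
  rw [add_sub_cancel_right] at h4
  nlinarith

lemma exists_norm_Ψ_le {γ : ℝ} (h0' : 0 < γ) (h1 : γ < 1 / 2) :
    ∃ K : ℝ, 0 ≤ K ∧ ∀ t : ℂ, h0 ≤ t.im → ‖Ψ γ t‖ ≤ K := by
  obtain ⟨K₁, hK₁⟩ := exists_norm_logDeriv_Nn_le (ν := 3 * γ) (by linarith) (by linarith)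
  obtain ⟨K₂, hK₂⟩ := exists_norm_logDeriv_Nn_le (ν := 1) (by norm_num) (by norm_num)
  set c : ℂ := Real.pi * Complex.I * (3 * γ ^ 2 - 3 * γ + 2 / 3) with hc
  have hb : ∀ t : ℂ, h0 ≤ t.im → ‖Ψ γ t‖ ≤ ‖c‖ + (K₁ + K₂) := by
    intro t ht
    have e1 := hK₁ t ht
    have e2 := hK₂ t ht
    push_cast at e1 e2
    exact (norm_add_le _ _).trans (add_le_add le_rfl ((norm_sub_le _ _).trans (add_le_add e1 e2)))
  refine ⟨‖c‖ + (K₁ + K₂), (norm_nonneg _).trans (hb (h0 * Complex.I) (by simp)), hb⟩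

lemma exists_norm_Δ_le {ν : ℝ} (hν : 0 < ν) (hν' : ν < 3 / 2) :
    ∃ K : ℝ, 0 ≤ K ∧ ∀ y : ℝ, h0 ≤ y → ‖Δ ν y‖ ≤ K * Real.exp (-(2 * Real.pi * ν * y)) := by
  obtain ⟨δ, hδ, K, hK, h⟩ := norm_Δ_add_le hν hν'
  set c : ℂ := 4 * Real.pi * ν * Real.sin (Real.pi * ν) with hc
  refine ⟨K + ‖c‖, by positivity, fun y hy => ?_⟩
  have hπ := Real.pi_pos
  have hy0 : 0 < y := h0_pos.trans_le hy
  have h1 := h y hy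
  have h2 : Real.exp (-(2 * Real.pi * (ν + δ) * y)) ≤ Real.exp (-(2 * Real.pi * ν * y)) := by
    rw [Real.exp_le_exp, neg_le_neg_iff]
    gcongr
    linarith
  have h4 := norm_sub_le (Δ ν y + c * Real.exp (-(2 * Real.pi * ν * y)))
    (c * Real.exp (-(2 * Real.pi * ν * y)))
  rw [add_sub_cancel_right, norm_mul c, Complex.norm_real,
    Real.norm_of_nonneg (Real.exp_pos _).le] at h4
  have h5 := mul_le_mul_of_nonneg_left h2 hK
  linarith

lemma Δ_continuousOn {ν : ℝ} (hν : 0 < ν) (hν' : ν < 3) :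
    ContinuousOn (Δ ν) (Set.Ioi 0) := by
  have h : ContinuousOn (logDeriv (Nn ν)) {t : ℂ | 0 < t.im} :=
    (differentiableOn_logDeriv isOpen_upper (Nn_differentiableOn ν)
      fun t ht => Nn_ne_zero hν hν' ht).continuousOn
  refine ContinuousOn.sub (h.comp (by fun_prop) ?_) (h.comp (by fun_prop) ?_)
  all_goals intro y hy; simpa using hy

lemma Hp_side_continuousOn (M : ℕ) :
    ContinuousOn (fun y : ℝ => Hp M (-(Real.exp (-(2 * Real.pi * y)) : ℂ))) (Set.Ioi 0) := by
  refine (Hp_differentiableOn M).continuousOn.comp (by fun_prop) fun y hy => ?_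
  rw [mem_ball_zero_iff, norm_neg, Complex.norm_real, Real.norm_of_nonneg (Real.exp_pos _).le]
  exact Real.exp_lt_one_iff.2 (by nlinarith [mul_pos Real.pi_pos (Set.mem_Ioi.1 hy)])

lemma exists_norm_Hp_le (M : ℕ) : ∃ C : ℝ, 0 ≤ C ∧ ∀ p : ℂ, ‖p‖ ≤ r0 → ‖Hp M p‖ ≤ C * ‖p‖ := by
  obtain ⟨A, hA, hA'⟩ := exists_norm_le_of_differentiableOn uF_differentiableOn
  obtain ⟨B, hB, hB'⟩ := exists_norm_le_of_differentiableOn gF_differentiableOn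
  refine ⟨A ^ (3 * M) * B, by positivity, fun p hp => ?_⟩
  rw [Hp_eq, norm_mul, norm_mul, norm_pow]
  calc ‖uF p‖ ^ (3 * M) * (‖p‖ * ‖gF p‖) ≤ A ^ (3 * M) * (‖p‖ * B) := by
        gcongr
        exacts [hA' p hp, hB' p hp]
    _ = _ := by ring

lemma integrableOn_ray {ν : ℝ} (hν : 0 < ν) (hν' : ν < 3 / 2) (M : ℕ) :
    MeasureTheory.IntegrableOn
      (fun y : ℝ => Hp M (-(Real.exp (-(2 * Real.pi * y)) : ℂ)) * Δ ν y) (Set.Ioi h0) := by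
  obtain ⟨C, hC, hC'⟩ := exists_norm_Hp_le M
  obtain ⟨K, hK, hK'⟩ := exists_norm_Δ_le hν hν'
  have hπ := Real.pi_pos
  have hint : MeasureTheory.IntegrableOn
      (fun y : ℝ => C * K * Real.exp (-(2 * Real.pi) * y)) (Set.Ioi h0) :=
    (exp_neg_integrableOn_Ioi h0 (by positivity)).const_mul _
  have hsub : Set.Ioi h0 ⊆ Set.Ioi (0 : ℝ) := Set.Ioi_subset_Ioi h0_pos.le
  refine hint.mono' (((Hp_side_continuousOn M).mul
    (Δ_continuousOn hν (by linarith))).mono hsub |>.aestronglyMeasurable measurableSet_Ioi) ?_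
  refine (MeasureTheory.ae_restrict_iff' measurableSet_Ioi).2 (Eventually.of_forall fun y hy => ?_)
  have hy' : h0 ≤ y := (Set.mem_Ioi.1 hy).le
  have hn : ‖(-(Real.exp (-(2 * Real.pi * y)) : ℂ))‖ = Real.exp (-(2 * Real.pi * y)) := by
    rw [norm_neg, Complex.norm_real, Real.norm_of_nonneg (Real.exp_pos _).le]
  have h1 := hC' (-(Real.exp (-(2 * Real.pi * y)) : ℂ)) (by rw [hn]; exact exp_le_r0 hy')
  rw [hn] at h1
  have h2 := hK' y hy'
  have h3 : Real.exp (-(2 * Real.pi * ν * y)) ≤ 1 := by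
    have : 0 < y := h0_pos.trans_le hy'
    exact Real.exp_le_one_iff.2 (neg_nonpos.2 (by positivity))
  have h4 : ‖Δ ν y‖ ≤ K := h2.trans (mul_le_of_le_one_right hK h3)
  rw [norm_mul]
  calc _ ≤ (C * Real.exp (-(2 * Real.pi * y))) * K := by gcongr
    _ = _ := by rw [neg_mul]; ring

lemma integral_line_eq_ray {γ : ℝ} (h0' : 0 < γ) (h1 : γ < 1 / 2) (M : ℕ) :
    (∫ x in (-1 / 2 : ℝ)..(1 / 2), Hp M (ex (x + h0 * Complex.I)) * Ψ γ (x + h0 * Complex.I)) =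
      Complex.I * ∫ y in Set.Ioi h0, Hp M (-(Real.exp (-(2 * Real.pi * y)) : ℂ)) * Δ (3 * γ) y := by
  obtain ⟨C, hC, hC'⟩ := exists_norm_Hp_le M
  obtain ⟨K, hK, hK'⟩ := exists_norm_Ψ_le h0' h1
  have hπ := Real.pi_pos
  set f : ℂ → ℂ := fun t => Hp M (ex t) * Ψ γ t with hf
  have hfd : DifferentiableOn ℂ f {t | 0 < t.im} := by
    refine DifferentiableOn.mul ((Hp_differentiableOn M).comp
      (fun t _ => (hasDerivAt_ex t).differentiableAt.differentiableWithinAt)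
      fun t ht => (ex_mem_punctured ht).1) (Ψ_differentiableOn h0' (by linarith))
  have hrect : ∀ T : ℝ, h0 ≤ T → (∫ x in (-1 / 2 : ℝ)..(1 / 2), f (x + h0 * Complex.I)) -
      Complex.I * ∫ y in h0..T, Hp M (-(Real.exp (-(2 * Real.pi * y)) : ℂ)) * Δ (3 * γ) y =
      ∫ x in (-1 / 2 : ℝ)..(1 / 2), f (x + T * Complex.I) := by
    intro T hT
    have hr := Complex.integral_boundary_rect_eq_zero_of_differentiableOn f
      (-1 / 2 + h0 * Complex.I) (1 / 2 + T * Complex.I) (hfd.mono fun z hz => by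
        rw [Complex.mem_reProdIm] at hz
        have := hz.2
        simp only [Complex.add_im, Complex.mul_im, Complex.I_im, Complex.I_re] at this
        norm_num at this
        rw [Set.uIcc_of_le hT] at this
        exact h0_pos.trans_le this.1)
    have e1 : (-1 / 2 + h0 * Complex.I : ℂ).re = -1 / 2 := by simp
    have e2 : (-1 / 2 + h0 * Complex.I : ℂ).im = h0 := by simp
    have e3 : (1 / 2 + T * Complex.I : ℂ).re = 1 / 2 := by simp
    have e4 : (1 / 2 + T * Complex.I : ℂ).im = T := by simp
    rw [e1, e2, e3, e4] at hr
    have hcont : ∀ a : ℂ, a.im = 0 → IntervalIntegrable (fun y : ℝ => f (a + y * Complex.I))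
        MeasureTheory.volume h0 T := by
      intro a ha
      refine ContinuousOn.intervalIntegrable ?_
      refine hfd.continuousOn.comp (by fun_prop) fun y hy => ?_
      rw [Set.uIcc_of_le hT] at hy
      have := h0_pos.trans_le hy.1
      simpa [ha] using this
    have e5 : (∫ y in h0..T, Hp M (-(Real.exp (-(2 * Real.pi * y)) : ℂ)) * Δ (3 * γ) y) =
        (∫ y in h0..T, f (-1 / 2 + y * Complex.I)) - ∫ y in h0..T, f (1 / 2 + y * Complex.I) := by
      rw [← intervalIntegral.integral_sub (hcont _ (by simp)) (hcont _ (by simp))]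
      refine intervalIntegral.integral_congr fun y _ => ?_
      simp only [hf]
      rw [ex_side (Or.inl rfl), ex_side (Or.inr rfl), ← mul_sub, Ψ_side_sub]
    rw [e5]
    simp only [smul_eq_mul] at hr
    push_cast at hr
    linear_combination hr
  have htop : Tendsto (fun T : ℝ => ∫ x in (-1 / 2 : ℝ)..(1 / 2), f (x + T * Complex.I)) atTop
      (𝓝 0) := by
    have hexp : Tendsto (fun T : ℝ => C * Real.exp (-(2 * Real.pi * T)) * K) atTop (𝓝 0) := by
      have h2 : Tendsto (fun T : ℝ => Real.exp (-(2 * Real.pi * T))) atTop (𝓝 0) :=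
        Real.tendsto_exp_neg_atTop_nhds_zero.comp
          (tendsto_id.const_mul_atTop (show 0 < 2 * Real.pi by positivity))
      simpa using (h2.const_mul C).mul_const K
    refine squeeze_zero_norm' ?_ hexp
    filter_upwards [eventually_ge_atTop h0] with T hT
    have := intervalIntegral.norm_integral_le_of_norm_le_const (a := (-1 / 2 : ℝ)) (b := 1 / 2)
      (f := fun x : ℝ => f (x + T * Complex.I)) (C := C * Real.exp (-(2 * Real.pi * T)) * K) ?_
    · rwa [show |(1 / 2 : ℝ) - -1 / 2| = 1 by norm_num, mul_one] at this
    · intro x _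
      have hn : ‖ex (x + T * Complex.I)‖ = Real.exp (-(2 * Real.pi * T)) := by
        have := norm_ex_mul 1 (x + T * Complex.I)
        rw [im_line, Complex.ofReal_one, one_mul, mul_one] at this
        exact this
      have h2 := hC' (ex (x + T * Complex.I)) (by rw [hn]; exact exp_le_r0 hT)
      rw [hn] at h2
      have h3 := hK' (x + T * Complex.I) (by rw [im_line]; exact hT)
      simp only [hf, norm_mul]
      gcongr
  have hlim := (MeasureTheory.intervalIntegral_tendsto_integral_Ioi h0
    (integrableOn_ray (ν := 3 * γ) (by linarith) (by linarith) M) tendsto_id).const_mul Complex.I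
  have hlim2 := (tendsto_const_nhds (x := ∫ x in (-1 / 2 : ℝ)..(1 / 2),
    f (x + h0 * Complex.I))).sub hlim
  have heq := tendsto_nhds_unique (hlim2.congr' (by
    filter_upwards [eventually_ge_atTop h0] with T hT using hrect T hT)) htop
  exact sub_eq_zero.1 heq

lemma r0_le : r0 ≤ 1 / 6 := by
  have hh : (0.288 : ℝ) ≤ h0 := by nlinarith [h0_sq, h0_pos]
  have h1 : (1.8 : ℝ) ≤ 2 * Real.pi * h0 := by nlinarith [Real.pi_gt_d2]
  have h2 : r0 ≤ Real.exp (-1.8) := Real.exp_le_exp.2 (by linarith)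
  have h3 : (6 : ℝ) ≤ Real.exp 1.8 := by
    refine le_of_pow_le_pow_left₀ (n := 5) (by norm_num) (Real.exp_pos _).le ?_
    rw [← Real.exp_nat_mul, show ((5 : ℕ) : ℝ) * 1.8 = (9 : ℕ) * 1 by norm_num, Real.exp_nat_mul]
    calc (6 : ℝ) ^ 5 ≤ 2.718 ^ 9 := by norm_num
      _ ≤ _ := pow_le_pow_left₀ (by norm_num) (by linarith [Real.exp_one_gt_d9]) 9
  refine h2.trans ?_
  rw [Real.exp_neg, one_div]
  exact inv_anti₀ (by norm_num) h3

lemma norm_qP_sub_one_le_mul {Z q : ℂ} (hq : ‖q‖ ≤ 1 / 6) (hZ : ‖Z‖ ≤ 1 / 36) :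
    ‖qP Z q - 1‖ ≤ 5 / 4 * ‖Z‖ := by
  refine (norm_qP_sub_one_le Z (by linarith)).trans ?_
  have hZ0 := norm_nonneg Z
  have h1 : ‖Z‖ / (1 - ‖q‖) ≤ 6 / 5 * ‖Z‖ := by
    rw [div_le_iff₀ (by linarith)]
    nlinarith
  have h2 := Real.exp_bound_div_one_sub_of_interval (x := 6 / 5 * ‖Z‖) (by positivity) (by linarith)
  have h3 : 1 / (1 - 6 / 5 * ‖Z‖) ≤ 1 + 5 / 4 * ‖Z‖ := by
    rw [div_le_iff₀ (by linarith)]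
    nlinarith
  linarith [Real.exp_le_exp.2 h1]

lemma norm_qP_self_sub_le {p : ℂ} (hp : ‖p‖ ≤ 1 / 6) :
    ‖qP (p * p) p - 1‖ ≤ 5 / 4 * ‖p‖ ^ 2 := by
  refine (norm_qP_sub_one_le_mul hp ?_).trans (le_of_eq ?_)
  · rw [norm_mul]; nlinarith [norm_nonneg p]
  · rw [norm_mul, sq]

lemma norm_qP_cube_sub_le {p : ℂ} (hp : ‖p‖ ≤ 1 / 6) :
    ‖qP (p ^ 3) (p ^ 3) - 1‖ ≤ 5 / 4 * ‖p‖ ^ 3 := by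
  have h : ‖p ^ 3‖ ≤ 1 / 36 := by
    rw [norm_pow]
    calc ‖p‖ ^ 3 ≤ (1 / 6) ^ 3 := pow_le_pow_left₀ (norm_nonneg _) hp 3
      _ ≤ _ := by norm_num
  refine (norm_qP_sub_one_le_mul (h.trans (by norm_num)) h).trans (le_of_eq ?_)
  rw [norm_pow]

/-- The contribution of the higher terms to `a1`. -/
def a1Tail (p : ℂ) : ℂ := a1 p - (1 + 6 * (p / (1 + p + p ^ 2)))

lemma norm_a1Tail_le {p : ℂ} (hp : ‖p‖ ≤ 1 / 6) : ‖a1Tail p‖ ≤ 8 * ‖p‖ ^ 2 := by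
  set r := ‖p‖ with hr
  have hr0 : 0 ≤ r := norm_nonneg p
  have hs := (hasSum_a1 (p := p) (by linarith)).summable
  have e : a1Tail p = 6 * ∑' n : ℕ, p ^ (n + 2) / (1 + p ^ (n + 2) + (p ^ (n + 2)) ^ 2) := by
    rw [a1Tail, a1, hs.tsum_eq_zero_add]
    simp only [zero_add, pow_one]
    ring
  have hb : ∀ n : ℕ, ‖p ^ (n + 2) / (1 + p ^ (n + 2) + (p ^ (n + 2)) ^ 2)‖ ≤
      10 / 9 * r ^ 2 * r ^ n := by
    intro n
    have hu : ‖p ^ (n + 2)‖ ≤ 1 / 36 := by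
      rw [norm_pow, pow_add]
      have h1 : r ^ n ≤ 1 := pow_le_one₀ hr0 (by linarith)
      nlinarith [pow_nonneg hr0 n]
    have h2 := norm_one_add_add_sq_ge (u := p ^ (n + 2)) (by linarith)
    have h3 : (9 / 10 : ℝ) ≤ ‖1 + p ^ (n + 2) + (p ^ (n + 2)) ^ 2‖ := by nlinarith
    rw [norm_div, div_le_iff₀ (by linarith), norm_pow, ← hr]
    have h4 : 0 ≤ r ^ (n + 2) := by positivity
    calc r ^ (n + 2) ≤ 10 / 9 * r ^ (n + 2) * ‖1 + p ^ (n + 2) + (p ^ (n + 2)) ^ 2‖ := by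
          nlinarith
      _ = _ := by ring
  have hg := (hasSum_geometric_of_lt_one hr0 (by linarith)).mul_left (10 / 9 * r ^ 2)
  have h1 := tsum_of_norm_bounded hg hb
  rw [e, norm_mul, Complex.norm_ofNat]
  have h2 : (1 - r)⁻¹ ≤ 6 / 5 := by
    rw [inv_le_comm₀ (by linarith) (by norm_num)]
    linarith
  nlinarith [mul_le_mul_of_nonneg_left h2 (show 0 ≤ 10 / 9 * r ^ 2 by positivity)]

lemma norm_a1_neg_le {r : ℝ} (hr0 : 0 ≤ r) (hr : r ≤ 1 / 6) : ‖a1 (-(r : ℂ))‖ ≤ 1 - 3 * r := by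
  have hn : ‖(-(r : ℂ))‖ = r := by
    rw [norm_neg, Complex.norm_real, Real.norm_of_nonneg hr0]
  have h1 := norm_a1Tail_le (p := -(r : ℂ)) (by rw [hn]; exact hr)
  rw [hn] at h1
  set x : ℝ := 1 - 6 * (r / (1 - r + r ^ 2)) with hx
  have e : a1 (-(r : ℂ)) = (x : ℂ) + a1Tail (-(r : ℂ)) := by
    rw [a1Tail, hx]
    push_cast
    ring
  have hd : 0 < 1 - r + r ^ 2 := by nlinarith
  have h2 : r ≤ r / (1 - r + r ^ 2) := by
    rw [le_div_iff₀ hd]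
    nlinarith [mul_nonneg hr0 hr0]
  have h3 : r / (1 - r + r ^ 2) ≤ 7 / 6 * r := by
    rw [div_le_iff₀ hd]
    have : 0 ≤ 1 / 6 - 7 / 6 * r + 7 / 6 * r ^ 2 := by nlinarith [sq_nonneg (r - 1 / 6)]
    nlinarith
  have h4 : |x| ≤ 1 - 3 * r - 8 * r ^ 2 := by
    rw [abs_le]
    constructor <;> nlinarith
  rw [e]
  refine (norm_add_le _ _).trans ?_
  rw [Complex.norm_real, Real.norm_eq_abs]
  linarith

lemma one_le_norm_bF_neg {r : ℝ} (hr0 : 0 ≤ r) (hr : r ≤ 1 / 6) : 1 ≤ ‖bF (-(r : ℂ))‖ := by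
  set p : ℂ := -(r : ℂ) with hp
  have hn : ‖p‖ = r := by
    rw [norm_neg, Complex.norm_real, Real.norm_of_nonneg hr0]
  have hp6 : ‖p‖ ≤ 1 / 6 := hn ▸ hr
  have h1 := norm_qP_self_sub_le hp6
  have h2 := norm_qP_cube_sub_le hp6
  rw [hn] at h1 h2
  have h3 : ‖1 - p‖ = 1 + r := by
    rw [hp, sub_neg_eq_add, show (1 + (r : ℂ)) = ((1 + r : ℝ) : ℂ) by push_cast; rfl,
      Complex.norm_real, Real.norm_of_nonneg (by linarith)]
  have h4 : 1 - 5 / 4 * r ^ 2 ≤ ‖qP (p * p) p‖ := by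
    have := norm_sub_norm_le 1 (1 - qP (p * p) p)
    rw [norm_one, sub_sub_cancel, norm_sub_rev] at this
    linarith
  have h5 : ‖qP (p ^ 3) (p ^ 3)‖ ≤ 1 + 5 / 4 * r ^ 3 := by
    have := norm_add_le 1 (qP (p ^ 3) (p ^ 3) - 1)
    rw [norm_one, add_sub_cancel] at this
    linarith
  have h6 : 1 + 5 / 4 * r ^ 3 ≤ ‖qP p p‖ := by
    rw [qP_succ p (by linarith), norm_mul, h3]
    have : (1 + r) * (1 - 5 / 4 * r ^ 2) ≤ (1 + r) * ‖qP (p * p) p‖ :=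
      mul_le_mul_of_nonneg_left h4 (by linarith)
    nlinarith [mul_nonneg hr0 hr0, mul_nonneg hr0 (sub_nonneg.2 hr),
      mul_nonneg (mul_nonneg hr0 hr0) (sub_nonneg.2 hr)]
  have h7 : 0 < ‖qP (p ^ 3) (p ^ 3)‖ := norm_pos_iff.2 (qP_cube_ne_zero (by linarith))
  rw [bF, norm_div, norm_pow, le_div_iff₀ h7, one_mul]
  have h8 : 1 ≤ ‖qP p p‖ := le_trans (by have := pow_nonneg hr0 3; linarith) h6
  exact (h5.trans h6).trans (le_self_pow₀ h8 (by norm_num))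

lemma norm_uF_neg_le {r : ℝ} (hr0 : 0 ≤ r) (hr : r ≤ 1 / 6) :
    ‖uF (-(r : ℂ))‖ ≤ Real.exp (-(3 * r)) := by
  have h1 := norm_a1_neg_le hr0 hr
  have h2 := one_le_norm_bF_neg hr0 hr
  rw [uF, norm_div]
  refine (div_le_self (norm_nonneg _) h2).trans (h1.trans ?_)
  linarith [Real.add_one_le_exp (-(3 * r))]

lemma hasDerivAt_zero_of_norm_sub_le {f : ℂ → ℂ} {c : ℂ} {C ε : ℝ} (hε : 0 < ε)
    (h : ∀ p : ℂ, ‖p‖ ≤ ε → ‖f p - c‖ ≤ C * ‖p‖ ^ 2) : f 0 = c ∧ HasDerivAt f 0 0 := by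
  have hc : f 0 = c := by
    have := h 0 (by simpa using hε.le)
    simp only [norm_zero, ne_eq, OfNat.ofNat_ne_zero, not_false_eq_true, zero_pow, mul_zero] at this
    exact sub_eq_zero.1 (norm_le_zero_iff.1 this)
  refine ⟨hc, ?_⟩
  rw [hasDerivAt_iff_isLittleO, hc]
  have hO : (fun p : ℂ => f p - c - (p - 0) • (0 : ℂ)) =O[𝓝 0] fun p : ℂ => p ^ 2 := by
    refine Asymptotics.IsBigO.of_bound C ?_
    filter_upwards [Metric.closedBall_mem_nhds (0 : ℂ) hε] with p hp
    rw [smul_zero, sub_zero, norm_pow]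
    exact h p (mem_closedBall_zero_iff.1 hp)
  refine hO.trans_isLittleO ?_
  simpa using Asymptotics.isLittleO_pow_id (𝕜 := ℂ) (n := 2) (by norm_num)

lemma hasDerivAt_bF_zero : bF 0 = 1 ∧ HasDerivAt bF (-3) 0 := by
  obtain ⟨-, ad⟩ := hasDerivAt_zero_of_norm_sub_le (f := fun p => qP (p * p) p)
    (c := 1) (C := 5 / 4) (ε := 1 / 6) (by norm_num) fun p hp => norm_qP_self_sub_le hp
  obtain ⟨b0, bd⟩ := hasDerivAt_zero_of_norm_sub_le (f := fun p => qP (p ^ 3) (p ^ 3))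
    (c := 1) (C := 5 / 4) (ε := 1 / 6) (by norm_num) fun p hp => by
      refine (norm_qP_cube_sub_le hp).trans ?_
      have : ‖p‖ ^ 3 ≤ ‖p‖ ^ 2 := pow_le_pow_of_le_one (norm_nonneg _) (by linarith) (by norm_num)
      linarith
  have h1 : HasDerivAt (fun p : ℂ => (1 - p) * qP (p * p) p) (-1) 0 := by
    exact (((hasDerivAt_id (0 : ℂ)).const_sub 1).mul ad).congr_deriv (by simp [qP_zero])
  have h2 : (fun p => qP p p) =ᶠ[𝓝 (0 : ℂ)] fun p => (1 - p) * qP (p * p) p := by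
    filter_upwards [Metric.ball_mem_nhds (0 : ℂ) one_pos] with p hp
    exact qP_succ p (mem_ball_zero_iff.1 hp)
  have h3 := h1.congr_of_eventuallyEq h2
  have h4 : qP (0 : ℂ) 0 = 1 := qP_zero 0
  have h5 := (h3.pow 3).div bd (by rw [b0]; norm_num)
  constructor
  · simp [bF, h4]
  · refine h5.congr_deriv ?_ |>.congr_of_eventuallyEq (Eventually.of_forall fun p => rfl)
    simp [h4]

lemma hasDerivAt_uF_zero : uF 0 = 1 ∧ HasDerivAt uF 9 0 := by
  obtain ⟨b0, bd⟩ := hasDerivAt_bF_zero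
  obtain ⟨t0, td⟩ := hasDerivAt_zero_of_norm_sub_le (f := a1Tail)
    (c := 0) (C := 8) (ε := 1 / 6) (by norm_num) fun p hp => by
      rw [sub_zero]; exact norm_a1Tail_le hp
  have hid := hasDerivAt_id (0 : ℂ)
  have hden : HasDerivAt (fun p : ℂ => 1 + p + p ^ 2) 1 0 := by
    exact ((hid.const_add 1).add (hid.pow 2)).congr_deriv (by simp)
  have hq : HasDerivAt (fun p : ℂ => p / (1 + p + p ^ 2)) 1 0 := by
    exact (hid.div hden (by norm_num)).congr_deriv (by simp)
  have ha : HasDerivAt a1 6 0 := by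
    have h := (((hq.const_mul 6).const_add 1).add td).congr_deriv
      (show (6 * 1 + 0 : ℂ) = 6 by norm_num)
    refine h.congr_of_eventuallyEq (Eventually.of_forall fun p => ?_)
    simp only [a1Tail, Pi.add_apply]
    ring
  have ha0 : a1 0 = 1 := by
    have : a1Tail 0 = a1 0 - 1 := by simp [a1Tail]
    rw [t0] at this
    linear_combination -this
  constructor
  · rw [uF, ha0, b0, div_one]
  · have := ha.div bd (by rw [b0]; norm_num)
    refine (this.congr_deriv ?_).congr_of_eventuallyEq (Eventually.of_forall fun p => rfl)
    rw [ha0, b0]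
    norm_num

lemma gF_zero : gF 0 = 18 * Real.pi * Complex.I := by
  rw [gF, hasDerivAt_bF_zero.1, hasDerivAt_uF_zero.2.deriv]
  ring

/-- The integrand of the ray integral after rescaling by `M`. -/
def rayF (ν : ℝ) (M : ℕ) (x : ℝ) : ℂ :=
  -(1 / (2 * Real.pi)) * (uF (-((x / M : ℝ) : ℂ)) ^ (3 * M) * gF (-((x / M : ℝ) : ℂ))) *
    (((M : ℝ) ^ ν : ℝ) * Δ ν (Real.log (M / x) / (2 * Real.pi)))

lemma image_exp_ray {M : ℝ} (hM : 0 < M) :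
    (fun y : ℝ => M * Real.exp (-(2 * Real.pi * y))) '' Set.Ioi h0 = Set.Ioo 0 (M * r0) := by
  have hπ := Real.pi_pos
  ext x
  constructor
  · rintro ⟨y, hy, rfl⟩
    refine ⟨by positivity, mul_lt_mul_of_pos_left ?_ hM⟩
    rw [r0, Real.exp_lt_exp, neg_lt_neg_iff]
    exact mul_lt_mul_of_pos_left hy (by positivity)
  · rintro ⟨hx0, hx⟩
    have e : M * Real.exp (-(2 * Real.pi * (Real.log (M / x) / (2 * Real.pi)))) = x := by
      rw [mul_div_cancel₀ _ (by positivity), Real.exp_neg, Real.exp_log (by positivity)]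
      field_simp
    refine ⟨Real.log (M / x) / (2 * Real.pi), ?_, e⟩
    by_contra hcon
    have h1 : Real.log (M / x) / (2 * Real.pi) ≤ h0 := not_lt.1 hcon
    have h2 : r0 ≤ Real.exp (-(2 * Real.pi * (Real.log (M / x) / (2 * Real.pi)))) := by
      rw [r0, Real.exp_le_exp, neg_le_neg_iff]
      gcongr
    have h3 := mul_le_mul_of_nonneg_left h2 hM.le
    rw [e] at h3
    linarith

lemma ray_eq (ν : ℝ) {M : ℕ} (hM : 0 < M) :
    (((M : ℝ) ^ (1 + ν) : ℝ) : ℂ) *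
      (∫ y in Set.Ioi h0, Hp M (-(Real.exp (-(2 * Real.pi * y)) : ℂ)) * Δ ν y) =
      ∫ x in Set.Ioo 0 (M * r0), rayF ν M x := by
  have hM' : (0 : ℝ) < M := by exact_mod_cast hM
  have hπ := Real.pi_pos
  have hd : ∀ y ∈ Set.Ioi h0, HasDerivWithinAt (fun y : ℝ => M * Real.exp (-(2 * Real.pi * y)))
      (M * (Real.exp (-(2 * Real.pi * y)) * -(2 * Real.pi))) (Set.Ioi h0) y := by
    intro y _
    have h1 : HasDerivAt (fun y : ℝ => -(2 * Real.pi * y)) (-(2 * Real.pi)) y := by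
      exact ((hasDerivAt_id y).const_mul (2 * Real.pi)).neg.congr_deriv (by simp)
    exact (h1.exp.const_mul (M : ℝ)).hasDerivWithinAt
  have hinj : Set.InjOn (fun y : ℝ => M * Real.exp (-(2 * Real.pi * y))) (Set.Ioi h0) := by
    intro a _ b _ hab
    have h1 := Real.exp_injective (mul_left_cancel₀ hM'.ne' hab)
    exact mul_left_cancel₀ (by positivity : 2 * Real.pi ≠ 0) (neg_injective h1)
  rw [← image_exp_ray hM', MeasureTheory.integral_image_eq_integral_abs_deriv_smul
    measurableSet_Ioi hd hinj, ← MeasureTheory.integral_const_mul]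
  refine MeasureTheory.setIntegral_congr_fun measurableSet_Ioi fun y _ => ?_
  set e := Real.exp (-(2 * Real.pi * y)) with he
  have he0 : 0 < e := Real.exp_pos _
  have h1 : |(M : ℝ) * (e * -(2 * Real.pi))| = 2 * Real.pi * (M * e) := by
    rw [show (M : ℝ) * (e * -(2 * Real.pi)) = -(2 * Real.pi * (M * e)) by ring, abs_neg,
      abs_of_pos (by positivity)]
  have h2 : (M : ℝ) * e / M = e := by field_simp
  have h3 : Real.log (M / (M * e)) / (2 * Real.pi) = y := by
    rw [show (M : ℝ) / (M * e) = e⁻¹ by field_simp, Real.log_inv, he, Real.log_exp]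
    field_simp
  have hπ' : (Real.pi : ℂ) ≠ 0 := by exact_mod_cast Real.pi_ne_zero
  simp only [rayF]
  rw [h1, h2, h3, Hp_eq, Real.rpow_add hM', Real.rpow_one, Complex.real_smul]
  push_cast
  field_simp

lemma rayF_continuousOn {ν : ℝ} (hν : 0 < ν) (hν' : ν < 3) (M : ℕ) :
    ContinuousOn (rayF ν M) (Set.Ioo 0 (M * r0)) := by
  rcases Nat.eq_zero_or_pos M with rfl | hM
  · simp
  have hM' : (0 : ℝ) < M := by exact_mod_cast hM
  have hπ := Real.pi_pos
  have hmaps : Set.MapsTo (fun x : ℝ => -((x / M : ℝ) : ℂ)) (Set.Ioo 0 (M * r0))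
      (Metric.ball 0 1) := by
    intro x hx
    rw [mem_ball_zero_iff, norm_neg, Complex.norm_real, Real.norm_of_nonneg
      (div_nonneg hx.1.le hM'.le), div_lt_one hM']
    exact hx.2.trans (mul_lt_of_lt_one_right hM' r0_lt_one)
  have hc : ContinuousOn (fun x : ℝ => -((x / M : ℝ) : ℂ)) (Set.Ioo 0 (M * r0)) := by fun_prop
  have hu := uF_differentiableOn.continuousOn.comp hc hmaps
  have hg := gF_differentiableOn.continuousOn.comp hc hmaps
  have hl : ContinuousOn (fun x : ℝ => Real.log (M / x) / (2 * Real.pi))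
      (Set.Ioo 0 (M * r0)) := by
    refine ContinuousOn.div_const (ContinuousOn.log (continuousOn_const.div continuousOn_id
      fun x hx => hx.1.ne') fun x hx => ?_) _
    exact (div_pos hM' hx.1).ne'
  have hD := (Δ_continuousOn hν hν').comp hl fun x hx => by
    refine Set.mem_Ioi.2 (div_pos (Real.log_pos ?_) (by positivity))
    rw [one_lt_div hx.1]
    exact hx.2.trans (mul_lt_of_lt_one_right hM' r0_lt_one)
  exact (continuousOn_const.mul ((hu.pow _).mul hg)).mul (continuousOn_const.mul hD)

lemma exp_log_div {ν x : ℝ} {M : ℝ} (hM : 0 < M) (hx : 0 < x) :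
    Real.exp (-(2 * Real.pi * ν * (Real.log (M / x) / (2 * Real.pi)))) = (x / M) ^ ν := by
  have hπ := Real.pi_pos
  rw [Real.rpow_def_of_pos (by positivity), ← inv_div M x, Real.log_inv]
  congr 1
  field_simp

lemma h0_le_log {x : ℝ} {M : ℝ} (hM : 0 < M) (hx : 0 < x) (h : x ≤ M * r0) :
    h0 ≤ Real.log (M / x) / (2 * Real.pi) := by
  have hπ := Real.pi_pos
  rw [le_div_iff₀ (by positivity), Real.le_log_iff_exp_le (by positivity), le_div_iff₀ hx]
  have : Real.exp (h0 * (2 * Real.pi)) * r0 = 1 := by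
    rw [r0, ← Real.exp_add, ← Real.exp_zero]
    congr 1
    ring
  calc _ ≤ Real.exp (h0 * (2 * Real.pi)) * (M * r0) := by gcongr
    _ = _ := by linear_combination M * this

lemma exists_norm_rayF_le {ν : ℝ} (hν : 0 < ν) (hν' : ν < 3 / 2) :
    ∃ C : ℝ, 0 ≤ C ∧ ∀ (M : ℕ), ∀ x ∈ Set.Ioo 0 (M * r0),
      ‖rayF ν M x‖ ≤ C * (Real.exp (-x) * x ^ ν) := by
  obtain ⟨K, hK, hK'⟩ := exists_norm_Δ_le hν hν'
  obtain ⟨B, hB, hB'⟩ := exists_norm_le_of_differentiableOn gF_differentiableOn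
  have hπ := Real.pi_pos
  refine ⟨1 / (2 * Real.pi) * B * K, by positivity, fun M x hx => ?_⟩
  have hM' : (0 : ℝ) < M := by
    have := hx.1.trans hx.2
    exact pos_of_mul_pos_left this r0_pos.le
  have hxM0 : 0 ≤ x / M := div_nonneg hx.1.le hM'.le
  have hxM : x / M ≤ r0 := by rw [div_le_iff₀' hM']; exact hx.2.le
  have h1 : ‖uF (-((x / M : ℝ) : ℂ)) ^ (3 * M)‖ ≤ Real.exp (-x) := by
    rw [norm_pow]
    refine (pow_le_pow_left₀ (norm_nonneg _) (norm_uF_neg_le hxM0 (hxM.trans r0_le)) _).trans ?_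
    rw [← Real.exp_nat_mul, Real.exp_le_exp]
    have : ((3 * M : ℕ) : ℝ) * -(3 * (x / M)) = -(9 * x) := by
      push_cast
      field_simp
      ring
    rw [this]
    linarith [hx.1]
  have h2 : ‖gF (-((x / M : ℝ) : ℂ))‖ ≤ B := hB' _ (by
    rwa [norm_neg, Complex.norm_real, Real.norm_of_nonneg hxM0])
  have h3 := hK' _ (h0_le_log hM' hx.1 hx.2.le)
  rw [exp_log_div hM' hx.1, Real.div_rpow hx.1.le hM'.le] at h3
  have h4 : 0 < (M : ℝ) ^ ν := Real.rpow_pos_of_pos hM' _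
  have h5 : (M : ℝ) ^ ν * ‖Δ ν (Real.log (M / x) / (2 * Real.pi))‖ ≤ K * x ^ ν := by
    calc _ ≤ (M : ℝ) ^ ν * (K * (x ^ ν / (M : ℝ) ^ ν)) := by gcongr
      _ = _ := by field_simp
  have h6 : ‖(-(1 / (2 * Real.pi)) : ℂ)‖ = 1 / (2 * Real.pi) := by
    rw [norm_neg, norm_div, norm_one, norm_mul, Complex.norm_ofNat, Complex.norm_real,
      Real.norm_of_nonneg hπ.le]
  rw [rayF, norm_mul, norm_mul, norm_mul, norm_mul, h6, Complex.norm_real,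
    Real.norm_of_nonneg h4.le]
  calc _ ≤ 1 / (2 * Real.pi) * (Real.exp (-x) * B) * (K * x ^ ν) := by gcongr
    _ = _ := by ring

lemma tendsto_neg_div_nhdsWithin {x : ℝ} (hx : 0 < x) :
    Tendsto (fun M : ℕ => -((x / M : ℝ) : ℂ)) atTop (𝓝[≠] 0) := by
  refine tendsto_nhdsWithin_iff.2 ⟨?_, ?_⟩
  · have h := (tendsto_const_div_atTop_nhds_zero_nat x)
    have h2 := ((Complex.continuous_ofReal.tendsto 0).comp h).neg
    simpa using h2
  · filter_upwards [eventually_gt_atTop 0] with M hM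
    have : (0 : ℝ) < M := by exact_mod_cast hM
    have h3 : (x / M : ℝ) ≠ 0 := (div_pos hx this).ne'
    simpa using h3

lemma tendsto_uF_pow {x : ℝ} (hx : 0 < x) :
    Tendsto (fun M : ℕ => uF (-((x / M : ℝ) : ℂ)) ^ (3 * M)) atTop
      (𝓝 (Real.exp (-(27 * x)) : ℂ)) := by
  have h1 := hasDerivAt_uF_zero.2.tendsto_slope_zero.comp (tendsto_neg_div_nhdsWithin hx)
  have h2 : Tendsto (fun M : ℕ => (M : ℂ) * (uF (-((x / M : ℝ) : ℂ)) - 1)) atTop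
      (𝓝 (-(x : ℂ) * 9)) := by
    refine (h1.const_mul (-(x : ℂ))).congr' ?_
    filter_upwards [eventually_gt_atTop 0] with M hM
    have hM' : (M : ℂ) ≠ 0 := by exact_mod_cast hM.ne'
    have hx' : (x : ℂ) ≠ 0 := by exact_mod_cast hx.ne'
    simp only [Function.comp, zero_add, hasDerivAt_uF_zero.1, smul_eq_mul]
    push_cast
    field_simp
  have h3 := (Complex.tendsto_one_add_pow_exp_of_tendsto h2).pow 3
  have e : Complex.exp (-(x : ℂ) * 9) ^ 3 = (Real.exp (-(27 * x)) : ℂ) := by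
    rw [← Complex.exp_nat_mul, Complex.ofReal_exp]
    congr 1
    push_cast
    ring
  rw [e] at h3
  refine h3.congr fun M => ?_
  rw [add_sub_cancel, ← pow_mul, mul_comm]

lemma tendsto_Δ_scaled {ν : ℝ} (hν : 0 < ν) (hν' : ν < 3 / 2) {x : ℝ} (hx : 0 < x) :
    Tendsto (fun M : ℕ => (((M : ℝ) ^ ν : ℝ) : ℂ) * Δ ν (Real.log (M / x) / (2 * Real.pi))) atTop
      (𝓝 (-(4 * Real.pi * ν * Real.sin (Real.pi * ν)) * (x ^ ν : ℝ))) := by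
  obtain ⟨δ, hδ, K, hK, h⟩ := norm_Δ_add_le hν hν'
  rw [tendsto_iff_norm_sub_tendsto_zero]
  have hlim : Tendsto (fun M : ℕ => K * x ^ (ν + δ) * (M : ℝ) ^ (-δ)) atTop (𝓝 0) := by
    have := ((tendsto_rpow_neg_atTop hδ).comp tendsto_natCast_atTop_atTop).const_mul
      (K * x ^ (ν + δ))
    simpa using this
  refine squeeze_zero' (Eventually.of_forall fun _ => norm_nonneg _) ?_ hlim
  filter_upwards [eventually_gt_atTop 0, eventually_ge_atTop ⌈x / r0⌉₊] with M hM hM2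
  have hM' : (0 : ℝ) < M := by exact_mod_cast hM
  have hxM : x ≤ M * r0 := by
    have := (Nat.le_ceil (x / r0)).trans (show (⌈x / r0⌉₊ : ℝ) ≤ M by exact_mod_cast hM2)
    rwa [div_le_iff₀ r0_pos] at this
  have h1 := h _ (h0_le_log hM' hx hxM)
  rw [exp_log_div hM' hx, exp_log_div hM' hx, Real.div_rpow hx.le hM'.le,
    Real.div_rpow hx.le hM'.le] at h1
  have h4 : 0 < (M : ℝ) ^ ν := Real.rpow_pos_of_pos hM' _
  have h4' : (((M : ℝ) ^ ν : ℝ) : ℂ) ≠ 0 := by exact_mod_cast h4.ne'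
  have e : (((M : ℝ) ^ ν : ℝ) : ℂ) * Δ ν (Real.log (M / x) / (2 * Real.pi)) -
      -(4 * Real.pi * ν * Real.sin (Real.pi * ν)) * (x ^ ν : ℝ) =
      (((M : ℝ) ^ ν : ℝ) : ℂ) * (Δ ν (Real.log (M / x) / (2 * Real.pi)) +
        4 * Real.pi * ν * Real.sin (Real.pi * ν) * ((x ^ ν / (M : ℝ) ^ ν : ℝ) : ℂ)) := by
    rw [Complex.ofReal_div]
    field_simp
    ring
  rw [e, norm_mul, Complex.norm_real, Real.norm_of_nonneg h4.le]
  calc _ ≤ (M : ℝ) ^ ν * (K * (x ^ (ν + δ) / (M : ℝ) ^ (ν + δ))) := by gcongr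
    _ = _ := by
      rw [Real.rpow_add hM', Real.rpow_neg hM'.le]
      have := Real.rpow_pos_of_pos hM' δ
      field_simp

lemma tendsto_rayF {ν : ℝ} (hν : 0 < ν) (hν' : ν < 3 / 2) {x : ℝ} (hx : 0 < x) :
    Tendsto (fun M : ℕ => rayF ν M x) atTop
      (𝓝 (36 * Real.pi * Complex.I * ν * Real.sin (Real.pi * ν) *
        ((x ^ ν * Real.exp (-(27 * x)) : ℝ) : ℂ))) := by
  have hg : Tendsto (fun M : ℕ => gF (-((x / M : ℝ) : ℂ))) atTop (𝓝 (gF 0)) := by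
    have hc : ContinuousAt gF 0 := (gF_differentiableOn.differentiableAt
      (Metric.ball_mem_nhds _ one_pos)).continuousAt
    exact hc.tendsto.comp ((tendsto_neg_div_nhdsWithin hx).mono_right nhdsWithin_le_nhds)
  have h := (((tendsto_uF_pow hx).mul hg).const_mul (-(1 / (2 * Real.pi)) : ℂ)).mul
    (tendsto_Δ_scaled hν hν' hx)
  rw [gF_zero] at h
  have hπ' : (Real.pi : ℂ) ≠ 0 := by exact_mod_cast Real.pi_ne_zero
  have e : 36 * Real.pi * Complex.I * ν * Real.sin (Real.pi * ν) *
      ((x ^ ν * Real.exp (-(27 * x)) : ℝ) : ℂ) =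
      -(1 / (2 * Real.pi)) * ((Real.exp (-(27 * x)) : ℂ) * (18 * Real.pi * Complex.I)) *
        (-(4 * Real.pi * ν * Real.sin (Real.pi * ν)) * (x ^ ν : ℝ)) := by
    push_cast
    field_simp
    ring
  rw [e]
  exact h

lemma tendsto_integral_rayF {ν : ℝ} (hν : 0 < ν) (hν' : ν < 3 / 2) :
    Tendsto (fun M : ℕ => ∫ x in Set.Ioo 0 (M * r0), rayF ν M x) atTop
      (𝓝 (36 * Real.pi * Complex.I * ν * Real.sin (Real.pi * ν) *
        (((1 / 27) ^ (1 + ν) * Real.Gamma (1 + ν) : ℝ) : ℂ))) := by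
  obtain ⟨C, hC, hC'⟩ := exists_norm_rayF_le hν hν'
  have hG := Real.GammaIntegral_convergent (s := 1 + ν) (by linarith)
  have hI := Real.integral_rpow_mul_exp_neg_mul_Ioi (a := 1 + ν) (r := 27) (by linarith)
    (by norm_num)
  simp only [add_sub_cancel_left] at hG hI
  have key := MeasureTheory.tendsto_integral_of_dominated_convergence (μ := MeasureTheory.volume)
    (F := fun M : ℕ => (Set.Ioo 0 (M * r0)).indicator (rayF ν M))
    (f := (Set.Ioi (0 : ℝ)).indicator fun x => 36 * Real.pi * Complex.I * ν *
      Real.sin (Real.pi * ν) * ((x ^ ν * Real.exp (-(27 * x)) : ℝ) : ℂ))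
    ((Set.Ioi (0 : ℝ)).indicator fun x => C * (Real.exp (-x) * x ^ ν))
    (fun M => by
      rw [aestronglyMeasurable_indicator_iff measurableSet_Ioo]
      exact (rayF_continuousOn hν (by linarith) M).aestronglyMeasurable measurableSet_Ioo)
    ((MeasureTheory.integrable_indicator_iff measurableSet_Ioi).2 (hG.const_mul C))
    (fun M => Eventually.of_forall fun x => by
      by_cases hx : x ∈ Set.Ioo 0 (M * r0)
      · rw [Set.indicator_of_mem hx, Set.indicator_of_mem (Set.mem_Ioi.2 hx.1)]
        exact hC' M x hx
      · rw [Set.indicator_of_notMem hx, norm_zero]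
        refine Set.indicator_nonneg (fun y hy => ?_) x
        have := Real.rpow_nonneg (Set.mem_Ioi.1 hy).le ν
        positivity)
    (Eventually.of_forall fun x => by
      by_cases hx : 0 < x
      · rw [Set.indicator_of_mem (Set.mem_Ioi.2 hx)]
        refine (tendsto_rayF hν hν' hx).congr' ?_
        filter_upwards [eventually_gt_atTop ⌈x / r0⌉₊] with M hM
        have h1 : x / r0 < M := (Nat.le_ceil _).trans_lt (by exact_mod_cast hM)
        rw [div_lt_iff₀ r0_pos] at h1
        rw [Set.indicator_of_mem (show x ∈ Set.Ioo 0 (M * r0) from ⟨hx, h1⟩)]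
      · rw [Set.indicator_of_notMem (by simpa using hx)]
        refine tendsto_const_nhds.congr fun M => ?_
        rw [Set.indicator_of_notMem fun h => hx h.1])
  simp only [MeasureTheory.integral_indicator measurableSet_Ioo,
    MeasureTheory.integral_indicator measurableSet_Ioi, MeasureTheory.integral_const_mul,
    integral_complex_ofReal, hI] at key
  exact key

lemma add_inv_add_one_ne_zero {γ : ℝ} (h0' : 0 < γ) (h1 : γ < 1 / 2) (hne : γ ≠ 1 / 3) :
    ex γ + (ex γ)⁻¹ + 1 ≠ 0 := by
  intro h
  have hs := ex_ne_zero (γ : ℂ)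
  have h2 : 1 + ex γ + ex γ ^ 2 = 0 := by
    field_simp at h
    linear_combination h
  have h3 : ex (γ : ℂ) ^ 3 = 1 := by linear_combination (ex (γ : ℂ) - 1) * h2
  rw [← ex_three_mul, ex, Complex.exp_eq_one_iff] at h3
  obtain ⟨n, hn⟩ := h3
  have h4 : (3 * γ : ℂ) = n := mul_left_cancel₀ Complex.two_pi_I_ne_zero (by rw [hn]; ring)
  have h5 : 3 * γ = n := by exact_mod_cast h4
  have a : 0 < n := by exact_mod_cast (show (0 : ℝ) < n by linarith)
  have b : n < 2 := by exact_mod_cast (show (n : ℝ) < 2 by linarith)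
  have c : n = 1 := by omega
  rw [c, Int.cast_one] at h5
  exact hne (by linarith)

lemma sin_pi_mul_ne_zero {ν : ℝ} (hν : 0 < ν) (hν' : ν < 3 / 2) (hne : ν ≠ 1) :
    Real.sin (Real.pi * ν) ≠ 0 := by
  intro h
  obtain ⟨n, hn⟩ := Real.sin_eq_zero_iff.1 h
  have h5 : (n : ℝ) = ν := mul_left_cancel₀ Real.pi_ne_zero (by rw [← hn]; ring)
  have a : 0 < n := by exact_mod_cast (show (0 : ℝ) < n by linarith)
  have b : n < 2 := by exact_mod_cast (show (n : ℝ) < 2 by linarith)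
  have c : n = 1 := by omega
  rw [c, Int.cast_one] at h5
  exact hne h5.symm

lemma inv_Gamma_neg {ν : ℝ} (hν : 0 < ν) (hs : Real.sin (Real.pi * ν) ≠ 0) :
    (Real.Gamma (-ν))⁻¹ = -(Real.sin (Real.pi * ν) * Real.Gamma (1 + ν)) / Real.pi := by
  have h := Real.Gamma_mul_Gamma_one_sub (-ν)
  rw [sub_neg_eq_add, mul_neg, Real.sin_neg] at h
  have hG := (Real.Gamma_pos_of_pos (show 0 < 1 + ν by linarith)).ne'
  have hπ := Real.pi_ne_zero
  have hΓ : Real.Gamma (-ν) ≠ 0 := fun h0' => by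
    rw [h0', zero_mul, eq_comm, div_eq_zero_iff] at h
    rcases h with h | h
    · exact hπ h
    · exact hs (neg_eq_zero.1 h)
  rw [eq_div_iff (neg_ne_zero.2 hs)] at h
  rw [eq_div_iff hπ, inv_mul_eq_iff_eq_mul₀ hΓ]
  linear_combination -h

lemma tendsto_walkSum_scaled {γ : ℝ} (h0' : 0 < γ) (h1 : γ < 1 / 2) (hne : γ ≠ 1 / 3) :
    Tendsto (fun M : ℕ => walkSum (3 * M) (wtE (ex γ)) *
      (((M : ℝ) ^ (1 + 3 * γ) : ℝ) : ℂ) / 27 ^ M) atTop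
      (𝓝 (((729 * (3 * γ) * Real.sin (Real.pi * (3 * γ)) * Real.Gamma (1 + 3 * γ) *
        (1 / 27) ^ (1 + 3 * γ) / Real.pi : ℝ) : ℂ) / (ex γ + (ex γ)⁻¹ + 1))) := by
  have hc := add_inv_add_one_ne_zero h0' h1 hne
  have hπ' : (Real.pi : ℂ) ≠ 0 := by exact_mod_cast Real.pi_ne_zero
  have h := (tendsto_integral_rayF (ν := 3 * γ) (by linarith) (by linarith)).const_mul
    (81 * Complex.I / ((2 * Real.pi * Complex.I) ^ 2 * (ex γ + (ex γ)⁻¹ + 1)))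
  have e : 81 * Complex.I / ((2 * Real.pi * Complex.I) ^ 2 * (ex γ + (ex γ)⁻¹ + 1)) *
      (36 * Real.pi * Complex.I * (3 * γ : ℝ) * Real.sin (Real.pi * (3 * γ)) *
        (((1 / 27) ^ (1 + 3 * γ) * Real.Gamma (1 + 3 * γ) : ℝ) : ℂ)) =
      ((729 * (3 * γ) * Real.sin (Real.pi * (3 * γ)) * Real.Gamma (1 + 3 * γ) *
        (1 / 27) ^ (1 + 3 * γ) / Real.pi : ℝ) : ℂ) / (ex γ + (ex γ)⁻¹ + 1) := by
    generalize ex (γ : ℂ) + (ex (γ : ℂ))⁻¹ + 1 = c at hc ⊢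
    generalize Real.sin (Real.pi * (3 * γ)) = S
    generalize Real.Gamma (1 + 3 * γ) = G
    generalize ((1 / 27 : ℝ)) ^ (1 + 3 * γ) = R
    push_cast
    field_simp
    ring
  rw [e] at h
  refine h.congr' ?_
  filter_upwards [eventually_gt_atTop 0] with M hM
  rw [← ray_eq _ hM, walkSum_eq_line h0' (by linarith) hc hM, integral_line_eq_ray h0' h1]
  generalize ex (γ : ℂ) + (ex (γ : ℂ))⁻¹ + 1 = c at hc ⊢
  field_simp

lemma atTop_inf_principal_dvd_le :
    atTop ⊓ 𝓟 {n : ℕ | 3 ∣ n} ≤ map (fun M : ℕ => 3 * M) atTop := by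
  intro s hs
  rw [mem_map, mem_atTop_sets] at hs
  obtain ⟨N, hN⟩ := hs
  rw [mem_inf_principal]
  filter_upwards [eventually_ge_atTop (3 * N)] with n hn hd
  obtain ⟨M, rfl⟩ := hd
  exact hN M (by omega)

end Kreweras

open Filter in
/-- Corollary 4: asymptotics of `v_n = [t^n] Ẽ(t, e^{iα})`. -/
theorem vertex_coefficient_asymptotics
    (α : ℝ) (h0 : 0 < α) (hπ : α < Real.pi) (hne : α ≠ 2 * Real.pi / 3) :
    (∀ n : ℕ, ¬ (3 ∣ n) →
      ∑' k : ℤ, (eVert n k : ℂ) * Complex.exp (Complex.I * α) ^ k = 0) ∧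
    Tendsto (fun n : ℕ =>
        (∑' k : ℤ, (eVert n k : ℂ) * Complex.exp (Complex.I * α) ^ k) /
        (-((3 : ℂ) ^ ((5 : ℂ) - 3 * α / Real.pi) * Complex.exp (Complex.I * α) * α /
            (2 * Real.pi * (1 + Complex.exp (Complex.I * α) + Complex.exp (Complex.I * α) ^ 2) *
              Complex.Gamma (-(3 * α) / (2 * Real.pi)))) *
          (n : ℂ) ^ (-(3 * (α : ℂ)) / (2 * Real.pi) - 1) * 3 ^ n))
      (atTop ⊓ 𝓟 {n : ℕ | 3 ∣ n}) (nhds 1) := by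
  refine ⟨fun n hn => by rw [Kreweras.tsum_eVert, Kreweras.walkSum_wtE_eq_zero n _ hn], ?_⟩
  have hpi := Real.pi_pos
  obtain ⟨γ, hγ⟩ : ∃ γ : ℝ, α = 2 * Real.pi * γ := ⟨α / (2 * Real.pi), by field_simp⟩
  have hγ0 : 0 < γ := by
    rw [hγ] at h0
    exact pos_of_mul_pos_right h0 (by positivity)
  have hγ1 : γ < 1 / 2 := by
    rw [hγ] at hπ
    by_contra hcon
    nlinarith
  have hγ3 : γ ≠ 1 / 3 := by
    rintro rfl
    exact hne (by rw [hγ]; ring)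
  have hex : Complex.exp (Complex.I * α) = Kreweras.ex γ := by
    rw [Kreweras.ex, hγ]
    congr 1
    push_cast
    ring
  have hlim := Kreweras.tendsto_walkSum_scaled hγ0 hγ1 hγ3
  have hc := Kreweras.add_inv_add_one_ne_zero hγ0 hγ1 hγ3
  have hsin := Kreweras.sin_pi_mul_ne_zero (ν := 3 * γ) (by linarith) (by linarith)
    (fun h => hγ3 (by linarith))
  have hG := Real.Gamma_pos_of_pos (show 0 < 1 + 3 * γ by linarith)
  have hΓ := Kreweras.inv_Gamma_neg (ν := 3 * γ) (by linarith) hsin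
  have hR : (0 : ℝ) < (1 / 27) ^ (1 + 3 * γ) := by positivity
  simp only [Kreweras.tsum_eVert, hex]
  set s := Kreweras.ex (γ : ℂ) with hs
  set L : ℝ := 729 * (3 * γ) * Real.sin (Real.pi * (3 * γ)) * Real.Gamma (1 + 3 * γ) *
        (1 / 27) ^ (1 + 3 * γ) / Real.pi with hL
  have hL0 : L ≠ 0 := by
    rw [hL]
    refine div_ne_zero (mul_ne_zero (mul_ne_zero (mul_ne_zero ?_ hsin) hG.ne') hR.ne') hpi.ne'
    positivity
  have hL' : (L : ℂ) / (s + s⁻¹ + 1) ≠ 0 := div_ne_zero (by exact_mod_cast hL0) hc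
  refine Tendsto.mono_left ?_ Kreweras.atTop_inf_principal_dvd_le
  rw [tendsto_map'_iff]
  have hone := hlim.div_const ((L : ℂ) / (s + s⁻¹ + 1))
  rw [div_self hL'] at hone
  refine hone.congr' ?_
  filter_upwards [eventually_gt_atTop 0] with M hM
  have hM' : (0 : ℝ) < M := by exact_mod_cast hM
  have hπc : (Real.pi : ℂ) ≠ 0 := by exact_mod_cast Real.pi_ne_zero
  have e1 : (3 : ℂ) ^ ((5 : ℂ) - 3 * α / Real.pi) = ((3 ^ (5 - 2 * (3 * γ)) : ℝ) : ℂ) := by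
    rw [Complex.ofReal_cpow (by norm_num)]
    congr 1
    rw [hγ]
    push_cast
    field_simp
  have e2 : ((3 * M : ℕ) : ℂ) ^ (-(3 * (α : ℂ)) / (2 * Real.pi) - 1) =
      (((3 * M : ℝ) ^ (-(1 + 3 * γ)) : ℝ) : ℂ) := by
    rw [Complex.ofReal_cpow (by positivity)]
    congr 1
    · push_cast; rfl
    · rw [hγ]
      push_cast
      field_simp
      ring
  have e3 : Complex.Gamma (-(3 * α) / (2 * Real.pi)) = ((Real.Gamma (-(3 * γ)) : ℝ) : ℂ) := by
    rw [← Complex.Gamma_ofReal]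
    congr 1
    rw [hγ]
    push_cast
    field_simp
  have hs0 : s ≠ 0 := Kreweras.ex_ne_zero _
  have e4 : 1 + s + s ^ 2 = s * (s + s⁻¹ + 1) := by
    field_simp
    ring
  have e5 : (3 : ℂ) ^ (3 * M) = 27 ^ M := by rw [pow_mul]; norm_num
  have e6 : -((3 ^ (5 - 2 * (3 * γ)) : ℝ) * γ * (Real.Gamma (-(3 * γ)))⁻¹) *
      (3 * M : ℝ) ^ (-(1 + 3 * γ)) = L * ((M : ℝ) ^ (1 + 3 * γ))⁻¹ := by
    have f1 : (3 * M : ℝ) ^ (-(1 + 3 * γ)) = (3 ^ (1 + 3 * γ))⁻¹ * ((M : ℝ) ^ (1 + 3 * γ))⁻¹ := by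
      rw [Real.mul_rpow (by norm_num) hM'.le, Real.rpow_neg (by norm_num), Real.rpow_neg hM'.le]
    have f2 : (3 : ℝ) ^ (5 - 2 * (3 * γ)) = 3 ^ 7 * ((3 ^ (1 + 3 * γ)) ^ 2)⁻¹ := by
      rw [← Real.rpow_natCast _ 2, ← Real.rpow_mul (by norm_num), ← Real.rpow_neg (by norm_num),
        ← Real.rpow_natCast 3 7, ← Real.rpow_add (by norm_num)]
      congr 1
      push_cast
      ring
    have f3 : (1 / 27 : ℝ) ^ (1 + 3 * γ) = ((3 ^ (1 + 3 * γ)) ^ 3)⁻¹ := by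
      rw [← Real.rpow_natCast _ 3, ← Real.rpow_mul (by norm_num), mul_comm (1 + 3 * γ),
        Real.rpow_mul (by norm_num), one_div, Real.inv_rpow (by norm_num)]
      norm_num
    rw [f1, f2, hΓ, hL, f3]
    have : (0 : ℝ) < 3 ^ (1 + 3 * γ) := by positivity
    field_simp
    ring
  have e7 : -((3 ^ (5 - 2 * (3 * γ)) : ℝ) * s * α / (2 * Real.pi * (s * (s + s⁻¹ + 1)) *
      (Real.Gamma (-(3 * γ)) : ℝ))) * (((3 * M : ℝ) ^ (-(1 + 3 * γ)) : ℝ) : ℂ) =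
      (L : ℂ) * (((M : ℝ) ^ (1 + 3 * γ) : ℝ) : ℂ)⁻¹ / (s + s⁻¹ + 1) := by
    rw [← Complex.ofReal_inv, ← Complex.ofReal_mul, ← e6, hγ]
    generalize s + s⁻¹ + 1 = c at hc ⊢
    push_cast
    field_simp
  have hMν : (((M : ℝ) ^ (1 + 3 * γ) : ℝ) : ℂ) ≠ 0 := by
    exact_mod_cast (Real.rpow_pos_of_pos hM' _).ne'
  simp only [Function.comp]
  rw [e1, e2, e3, e4, e5, e7]
  have hLc : (L : ℂ) ≠ 0 := by exact_mod_cast hL0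
  generalize s + s⁻¹ + 1 = c at hc ⊢
  field_simp
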